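/- Let q be a positive rational number and consider L(q) = 2^{1/q}·B(1/2, 1/(2q)), where B(a,b) = Γ(a)Γ(b)/Γ(a+b); up to a positive integer factor, L(q) is the total length of the sinusoidal spiral with polar equation r^q = 2cos(qθ). Then L(q) is algebraic over ℚ if and only if 1/q is an even positive integer (i.e. q = 1/(2k) for some positive integer k). Explicitly: if q = 1/(2k) then B(1/2, k) = (k−1)!/((1/2)(3/2)⋯(k−1/2)) is rational; if q = 1/(2k+1) then B(1/2, (2k+1)/2) = π·(1/2)(3/2)⋯(k−1/2)/k! is a rational multiple of π, hence transcendental; and for all other positive rational q, L(q) is transcendental. -/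

import Mathlib

section

open Polynomial

theorem no_rational_solution_aux {F : Type*} [Field F] [IsAlgClosed F] [CharZero F] (a e : F)
    (h0 : a ≠ 0) (hk : ∀ k : ℕ, 0 < k → 2 * (k : F) + a ≠ 0) (hD : ∀ k : ℕ, 2 ≤ k → a ≠ k)
    (he : e ≠ 0) (g h : F[X]) (hg : g ≠ 0) (hc : IsCoprime g h)
    (H : (1 - X ^ 2) * (g * derivative h - derivative g * h) + C a * X * g * h
      + C e * (1 - X ^ 2) * g ^ 2 = 0) : False := by
  by_cases hdeg : g.degree = 0
  · obtain ⟨γ, hγ⟩ : ∃ γ, g = C γ := ⟨_, eq_C_of_degree_eq_zero hdeg⟩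
    have hγ0 : γ ≠ 0 := by rintro rfl; simp [hγ] at hg
    subst hγ
    have H1 : (1 - X ^ 2) * derivative h + C a * X * h + C (e * γ) * (1 - X ^ 2) = 0 := by
      have : C γ * ((1 - X ^ 2) * derivative h + C a * X * h + C (e * γ) * (1 - X ^ 2)) = 0 := by
        rw [← H]; simp only [derivative_C, C_mul]; ring
      exact (mul_eq_zero.1 this).resolve_left hg
    have e1 : h.eval 1 = 0 := by
      have := congrArg (eval 1) H1
      simpa [h0] using this
    have e2 : h.eval (-1) = 0 := by
      have := congrArg (eval (-1)) H1
      simpa [h0] using this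
    by_cases hd : 2 ≤ h.natDegree
    · have := congrArg (fun p => coeff p (h.natDegree + 1)) H1
      obtain ⟨D, hDD⟩ : ∃ D, h.natDegree = D + 2 := ⟨h.natDegree - 2, by omega⟩
      have hl : h.coeff (D + 2) ≠ 0 := by
        rw [← hDD]; simp only [coeff_natDegree]; intro h'
        rw [leadingCoeff_eq_zero] at h'; simp [h'] at hDD
      have hz : h.coeff (D + 4) = 0 := coeff_eq_zero_of_natDegree_lt (by omega)
      have hx : ((1 - X ^ 2) * derivative h).coeff (D + 3) = - (h.coeff (D + 2) * (D + 2)) := by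
        have : (1 - X ^ 2) * derivative h = derivative h - derivative h * X ^ 2 := by ring
        rw [this, coeff_sub, coeff_mul_X_pow', if_pos (by omega), coeff_derivative, hz]
        rw [show D + 3 - 2 = D + 1 by omega, coeff_derivative]; push_cast; ring
      have hy : (C a * X * h).coeff (D + 3) = a * h.coeff (D + 2) := by
        rw [mul_assoc, coeff_C_mul, show D + 3 = (D + 2) + 1 from rfl, coeff_X_mul]
      have hw : (C (e * γ) * (1 - X ^ 2)).coeff (D + 3) = 0 := by
        rw [coeff_C_mul, coeff_sub, coeff_one, coeff_X_pow]; simp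
      rw [hDD] at this
      simp only [coeff_add, hx, hy, hw, coeff_zero] at this
      have h2 : (a - (D + 2)) * h.coeff (D + 2) = 0 := by linear_combination this
      rcases mul_eq_zero.1 h2 with h3 | h3
      · refine hD (D + 2) (by omega) ?_
        push_cast; linear_combination h3
      · exact hl h3
    · have hlin := eq_X_add_C_of_natDegree_le_one (p := h) (by omega)
      rw [hlin] at e1 e2
      simp only [eval_add, eval_mul, eval_C, eval_X] at e1 e2
      have h1 : h.coeff 0 = 0 := by
        have : 2 * h.coeff 0 = 0 := by linear_combination e1 + e2
        simpa using this
      have h2 : h.coeff 1 = 0 := by linear_combination e1 - h1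
      rw [h1, h2] at hlin
      simp only [C_0, zero_mul, add_zero] at hlin
      rw [hlin] at H1
      have := congrArg (eval 0) H1
      simp [he, hγ0] at this
  · obtain ⟨b, hb⟩ := IsAlgClosed.exists_root g hdeg
    obtain ⟨q, hq, hqb⟩ := exists_eq_pow_rootMultiplicity_mul_and_not_dvd g hg b
    have hkpos : 0 < g.rootMultiplicity b := (rootMultiplicity_pos hg).2 hb
    obtain ⟨k, hkk⟩ : ∃ k, g.rootMultiplicity b = k + 1 := ⟨_, (Nat.sub_add_cancel hkpos).symm⟩
    rw [hkk] at hq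
    have hq0 : q.eval b ≠ 0 := fun h' => hqb (dvd_iff_isRoot.2 h')
    have hh0 : h.eval b ≠ 0 := by
      intro h'
      obtain ⟨u, v, huv⟩ := hc
      have := congrArg (eval b) huv
      simp [h', hb.eq_zero] at this
    have hder : derivative g = (X - C b) ^ k * (C ((k : F) + 1) * q + (X - C b) * derivative q) := by
      rw [hq, derivative_mul, derivative_X_sub_C_pow]; simp; ring
    have hXb : (X - C b) ≠ 0 := X_sub_C_ne_zero b
    have H2 : (1 - X ^ 2) * ((X - C b) * q * derivative h
        - (C ((k : F) + 1) * q + (X - C b) * derivative q) * h) + C a * X * (X - C b) * q * h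
        + C e * (1 - X ^ 2) * (X - C b) ^ (k + 2) * q ^ 2 = 0 := by
      have : (X - C b) ^ k * ((1 - X ^ 2) * ((X - C b) * q * derivative h
        - (C ((k : F) + 1) * q + (X - C b) * derivative q) * h) + C a * X * (X - C b) * q * h
        + C e * (1 - X ^ 2) * (X - C b) ^ (k + 2) * q ^ 2) = 0 := by
        rw [← H, hder, hq]; ring
      exact (mul_eq_zero.1 this).resolve_left (pow_ne_zero _ hXb)
    have hk1 : (k : F) + 1 ≠ 0 := Nat.cast_add_one_ne_zero k
    have hb1 : b ^ 2 = 1 := by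
      have := congrArg (eval b) H2
      simp [hq0, hh0, hk1] at this
      linear_combination -this
    have hX2 : (1 - X ^ 2 : F[X]) = - ((X - C b) * (X + C b)) := by
      have : (C b : F[X]) ^ 2 = 1 := by rw [← C_pow, hb1, C_1]
      linear_combination -this
    have H3 : - (X + C b) * ((X - C b) * q * derivative h
        - (C ((k : F) + 1) * q + (X - C b) * derivative q) * h) + C a * X * q * h
        - C e * (X + C b) * (X - C b) ^ (k + 2) * q ^ 2 = 0 := by
      have : (X - C b) * (- (X + C b) * ((X - C b) * q * derivative h
        - (C ((k : F) + 1) * q + (X - C b) * derivative q) * h) + C a * X * q * h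
        - C e * (X + C b) * (X - C b) ^ (k + 2) * q ^ 2) = 0 := by
        rw [← H2, hX2]; ring
      exact (mul_eq_zero.1 this).resolve_left hXb
    have := congrArg (eval b) H3
    simp at this
    have hb0 : b ≠ 0 := by rintro rfl; simp at hb1
    have h5 : (b * q.eval b * h.eval b) * (2 * ((k + 1 : ℕ) : F) + a) = 0 := by
      push_cast; linear_combination this
    exact (mul_ne_zero (mul_ne_zero (mul_ne_zero hb0 hq0) hh0) (hk _ k.succ_pos)) h5

theorem no_rational_solution {F : Type*} [Field F] [IsAlgClosed F] [CharZero F] (a e : F)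
    (h0 : a ≠ 0) (hk : ∀ k : ℕ, 0 < k → 2 * (k : F) + a ≠ 0) (hD : ∀ k : ℕ, 2 ≤ k → a ≠ k)
    (he : e ≠ 0) (g h : F[X]) (hg : g ≠ 0)
    (H : (1 - X ^ 2) * (g * derivative h - derivative g * h) + C a * X * g * h
      + C e * (1 - X ^ 2) * g ^ 2 = 0) : False := by
  classical
  obtain ⟨g', h', hc, hgg, hhh⟩ : ∃ g' h', IsCoprime g' h' ∧ g = EuclideanDomain.gcd g h * g' ∧
      h = EuclideanDomain.gcd g h * h' := by
    obtain ⟨g', hg'⟩ := EuclideanDomain.gcd_dvd_left g h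
    obtain ⟨h', hh'⟩ := EuclideanDomain.gcd_dvd_right g h
    refine ⟨g', h', ?_, hg', hh'⟩
    have hd0 : EuclideanDomain.gcd g h ≠ 0 := by
      intro h''; rw [h'', zero_mul] at hg'; exact hg hg'
    have hb := EuclideanDomain.gcd_eq_gcd_ab g h
    refine ⟨EuclideanDomain.gcdA g h, EuclideanDomain.gcdB g h, mul_left_cancel₀ hd0 ?_⟩
    linear_combination EuclideanDomain.gcdA g h * -hg' + EuclideanDomain.gcdB g h * -hh' - hb
  have hg0 : g' ≠ 0 := by rintro rfl; simp at hgg; exact hg hgg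
  generalize EuclideanDomain.gcd g h = d at hgg hhh
  have hd0 : d ≠ 0 := by rintro rfl; simp at hgg; exact hg hgg
  refine no_rational_solution_aux a e h0 hk hD he g' h' hg0 hc ?_
  have : d ^ 2 * ((1 - X ^ 2) * (g' * derivative h' - derivative g' * h') + C a * X * g' * h'
      + C e * (1 - X ^ 2) * g' ^ 2) = 0 := by
    rw [← H, hgg, hhh]; simp only [derivative_mul]; ring
  exact (mul_eq_zero.1 this).resolve_left (pow_ne_zero _ hd0)

end

section

open Polynomial

/-- Coefficientwise form of `(1-x²)∂ₓ + ((1-x²) - a x Y)∂_Y` on polynomials in `Y`. -/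
noncomputable def odeDer {F : Type*} [Field F] (a : F) (G : ℕ → F[X]) (j : ℕ) : F[X] :=
  (1 - X ^ 2) * derivative (G j) + ((j : F[X]) + 1) * ((1 - X ^ 2) * G (j + 1)) - C a * X * (j : F[X]) * G j

section
variable {F : Type*} [Field F]

theorem odeDer_add (a : F) (G H : ℕ → F[X]) : odeDer a (G + H) = odeDer a G + odeDer a H := by
  ext1 j; simp only [odeDer, Pi.add_apply, derivative_add]; ring

theorem odeDer_smul (a : F) (c : F[X]) (G : ℕ → F[X]) :
    odeDer a (c • G) = ((1 - X ^ 2) * derivative c) • G + c • odeDer a G := by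
  ext1 j; simp only [odeDer, Pi.add_apply, Pi.smul_apply, smul_eq_mul, derivative_mul]; ring

theorem odeDer_sum (a : F) {ι : Type*} (s : Finset ι) (G : ι → ℕ → F[X]) :
    odeDer a (∑ i ∈ s, G i) = ∑ i ∈ s, odeDer a (G i) := by
  classical
  induction s using Finset.induction_on with
  | empty => ext1 j; simp [odeDer]
  | insert i s hi ih => rw [Finset.sum_insert hi, odeDer_add, ih, Finset.sum_insert hi]

theorem odeDer_supp (a : F) (d : ℕ) (G : ℕ → F[X]) (hG : ∀ j, d < j → G j = 0) :
    ∀ j, d < j → odeDer a G j = 0 := by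
  intro j hj
  simp [odeDer, hG j hj, hG (j + 1) (by omega)]

theorem odeDer_iter_supp (a : F) (d : ℕ) (G : ℕ → F[X]) (hG : ∀ j, d < j → G j = 0) (i : ℕ) :
    ∀ j, d < j → (odeDer a)^[i] G j = 0 := by
  induction i with
  | zero => simpa
  | succ i ih => rw [Function.iterate_succ_apply']; exact odeDer_supp a d _ ih

theorem odeDer_natDegree (a : F) (A : ℕ) (G : ℕ → F[X]) (hG : ∀ j, (G j).natDegree ≤ A) (j : ℕ) :
    (odeDer a G j).natDegree ≤ A + 2 := by
  have h2 : (1 - X ^ 2 : F[X]).natDegree ≤ 2 := by compute_degree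
  unfold odeDer
  refine (natDegree_sub_le _ _).trans (max_le ((natDegree_add_le _ _).trans (max_le ?_ ?_)) ?_)
  · refine natDegree_mul_le.trans ?_
    have := natDegree_derivative_le (G j)
    have := hG j; omega
  · refine natDegree_mul_le.trans ?_
    have h3 : ((j : F[X]) + 1).natDegree = 0 := by
      rw [← Nat.cast_succ]; exact natDegree_natCast _
    have := natDegree_mul_le (p := (1 - X ^ 2 : F[X])) (q := G (j + 1))
    have := hG (j + 1)
    omega
  · refine natDegree_mul_le.trans ?_
    have : (C a * X * (j : F[X])).natDegree ≤ 1 := by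
      rw [← C_eq_natCast]; compute_degree
    have := hG j; omega

theorem odeDer_iter_natDegree (a : F) (A : ℕ) (G : ℕ → F[X]) (hG : ∀ j, (G j).natDegree ≤ A)
    (i : ℕ) : ∀ j, ((odeDer a)^[i] G j).natDegree ≤ A + 2 * i := by
  induction i with
  | zero => simpa
  | succ i ih => rw [Function.iterate_succ_apply']; exact odeDer_natDegree a _ _ ih

/-- A family of `d+1` vectors supported on `{0,…,d}` with distinct leading positions cannot lie, up
to nonzero scalars, in the span of `r ≤ d` elements. -/
theorem exists_missing (d r : ℕ) (hr : r ≤ d) (Q : ℕ → ℕ → F[X]) (G : ℕ → ℕ → F[X])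
    (hG : ∀ f ≤ d, G f f ≠ 0 ∧ (∀ j, f < j → G f j = 0))
    (hs : ∀ f ≤ d, ∃ v : F[X], v ≠ 0 ∧ ∃ c : ℕ → F[X], v • G f = ∑ i ∈ Finset.range r, c i • Q i) :
    False := by
  classical
  have hs' : ∀ f, ∃ v : F[X], ∃ c : ℕ → F[X], f ≤ d →
      v ≠ 0 ∧ v • G f = ∑ i ∈ Finset.range r, c i • Q i := by
    intro f
    by_cases hf : f ≤ d
    · obtain ⟨v, hv, c, hc⟩ := hs f hf
      exact ⟨v, c, fun _ => ⟨hv, hc⟩⟩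
    · exact ⟨0, 0, fun h => absurd h hf⟩
  choose v c hvc using hs'
  let M : Matrix (Fin (d + 1)) (Fin (d + 1)) F[X] := fun f i => if (i : ℕ) < r then c f i else 0
  have hM : M.det = 0 := Matrix.det_eq_zero_of_column_eq_zero (Fin.last d) (by
    intro i; simp [M]; omega)
  obtain ⟨u, hu, huM⟩ := Matrix.exists_vecMul_eq_zero_iff.2 hM
  have hsum : ∑ f : Fin (d + 1), (u f * v f) • G f = 0 := by
    have : ∀ f : Fin (d + 1), (u f * v f) • G f
        = ∑ i : Fin (d + 1), (u f * M f i) • Q i := by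
      intro f
      rw [mul_smul, (hvc f (by omega)).2, Finset.smul_sum, Fin.sum_univ_eq_sum_range
        (fun i => (u f * (if i < r then c f i else 0)) • Q i) (d + 1)]
      rw [← Finset.sum_subset (Finset.range_subset_range.2 (show r ≤ d + 1 by omega))]
      · refine Finset.sum_congr rfl fun i hi => ?_
        rw [if_pos (by simpa using hi), mul_smul]
      · intro i _ hi
        have : ¬ i < r := by simpa using hi
        simp [this]
    rw [Finset.sum_congr rfl fun f _ => this f, Finset.sum_comm]
    refine Finset.sum_eq_zero fun i _ => ?_
    rw [← Finset.sum_smul]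
    have := congrFun huM i
    simp only [Matrix.vecMul, dotProduct, Pi.zero_apply] at this
    rw [this, zero_smul]
  obtain ⟨f, hf, hmax⟩ := (Finset.univ.filter (fun f => u f ≠ 0)).exists_max_image id (by
    obtain ⟨f, hf⟩ := Function.ne_iff.1 hu
    exact ⟨f, by simpa using hf⟩)
  have h1 := congrFun hsum f
  rw [Finset.sum_apply, Finset.sum_eq_single f] at h1
  · simp only [Pi.smul_apply, smul_eq_mul, Pi.zero_apply, mul_eq_zero] at h1
    rcases h1 with (h1 | h1) | h1
    · exact (by simpa using hf : u f ≠ 0) h1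
    · exact (hvc f (by omega)).1 h1
    · exact (hG f (by omega)).1 h1
  · intro g _ hgf
    by_cases hug : u g = 0
    · simp [hug]
    · have := hmax g (by simpa using hug)
      have hlt : g < f := lt_of_le_of_ne this hgf
      simp [(hG g (by omega)).2 f hlt]
  · simp

theorem iterates_independent [IsAlgClosed F] [CharZero F] (a : F)
    (h0 : a ≠ 0) (hk : ∀ k : ℕ, 0 < k → 2 * (k : F) + a ≠ 0) (hD : ∀ k : ℕ, 2 ≤ k → a ≠ k)
    (d : ℕ) (Q : ℕ → F[X]) (hQ : Q d ≠ 0) (hQs : ∀ j, d < j → Q j = 0)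
    (v : ℕ → F[X]) (r : ℕ) (hr : r ≤ d) (hv : v r ≠ 0)
    (hsum : ∑ i ∈ Finset.range (r + 1), v i • (odeDer a)^[i] Q = 0) : False := by
  classical
  set q : ℕ → ℕ → F[X] := fun i => (odeDer a)^[i] Q with hq
  let S : Submodule F[X] (ℕ → F[X]) := Submodule.span F[X] (q '' (Finset.range r : Set ℕ))
  have hS : ∀ G ∈ S, ∃ c : ℕ → F[X], G = ∑ i ∈ Finset.range r, c i • q i := by
    intro G hG
    obtain ⟨c, hc⟩ := (Submodule.mem_span_image_finset_iff_exists_fun' F[X]).1 hG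
    exact ⟨c, hc.symm⟩
  have hqS : ∀ i < r, q i ∈ S := fun i hi => Submodule.subset_span ⟨i, by simpa using hi, rfl⟩
  have hrS : v r • q r ∈ S := by
    rw [Finset.sum_range_succ] at hsum
    rw [eq_neg_of_add_eq_zero_right hsum]
    exact S.neg_mem (S.sum_mem fun i hi => S.smul_mem _ (hqS i (by simpa using hi)))
  -- saturation
  let W : Set (ℕ → F[X]) := {G | ∃ w : F[X], w ≠ 0 ∧ w • G ∈ S}
  have hW0 : ∀ G ∈ S, G ∈ W := fun G hG => ⟨1, one_ne_zero, by simpa⟩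
  have hWadd : ∀ G ∈ W, ∀ H ∈ W, G + H ∈ W := by
    rintro G ⟨w, hw, hG⟩ H ⟨w', hw', hH⟩
    refine ⟨w * w', mul_ne_zero hw hw', ?_⟩
    rw [smul_add]
    refine S.add_mem ?_ ?_
    · rw [mul_comm, mul_smul]; exact S.smul_mem _ hG
    · rw [mul_smul]; exact S.smul_mem _ hH
  have hWsmul : ∀ c : F[X], ∀ G ∈ W, c • G ∈ W := by
    rintro c G ⟨w, hw, hG⟩
    refine ⟨w, hw, ?_⟩
    rw [smul_comm]; exact S.smul_mem _ hG
  have hWdiv : ∀ c : F[X], c ≠ 0 → ∀ G, c • G ∈ W → G ∈ W := by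
    rintro c hc G ⟨w, hw, hG⟩
    exact ⟨w * c, mul_ne_zero hw hc, by rwa [mul_smul]⟩
  have hqW : ∀ i ≤ r, q i ∈ W := by
    intro i hi
    rcases hi.lt_or_eq with h | rfl
    · exact hW0 _ (hqS i h)
    · exact ⟨v i, hv, hrS⟩
  have hWder : ∀ G ∈ W, odeDer a G ∈ W := by
    rintro G ⟨w, hw, hG⟩
    obtain ⟨c, hc⟩ := hS _ hG
    have h1 := congrArg (odeDer a) hc
    rw [odeDer_smul, odeDer_sum] at h1
    refine hWdiv w hw _ ?_
    rw [eq_sub_of_add_eq' h1, sub_eq_add_neg, ← neg_one_smul F[X]]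
    refine hWadd _ ?_ _ (hWsmul _ _ (hWsmul _ _ ⟨w, hw, hG⟩))
    have : ∀ s : Finset ℕ, s ⊆ Finset.range r → ∑ i ∈ s, odeDer a (c i • q i) ∈ W := by
      intro s
      induction s using Finset.induction_on with
      | empty => intro _; exact hW0 _ (by simp)
      | insert i s hi ih =>
        intro hs
        rw [Finset.sum_insert hi]
        refine hWadd _ ?_ _ (ih fun j hj => hs (Finset.mem_insert_of_mem hj))
        have hir : i < r := by simpa using hs (Finset.mem_insert_self i s)
        rw [odeDer_smul]
        refine hWadd _ (hWsmul _ _ (hqW i hir.le)) _ (hWsmul _ _ ?_)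
        have : odeDer a (q i) = q (i + 1) := (Function.iterate_succ_apply' _ _ _).symm
        rw [this]
        exact hqW _ hir
    exact this _ subset_rfl
  have hWsupp : ∀ G ∈ W, ∀ j, d < j → G j = 0 := by
    rintro G ⟨w, hw, hG⟩ j hj
    obtain ⟨c, hc⟩ := hS _ hG
    have h1 := congrFun hc j
    rw [Finset.sum_apply, Finset.sum_eq_zero] at h1
    · simpa [hw] using h1
    · intro i _
      simp [hq, odeDer_iter_supp a d Q hQs i j hj]
  have hstep : ∀ f, f + 1 ≤ d → (∃ G ∈ W, G (f + 1) ≠ 0 ∧ ∀ j, f + 1 < j → G j = 0) →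
      ∃ G ∈ W, G f ≠ 0 ∧ ∀ j, f < j → G j = 0 := by
    rintro f - ⟨G, hG, hg0, hgs⟩
    by_contra hcon
    push Not at hcon
    set g := G (f + 1) with hg
    let c := (1 - X ^ 2) * derivative g - C a * X * ((f + 1 : ℕ) : F[X]) * g
    have hH : (g • odeDer a G + (-c) • G) ∈ W :=
      hWadd _ (hWsmul _ _ (hWder G hG)) _ (hWsmul _ _ hG)
    have hHs : ∀ j, f < j → (g • odeDer a G + (-c) • G) j = 0 := by
      intro j hj
      rcases (Nat.succ_le_of_lt hj).lt_or_eq with h | rfl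
      · simp [odeDer, hgs j h, hgs (j + 1) (by omega)]
      · simp only [Pi.add_apply, Pi.smul_apply, smul_eq_mul, odeDer, hgs (f + 1 + 1) (by omega), c,
          Nat.succ_eq_add_one, ← hg]
        ring
    have hHf : (g • odeDer a G + (-c) • G) f = 0 := by
      by_contra h
      obtain ⟨j, hj, hj'⟩ := hcon _ hH h
      exact hj' (hHs j hj)
    refine no_rational_solution a ((f : F) + 1) h0 hk hD (Nat.cast_add_one_ne_zero f) g (G f) hg0 ?_
    rw [← hHf]
    simp only [Pi.add_apply, Pi.smul_apply, smul_eq_mul, odeDer, c, ← hg]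
    push_cast
    simp only [C_add, C_1, map_natCast]
    ring
  have hall : ∀ k, k ≤ d → ∃ G ∈ W, G (d - k) ≠ 0 ∧ ∀ j, d - k < j → G j = 0 := by
    intro k
    induction k with
    | zero => intro _; exact ⟨Q, hqW 0 (by omega), hQ, hQs⟩
    | succ k ih =>
      intro hk
      refine hstep (d - (k + 1)) (by omega) ?_
      rw [show d - (k + 1) + 1 = d - k by omega]
      exact ih (by omega)
  have hall' : ∀ f, ∃ G, f ≤ d → G ∈ W ∧ G f ≠ 0 ∧ ∀ j, f < j → G j = 0 := by
    intro f
    by_cases hf : f ≤ d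
    · obtain ⟨G, hG⟩ := hall (d - f) (by omega)
      rw [show d - (d - f) = f by omega] at hG
      exact ⟨G, fun _ => hG⟩
    · exact ⟨0, fun h => absurd h hf⟩
  choose G hG using hall'
  refine exists_missing d r hr q G (fun f hf => (hG f hf).2) fun f hf => ?_
  obtain ⟨w, hw, h⟩ := (hG f hf).1
  exact ⟨w, hw, hS _ h⟩
end

end

section

open Polynomial

section
variable {F : Type*} [Field F]

/-- Evaluation of the first `d+1` coefficients at a power series. -/
noncomputable def evalSer (d : ℕ) (G : ℕ → F[X]) (V : PowerSeries F) : PowerSeries F :=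
  ∑ j ∈ Finset.range (d + 1), (G j : PowerSeries F) * V ^ j

theorem evalSer_odeDer (a : F) (d : ℕ) (G : ℕ → F[X]) (hG : ∀ j, d < j → G j = 0)
    (V : PowerSeries F) (hV : (1 - PowerSeries.X ^ 2) * PowerSeries.derivative F V
      = (1 - PowerSeries.X ^ 2) - PowerSeries.C a * PowerSeries.X * V) :
    evalSer d (odeDer a G) V
      = (1 - PowerSeries.X ^ 2) * PowerSeries.derivative F (evalSer d G V) := by
  have key : ∀ j, (1 - PowerSeries.X ^ 2) * PowerSeries.derivative F ((G j : PowerSeries F) * V ^ j)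
      = ((((1 - X ^ 2) * derivative (G j) - C a * X * (j : F[X]) * G j : F[X])) : PowerSeries F)
          * V ^ j + (((j : F[X]) * ((1 - X ^ 2) * G j) : F[X]) : PowerSeries F) * V ^ (j - 1) := by
    intro j
    have h1 : PowerSeries.derivative F ((G j : PowerSeries F)) = ((derivative (G j) : F[X]) : PowerSeries F) :=
      PowerSeries.derivative_coe _
    simp only [Derivation.leibniz, Derivation.leibniz_pow, h1, smul_eq_mul, nsmul_eq_mul]
    have hc : (((j : F[X])) : PowerSeries F) = (j : PowerSeries F) :=
      map_natCast (coeToPowerSeries.ringHom (R := F)) j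
    push_cast
    rw [hc]
    rcases j with _ | j
    · simp
    · simp only [Nat.add_sub_cancel]
      linear_combination (G (j + 1) : PowerSeries F) * ((j + 1 : ℕ) : PowerSeries F) * V ^ j * hV
  unfold evalSer
  rw [map_sum, Finset.mul_sum, Finset.sum_congr rfl fun j _ => key j, Finset.sum_add_distrib,
    Finset.sum_range_succ' (fun j => (((j : F[X]) * ((1 - X ^ 2) * G j) : F[X]) : PowerSeries F)
      * V ^ (j - 1))]
  have h2 : ∑ j ∈ Finset.range d, ((((j + 1 : ℕ) : F[X]) * ((1 - X ^ 2) * G (j + 1)) : F[X]) : PowerSeries F)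
      * V ^ (j + 1 - 1) = ∑ j ∈ Finset.range (d + 1),
        ((((j + 1 : ℕ) : F[X]) * ((1 - X ^ 2) * G (j + 1)) : F[X]) : PowerSeries F) * V ^ j := by
    rw [Finset.sum_range_succ _ d, hG (d + 1) (by omega)]
    simp
  rw [h2]
  simp only [Nat.cast_zero, zero_mul, Polynomial.coe_zero, add_zero]
  rw [← Finset.sum_add_distrib]
  refine Finset.sum_congr rfl fun j _ => ?_
  rw [← add_mul, ← Polynomial.coe_add]
  congr 2
  unfold odeDer
  push_cast; ring

theorem X_pow_dvd_derivative {g : PowerSeries F} {T : ℕ} (h : PowerSeries.X ^ T ∣ g) :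
    PowerSeries.X ^ (T - 1) ∣ PowerSeries.derivative F g := by
  obtain ⟨k, rfl⟩ := h
  rcases T with _ | T
  · simp
  · rw [Derivation.leibniz, Derivation.leibniz_pow]
    simp only [Nat.add_sub_cancel, smul_eq_mul, nsmul_eq_mul]
    refine dvd_add (Dvd.dvd.mul_right (pow_dvd_pow _ (by omega)) _) ?_
    exact ⟨k * (((T + 1 : ℕ) : PowerSeries F) * PowerSeries.derivative F PowerSeries.X), by ring⟩

theorem zero_estimate [IsAlgClosed F] [CharZero F] (a : F)
    (h0 : a ≠ 0) (hk : ∀ k : ℕ, 0 < k → 2 * (k : F) + a ≠ 0) (hD : ∀ k : ℕ, 2 ≤ k → a ≠ k)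
    (V : PowerSeries F) (hV : (1 - PowerSeries.X ^ 2) * PowerSeries.derivative F V
      = (1 - PowerSeries.X ^ 2) - PowerSeries.C a * PowerSeries.X * V)
    (d A T : ℕ) (G : ℕ → F[X]) (hG : G d ≠ 0) (hGs : ∀ j, d < j → G j = 0)
    (hA : ∀ j, (G j).natDegree ≤ A) (hT : PowerSeries.X ^ T ∣ evalSer d G V) :
    T ≤ d + (d + 1) * (A + 2 * d) := by
  classical
  let M : Matrix (Fin (d + 1)) (Fin (d + 1)) F[X] := fun i j => (odeDer a)^[i] G j
  have hdiv : ∀ i, PowerSeries.X ^ (T - i) ∣ evalSer d ((odeDer a)^[i] G) V := by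
    intro i
    induction i with
    | zero => simpa
    | succ i ih =>
      rw [Function.iterate_succ_apply', evalSer_odeDer a d _ (odeDer_iter_supp a d G hGs i) V hV]
      exact Dvd.dvd.mul_left (by simpa [Nat.sub_sub] using X_pow_dvd_derivative ih) _
  have hdetdeg : M.det.natDegree ≤ (d + 1) * (A + 2 * d) := by
    rw [Matrix.det_apply]
    refine natDegree_sum_le_of_forall_le _ _ fun σ _ => ?_
    refine (natDegree_smul_le _ _).trans ?_
    refine (natDegree_prod_le _ _).trans ?_
    refine (Finset.sum_le_card_nsmul _ _ (A + 2 * d) fun i _ => ?_).trans (by simp)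
    refine (odeDer_iter_natDegree a A G hA _ _).trans ?_
    have := (σ i).2
    omega
  have hdvd : (PowerSeries.X : PowerSeries F) ^ (T - d) ∣ (M.det : PowerSeries F) := by
    let y : Fin (d + 1) → PowerSeries F := fun j => V ^ (j : ℕ)
    let φ : F[X] →+* PowerSeries F := Polynomial.coeToPowerSeries.ringHom
    have h1 : ∀ i : Fin (d + 1), ((φ.mapMatrix M).mulVec y) i = evalSer d ((odeDer a)^[i] G) V := by
      intro i
      simp only [Matrix.mulVec, dotProduct, evalSer, y, φ, M]
      rw [← Fin.sum_univ_eq_sum_range (fun j => ((odeDer a)^[i] G j : PowerSeries F) * V ^ j)]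
      rfl
    have h2 : (φ M.det) • y = (φ.mapMatrix M.adjugate).mulVec ((φ.mapMatrix M).mulVec y) := by
      rw [Matrix.mulVec_mulVec, ← map_mul, Matrix.adjugate_mul]
      ext1 i
      simp only [Pi.smul_apply, smul_eq_mul, Matrix.mulVec, dotProduct, RingHom.mapMatrix_apply,
        Matrix.map_apply, Matrix.smul_apply, Matrix.one_apply]
      rw [Finset.sum_eq_single i]
      · simp
      · intro j _ hj; simp [hj.symm]
      · simp
    have h3 := congrFun h2 0
    have : (M.det : PowerSeries F) = φ M.det * y 0 := by simp [y, φ]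
    rw [this]
    simp only [Pi.smul_apply, smul_eq_mul] at h3
    rw [h3, Matrix.mulVec, dotProduct]
    refine Finset.dvd_sum fun i _ => Dvd.dvd.mul_left ?_ _
    rw [h1]
    exact (pow_dvd_pow _ (by omega)).trans (hdiv i)
  have hdet : M.det ≠ 0 := by
    intro h
    obtain ⟨v, hv, hvM⟩ := Matrix.exists_vecMul_eq_zero_iff.2 h
    obtain ⟨r, hr, hmax⟩ := (Finset.univ.filter (fun f => v f ≠ 0)).exists_max_image id (by
      obtain ⟨f, hf⟩ := Function.ne_iff.1 hv
      exact ⟨f, by simpa using hf⟩)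
    let v' : ℕ → F[X] := fun i => if h : i < d + 1 then v ⟨i, h⟩ else 0
    have hv' : ∀ i : Fin (d + 1), v' i = v i := fun i => by simp only [v', i.2, dif_pos, Fin.eta]
    have hr0 : v' r ≠ 0 := by rw [hv']; simpa using hr
    refine iterates_independent a h0 hk hD d G hG hGs v' r (by omega) hr0 ?_
    rw [Finset.sum_subset (Finset.range_subset_range.2 (show (r : ℕ) + 1 ≤ d + 1 by omega))]
    · rw [← Fin.sum_univ_eq_sum_range (fun i => v' i • (odeDer a)^[i] G) (d + 1)]
      ext1 j
      rw [Finset.sum_apply]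
      by_cases hj : j < d + 1
      · have := congrFun hvM ⟨j, hj⟩
        simp only [Matrix.vecMul, dotProduct, Pi.zero_apply, M] at this
        simp only [hv', Pi.smul_apply, smul_eq_mul, Pi.zero_apply]
        exact this
      · refine Finset.sum_eq_zero fun i _ => ?_
        simp [odeDer_iter_supp a d G hGs i j (by omega)]
    · intro i hi hi'
      simp only [Finset.mem_range] at hi hi'
      have : v ⟨i, hi⟩ = 0 := by
        by_contra hne
        have := hmax ⟨i, hi⟩ (by simpa using hne)
        simp only [id, Fin.le_def] at this
        omega
      simp [v', this]
  have h5 : T - d ≤ M.det.natDegree := by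
    by_contra hlt
    push Not at hlt
    rw [PowerSeries.X_pow_dvd_iff] at hdvd
    have := hdvd _ hlt
    rw [Polynomial.coeff_coe] at this
    exact hdet (leadingCoeff_eq_zero.1 this)
  omega
end

end

/-- The Taylor series at `0`. -/
noncomputable def taylorSer (f : ℂ → ℂ) : PowerSeries ℂ :=
  PowerSeries.mk fun k => iteratedDeriv k f 0 / (k.factorial : ℂ)

theorem coeff_taylorSer (f : ℂ → ℂ) (k : ℕ) :
    PowerSeries.coeff k (taylorSer f) = iteratedDeriv k f 0 / (k.factorial : ℂ) := by
  simp [taylorSer]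

theorem taylorSer_congr {f g : ℂ → ℂ} (h : f =ᶠ[nhds 0] g) : taylorSer f = taylorSer g := by
  ext k; rw [coeff_taylorSer, coeff_taylorSer, h.iteratedDeriv_eq]

theorem taylorSer_add {f g : ℂ → ℂ} (hf : AnalyticAt ℂ f 0) (hg : AnalyticAt ℂ g 0) :
    taylorSer (fun x => f x + g x) = taylorSer f + taylorSer g := by
  ext k
  simp only [coeff_taylorSer, map_add]
  rw [iteratedDeriv_fun_add hf.contDiffAt hg.contDiffAt]; ring

theorem taylorSer_mul {f g : ℂ → ℂ} (hf : AnalyticAt ℂ f 0) (hg : AnalyticAt ℂ g 0) :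
    taylorSer (fun x => f x * g x) = taylorSer f * taylorSer g := by
  ext k
  rw [coeff_taylorSer, iteratedDeriv_fun_mul hf.contDiffAt hg.contDiffAt, PowerSeries.coeff_mul,
    Finset.Nat.sum_antidiagonal_eq_sum_range_succ
      (fun i j => PowerSeries.coeff i (taylorSer f) * PowerSeries.coeff j (taylorSer g)),
    Finset.sum_div]
  refine Finset.sum_congr rfl fun i hi => ?_
  have hi' : i ≤ k := by simpa [Nat.lt_succ_iff] using hi
  rw [coeff_taylorSer, coeff_taylorSer, Nat.cast_choose ℂ hi']
  have h1 : (k.factorial : ℂ) ≠ 0 := Nat.cast_ne_zero.2 k.factorial_ne_zero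
  field_simp

theorem taylorSer_const (c : ℂ) : taylorSer (fun _ => c) = PowerSeries.C c := by
  ext k
  rw [coeff_taylorSer, iteratedDeriv_const, PowerSeries.coeff_C]
  split_ifs with h <;> simp [h]

theorem taylorSer_deriv (f : ℂ → ℂ) :
    taylorSer (deriv f) = PowerSeries.derivative ℂ (taylorSer f) := by
  ext k
  rw [PowerSeries.coeff_derivative, coeff_taylorSer, coeff_taylorSer, iteratedDeriv_succ',
    Nat.factorial_succ]
  have h1 : (k.factorial : ℂ) ≠ 0 := Nat.cast_ne_zero.2 k.factorial_ne_zero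
  have h2 : (k : ℂ) + 1 ≠ 0 := Nat.cast_add_one_ne_zero k
  push_cast
  field_simp

theorem taylorSer_id : taylorSer (fun x => x) = PowerSeries.X := by
  refine PowerSeries.derivative.ext ?_ ?_
  · rw [← taylorSer_deriv, deriv_id'', taylorSer_const]; simp
  · rw [← PowerSeries.coeff_zero_eq_constantCoeff_apply, coeff_taylorSer]; simp

theorem taylorSer_pow {f : ℂ → ℂ} (hf : AnalyticAt ℂ f 0) (k : ℕ) :
    taylorSer (fun x => f x ^ k) = taylorSer f ^ k := by
  induction k with
  | zero => simp [taylorSer_const]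
  | succ k ih =>
    simp only [pow_succ]
    rw [taylorSer_mul (f := fun x => f x ^ k) (hf.pow k) hf, ih]

theorem taylorSer_sum {ι : Type*} (s : Finset ι) (f : ι → ℂ → ℂ) (hf : ∀ i, AnalyticAt ℂ (f i) 0) :
    taylorSer (fun x => ∑ i ∈ s, f i x) = ∑ i ∈ s, taylorSer (f i) := by
  classical
  induction s using Finset.induction_on with
  | empty => simp [taylorSer_const]
  | insert i s hi ih =>
    simp only [Finset.sum_insert hi]
    rw [taylorSer_add (hf i), ih]
    exact Finset.analyticAt_fun_sum s fun i _ => hf i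

theorem norm_coeff_taylorSer_le {f : ℂ → ℂ} {r M : ℝ} (hr : 0 < r)
    (hf : DifferentiableOn ℂ f (Metric.closedBall 0 r)) (hM : ∀ x, ‖x‖ = r → ‖f x‖ ≤ M) (k : ℕ) :
    ‖PowerSeries.coeff k (taylorSer f)‖ ≤ M / r ^ k := by
  have := Complex.norm_iteratedDeriv_le_of_forall_mem_sphere_norm_le (f := f) (c := 0) k hr
    ((hf.mono Metric.closure_ball_subset_closedBall).diffContOnCl)
    (fun x hx => hM x (by simpa using hx))
  rw [coeff_taylorSer, norm_div, Complex.norm_natCast, div_le_iff₀ (by positivity)]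
  calc _ ≤ _ := this
    _ = _ := by ring

theorem schwarz_order {F : ℂ → ℂ} {r R M : ℝ} {T : ℕ} (hr : 0 < r) (hrR : r < R)
    (hF : DifferentiableOn ℂ F (Metric.ball 0 R)) (hM : ∀ x, ‖x‖ = r → ‖F x‖ ≤ M)
    (hT : ∀ t < T, iteratedDeriv t F 0 = 0) {x : ℂ} (hx : ‖x‖ ≤ r) :
    ‖F x‖ ≤ (‖x‖ / r) ^ T * M := by
  have key : ∀ T : ℕ, ∀ F : ℂ → ℂ, DifferentiableOn ℂ F (Metric.ball 0 R) →
      (T : ℕ∞) ≤ analyticOrderAt F 0 →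
      ∃ G : ℂ → ℂ, DifferentiableOn ℂ G (Metric.ball 0 R) ∧ ∀ x, F x = x ^ T * G x := by
    intro T
    induction T with
    | zero => intro F hF _; exact ⟨F, hF, fun x => by simp⟩
    | succ T ih =>
      intro F hF hT
      have hFa : AnalyticAt ℂ F 0 := hF.analyticAt (Metric.ball_mem_nhds _ (hr.trans hrR))
      obtain ⟨g, hg, hgF⟩ := (natCast_le_analyticOrderAt hFa).1 hT
      have hF0 : F 0 = 0 := by simpa using hgF.self_of_nhds
      have hds : DifferentiableOn ℂ (dslope F 0) (Metric.ball 0 R) :=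
        (Complex.differentiableOn_dslope (Metric.ball_mem_nhds _ (hr.trans hrR))).2 hF
      have heq : ∀ x, F x = x * dslope F 0 x := by
        intro x
        have := sub_smul_dslope F 0 x
        simp only [sub_zero, smul_eq_mul, hF0] at this
        exact this.symm
      obtain ⟨G, hG, hGF⟩ := ih (dslope F 0) hds (by
        have hda : AnalyticAt ℂ (dslope F 0) 0 :=
          hds.analyticAt (Metric.ball_mem_nhds _ (hr.trans hrR))
        rw [natCast_le_analyticOrderAt hda]
        refine ⟨g, hg, ?_⟩
        have h1 : ∀ᶠ x in nhdsWithin (0 : ℂ) {0}ᶜ, dslope F 0 x = (x - 0) ^ T • g x := by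
          filter_upwards [hgF.filter_mono nhdsWithin_le_nhds, self_mem_nhdsWithin] with x h1 hx
          have hx0 : x ≠ 0 := by simpa using hx
          rw [heq x] at h1
          apply mul_left_cancel₀ hx0
          rw [h1]; simp only [sub_zero, smul_eq_mul]; ring
        have h2 := (hda.frequently_eq_iff_eventually_eq (g := fun x => (x - 0) ^ T • g x)
          (by fun_prop)).1 h1.frequently
        exact h2)
      refine ⟨G, hG, fun x => ?_⟩
      rw [heq, hGF]; ring
  have hFa : AnalyticAt ℂ F 0 := hF.analyticAt (Metric.ball_mem_nhds _ (hr.trans hrR))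
  obtain ⟨G, hG, hGF⟩ := key T F hF
    ((natCast_le_analyticOrderAt_iff_iteratedDeriv_eq_zero hFa).2 hT)
  have hGx : ‖G x‖ ≤ M / r ^ T := by
    refine Complex.norm_le_of_forall_mem_frontier_norm_le (U := Metric.ball 0 r)
      Metric.isBounded_ball (f := G) ?_ ?_ ?_
    · refine (hG.mono ?_).diffContOnCl
      exact (Metric.closure_ball_subset_closedBall).trans (Metric.closedBall_subset_ball hrR)
    · intro y hy
      rw [frontier_ball _ hr.ne'] at hy
      have hy' : ‖y‖ = r := by simpa using hy
      have := hM y hy'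
      rw [hGF, norm_mul, norm_pow, hy'] at this
      rw [le_div_iff₀ (by positivity)]; linarith
    · rw [closure_ball _ hr.ne']; simpa using hx
  rw [hGF, norm_mul, norm_pow, div_pow]
  calc ‖x‖ ^ T * ‖G x‖ ≤ ‖x‖ ^ T * (M / r ^ T) := by gcongr
    _ = _ := by ring

section

open MeasureTheory Set

/-- The integral of `g` along the segment from `0` to `z`. -/
noncomputable def radialInt (g : ℂ → ℂ) (z : ℂ) : ℂ := ∫ v in (0 : ℝ)..1, z * g (v * z)

theorem hasDerivAt_radialInt {U : Set ℂ} (hU : IsOpen U)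
    (hs : ∀ z ∈ U, ∀ v : ℝ, 0 ≤ v → v ≤ 1 → (v : ℂ) * z ∈ U)
    {g : ℂ → ℂ} (hg : DifferentiableOn ℂ g U) {z : ℂ} (hz : z ∈ U) :
    HasDerivAt (radialInt g) (g z) z := by
  have hda : ∀ w ∈ U, HasDerivAt g (deriv g w) w := fun w hw =>
    (hg.differentiableAt (hU.mem_nhds hw)).hasDerivAt
  have hcont : ContinuousOn g U := hg.continuousOn
  have hcont' : ContinuousOn (deriv g) U := (hg.deriv hU).continuousOn
  set h : ℂ → ℂ := fun u => g u + u * deriv g u with hh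
  have hhc : ContinuousOn h U := hcont.add (continuousOn_id.mul hcont')
  obtain ⟨ε, hε, hεU⟩ := Metric.nhds_basis_closedBall.mem_iff.1 (hU.mem_nhds hz)
  have hK : IsCompact ((fun p : ℝ × ℂ => (p.1 : ℂ) * p.2) '' (Icc 0 1 ×ˢ Metric.closedBall z ε)) :=
    (isCompact_Icc.prod (isCompact_closedBall z ε)).image (by fun_prop)
  have hKU : ((fun p : ℝ × ℂ => (p.1 : ℂ) * p.2) '' (Icc 0 1 ×ˢ Metric.closedBall z ε)) ⊆ U := by
    rintro _ ⟨⟨v, w⟩, ⟨hv, hw⟩, rfl⟩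
    exact hs w (hεU hw) v hv.1 hv.2
  obtain ⟨C, hC⟩ := hK.exists_bound_of_continuousOn (hhc.mono hKU)
  have hsc : ∀ w ∈ U, ContinuousOn (fun v : ℝ => (v : ℂ) * w) (uIcc 0 1) := fun w _ => by fun_prop
  have hmaps : ∀ w ∈ U, MapsTo (fun v : ℝ => (v : ℂ) * w) (uIcc 0 1) U := by
    intro w hw v hv
    rw [uIcc_of_le zero_le_one] at hv
    exact hs w hw v hv.1 hv.2
  have hFc : ∀ w ∈ U, ContinuousOn (fun v : ℝ => w * g (v * w)) (uIcc 0 1) := fun w hw =>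
    continuousOn_const.mul (hcont.comp (hsc w hw) (hmaps w hw))
  have hF'c : ContinuousOn (fun v : ℝ => h (v * z)) (uIcc 0 1) :=
    hhc.comp (hsc z hz) (hmaps z hz)
  have main := (intervalIntegral.hasDerivAt_integral_of_dominated_loc_of_deriv_le (𝕜 := ℂ)
    (μ := volume) (a := (0 : ℝ)) (b := 1) (s := Metric.ball z ε) (x₀ := z)
    (F := fun w v => w * g (v * w)) (F' := fun w v => h (v * w)) (bound := fun _ => C)
    (Metric.ball_mem_nhds z hε)
    (by
      filter_upwards [Metric.ball_mem_nhds z hε] with w hw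
      exact ((hFc w (hεU (Metric.ball_subset_closedBall hw))).mono
        uIoc_subset_uIcc).aestronglyMeasurable measurableSet_uIoc)
    (hFc z hz).intervalIntegrable
    ((hF'c.mono uIoc_subset_uIcc).aestronglyMeasurable measurableSet_uIoc)
    (by
      refine Filter.Eventually.of_forall fun v hv w hw => ?_
      rw [uIoc_of_le zero_le_one] at hv
      exact hC _ ⟨(v, w), ⟨⟨hv.1.le, hv.2⟩, Metric.ball_subset_closedBall hw⟩, rfl⟩)
    intervalIntegrable_const
    (by
      refine Filter.Eventually.of_forall fun v hv w hw => ?_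
      rw [uIoc_of_le zero_le_one] at hv
      have hvw : (v : ℂ) * w ∈ U := hs w (hεU (Metric.ball_subset_closedBall hw)) v hv.1.le hv.2
      have h1 : HasDerivAt (fun w : ℂ => (v : ℂ) * w) v w := by
        simpa using (hasDerivAt_id w).const_mul (v : ℂ)
      have := (hasDerivAt_id w).mul ((hda _ hvw).comp w h1)
      have e : h (v * w) = 1 * g (v * w) + w * (deriv g (v * w) * v) := by
        simp only [h]; ring
      rw [e]; exact this)).2
  have hvalint : ∫ v in (0 : ℝ)..1, h (v * z) = g z := by
    have : ∀ v ∈ uIcc (0 : ℝ) 1, HasDerivAt (fun v : ℝ => (v : ℂ) * g (v * z)) (h (v * z)) v := by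
      intro v hv
      have h1 : HasDerivAt (fun v : ℝ => (v : ℂ)) 1 v := Complex.ofRealCLM.hasDerivAt
      have h2 : HasDerivAt (fun v : ℝ => (v : ℂ) * z) z v := by simpa using h1.mul_const z
      have h3 := (hda _ (hmaps z hz hv)).comp_of_eq v h2 rfl
      have e : h (v * z) = 1 * g (v * z) + v * (deriv g (v * z) * z) := by
        simp only [h]; ring
      rw [e]; exact h1.mul h3
    rw [intervalIntegral.integral_eq_sub_of_hasDerivAt this hF'c.intervalIntegrable]
    simp
  rw [hvalint] at main
  exact main

end

section

open MeasureTheory Set Complex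

/-- Integrand `n z^(m-1) (2-z^n)^(m/n-1)`. -/
noncomputable def uDens (n m : ℕ) (z : ℂ) : ℂ :=
  n * z ^ (m - 1) * (2 - z ^ n) ^ (((m / n - 1 : ℝ)) : ℂ)

/-- Uniformized integral `∫ (1-x²)^(m/n-1) dx` near `x = 1`, where `x = 1 - z^n`. -/
noncomputable def uInt (n m : ℕ) : ℂ → ℂ := radialInt (uDens n m)

/-- Half of the Beta value `B(1/2, m/n)`. -/
noncomputable def uPer (n m : ℕ) : ℂ := uInt n m 1

/-- Branch of `∫₀ˣ (1-t²)^(m/n-1) dt`. -/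
noncomputable def uBr (n m : ℕ) (x : ℂ) : ℂ := uPer n m - uInt n m ((1 - x) ^ ((n : ℂ)⁻¹))

def uDom (n : ℕ) : Set ℂ := {z | 2 - z ^ n ∈ slitPlane}

def xDom : Set ℂ := {x | 1 - x ∈ slitPlane ∧ 1 + x ∈ slitPlane}

theorem sub_smul_mem_slitPlane {a t : ℝ} {u : ℂ} (ha : 0 < a) (h : (a : ℂ) - u ∈ slitPlane)
    (ht0 : 0 ≤ t) (ht1 : t ≤ 1) : (a : ℂ) - t * u ∈ slitPlane := by
  rw [mem_slitPlane_iff] at h ⊢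
  simp only [sub_re, ofReal_re, sub_im, ofReal_im, mul_re, mul_im, zero_mul, sub_zero, add_zero,
    zero_sub] at h ⊢
  rcases eq_or_lt_of_le ht0 with rfl | ht
  · left; simpa
  rcases h with h | h
  · left
    rcases le_or_gt u.re 0 with h' | h'
    · nlinarith
    · nlinarith
  · right
    exact neg_ne_zero.2 (mul_ne_zero ht.ne' (neg_ne_zero.1 h))

theorem isOpen_uDom (n : ℕ) : IsOpen (uDom n) :=
  isOpen_slitPlane.preimage (by fun_prop : Continuous fun z : ℂ => 2 - z ^ n)

theorem isOpen_xDom : IsOpen xDom :=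
  (isOpen_slitPlane.preimage (by fun_prop : Continuous fun z : ℂ => 1 - z)).inter
    (isOpen_slitPlane.preimage (by fun_prop : Continuous fun z : ℂ => 1 + z))

theorem uDom_star (n : ℕ) : ∀ z ∈ uDom n, ∀ v : ℝ, 0 ≤ v → v ≤ 1 → (v : ℂ) * z ∈ uDom n := by
  intro z hz v h0 h1
  have := sub_smul_mem_slitPlane (a := 2) (t := v ^ n) (u := z ^ n) (by norm_num)
    (by simpa [uDom] using hz) (by positivity) (pow_le_one₀ h0 h1)
  simpa [uDom, mul_pow] using this

theorem xDom_star : ∀ z ∈ xDom, ∀ v : ℝ, 0 ≤ v → v ≤ 1 → (v : ℂ) * z ∈ xDom := by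
  rintro z ⟨hz, hz'⟩ v h0 h1
  have h2 := sub_smul_mem_slitPlane (a := 1) (t := v) (u := z) (by norm_num)
    (by simpa using hz) h0 h1
  have h3 := sub_smul_mem_slitPlane (a := 1) (t := v) (u := -z) (by norm_num)
    (by simpa using hz') h0 h1
  exact ⟨by simpa using h2, by simpa using h3⟩

theorem isPreconnected_xDom : IsPreconnected xDom := by
  have h : StarConvex ℝ 0 xDom := by
    rw [starConvex_zero_iff]
    intro x hx a h0 h1
    have := xDom_star x hx a h0 h1
    simpa using this
  exact (h.isPathConnected (show (0 : ℂ) ∈ xDom by simp [xDom])).isConnected.isPreconnected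

theorem hasDerivAt_uInt (n m : ℕ) {z : ℂ} (hz : z ∈ uDom n) :
    HasDerivAt (uInt n m) (uDens n m z) z := by
  refine hasDerivAt_radialInt (isOpen_uDom n) (uDom_star n) ?_ hz
  intro w hw
  refine DifferentiableAt.differentiableWithinAt ?_
  unfold uDens
  exact (DifferentiableAt.mul (by fun_prop) (DifferentiableAt.cpow_const (by fun_prop) hw))

theorem differentiableOn_uInt (n m : ℕ) : DifferentiableOn ℂ (uInt n m) (uDom n) := fun _ hz =>
  (hasDerivAt_uInt n m hz).differentiableAt.differentiableWithinAt

theorem uInt_root_mul {n m : ℕ} (hm : 0 < m) {ω : ℂ} (hω : ω ^ n = 1) (z : ℂ) :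
    uInt n m (ω * z) = ω ^ m * uInt n m z := by
  unfold uInt radialInt
  rw [← intervalIntegral.integral_const_mul]
  congr 1
  ext v
  unfold uDens
  have h1 : ((v : ℂ) * (ω * z)) ^ n = (v * z) ^ n := by
    rw [mul_left_comm, mul_pow, hω, one_mul]
  rw [h1]
  obtain ⟨k, rfl⟩ : ∃ k, m = k + 1 := ⟨m - 1, by omega⟩
  simp only [Nat.add_sub_cancel]
  ring

theorem norm_uInt_le {n m : ℕ} (hm : 0 < m) (hmn : m < n) {z : ℂ} (hz : 0 ≤ (1 - z ^ n).re) :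
    ‖uInt n m z‖ ≤ n * (1 + ‖1 - z ^ n‖) := by
  have hzn : ‖z‖ ^ m ≤ 1 + ‖1 - z ^ n‖ := by
    rcases le_or_gt ‖z‖ 1 with h | h
    · have := pow_le_one₀ (norm_nonneg z) h (n := m)
      have := norm_nonneg (1 - z ^ n)
      linarith
    · calc ‖z‖ ^ m ≤ ‖z‖ ^ n := pow_le_pow_right₀ h.le hmn.le
        _ = ‖1 - (1 - z ^ n)‖ := by rw [sub_sub_cancel, norm_pow]
        _ ≤ _ := by simpa using norm_sub_le (1 : ℂ) (1 - z ^ n)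
  have hb : ∀ v ∈ uIoc (0 : ℝ) 1, ‖z * uDens n m (v * z)‖ ≤ n * ‖z‖ ^ m := by
    intro v hv
    rw [uIoc_of_le zero_le_one] at hv
    have hre : 1 ≤ (2 - ((v : ℂ) * z) ^ n).re := by
      have e : (((v : ℂ) * z) ^ n).re = v ^ n * (z ^ n).re := by
        rw [mul_pow, ← ofReal_pow, re_ofReal_mul]
      have h2 : (z ^ n).re ≤ 1 := by simpa using hz
      have h3 : v ^ n ≤ 1 := pow_le_one₀ hv.1.le hv.2
      have h4 : 0 ≤ v ^ n := pow_nonneg hv.1.le n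
      rw [sub_re, e]
      have : (2 : ℂ).re = 2 := rfl
      rw [this]
      nlinarith
    have h1 : 1 ≤ ‖2 - ((v : ℂ) * z) ^ n‖ := hre.trans (re_le_norm _)
    have hs : ((m : ℝ) / n - 1) ≤ 0 := by
      have : (m : ℝ) / n ≤ 1 := div_le_one_of_le₀ (by exact_mod_cast hmn.le) (by positivity)
      linarith
    rw [uDens, norm_mul, norm_mul, norm_mul, norm_cpow_real, norm_natCast, norm_pow, norm_mul,
      norm_real, Real.norm_of_nonneg hv.1.le]
    have h5 : ‖2 - ((v : ℂ) * z) ^ n‖ ^ ((m : ℝ) / n - 1) ≤ 1 := Real.rpow_le_one_of_one_le_of_nonpos h1 hs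
    have h6 : v * ‖z‖ ≤ ‖z‖ := mul_le_of_le_one_left (norm_nonneg _) hv.2
    have h7 : (v * ‖z‖) ^ (m - 1) ≤ ‖z‖ ^ (m - 1) :=
      pow_le_pow_left₀ (mul_nonneg hv.1.le (norm_nonneg _)) h6 _
    calc ‖z‖ * (↑n * (v * ‖z‖) ^ (m - 1) * ‖2 - ((v : ℂ) * z) ^ n‖ ^ ((m : ℝ) / n - 1))
        ≤ ‖z‖ * (↑n * ‖z‖ ^ (m - 1) * 1) := by gcongr
      _ = n * ‖z‖ ^ m := by
        obtain ⟨k, rfl⟩ : ∃ k, m = k + 1 := ⟨m - 1, by omega⟩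
        simp only [Nat.add_sub_cancel]; ring
  have := intervalIntegral.norm_integral_le_of_norm_le_const hb
  calc ‖uInt n m z‖ ≤ n * ‖z‖ ^ m * |1 - 0| := this
    _ = n * ‖z‖ ^ m := by simp
    _ ≤ _ := by gcongr

theorem root_pow {n : ℕ} (hn : 0 < n) (x : ℂ) : ((1 - x) ^ ((n : ℂ)⁻¹)) ^ n = 1 - x :=
  cpow_nat_inv_pow _ hn.ne'

theorem root_mem_uDom {n : ℕ} (hn : 0 < n) {x : ℂ} (hx : x ∈ xDom) :
    (1 - x) ^ ((n : ℂ)⁻¹) ∈ uDom n := by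
  unfold uDom
  rw [Set.mem_ofPred_eq, root_pow hn]
  convert hx.2 using 1; ring

theorem hasDerivAt_uBr {n m : ℕ} (hm : 0 < m) (hmn : m < n) {x : ℂ} (hx : x ∈ xDom) :
    HasDerivAt (uBr n m) ((1 - x) ^ (((m / n - 1 : ℝ)) : ℂ) * (1 + x) ^ (((m / n - 1 : ℝ)) : ℂ)) x := by
  have hn : 0 < n := by omega
  have hn0 : (n : ℂ) ≠ 0 := Nat.cast_ne_zero.2 hn.ne'
  have h1 : HasDerivAt (fun x : ℂ => (1 - x) ^ ((n : ℂ)⁻¹))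
      ((n : ℂ)⁻¹ * (1 - x) ^ ((n : ℂ)⁻¹ - 1) * (-1)) x :=
    HasDerivAt.cpow_const (by simpa using (hasDerivAt_id x).const_sub 1) hx.1
  have h2 := ((hasDerivAt_uInt n m (root_mem_uDom hn hx)).comp x h1).const_sub (uPer n m)
  have hx0 : 1 - x ≠ 0 := slitPlane_ne_zero hx.1
  have e : -(uDens n m ((1 - x) ^ ((n : ℂ)⁻¹)) * ((n : ℂ)⁻¹ * (1 - x) ^ ((n : ℂ)⁻¹ - 1) * (-1)))
      = (1 - x) ^ (((m / n - 1 : ℝ)) : ℂ) * (1 + x) ^ (((m / n - 1 : ℝ)) : ℂ) := by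
    unfold uDens
    rw [root_pow hn, show (2 : ℂ) - (1 - x) = 1 + x by ring]
    have e2 : (1 - x) ^ (((m / n - 1 : ℝ)) : ℂ)
        = ((1 - x) ^ ((n : ℂ)⁻¹)) ^ (m - 1) * (1 - x) ^ ((n : ℂ)⁻¹ - 1) := by
      rw [← cpow_nat_mul, ← cpow_add _ _ hx0]
      congr 1
      push_cast [Nat.cast_sub (show 1 ≤ m from hm)]
      field_simp
      ring
    rw [e2]
    field_simp
  rw [← e]
  exact h2

theorem differentiableOn_uBr {n m : ℕ} (hm : 0 < m) (hmn : m < n) :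
    DifferentiableOn ℂ (uBr n m) xDom := fun _ hx =>
  (hasDerivAt_uBr hm hmn hx).differentiableAt.differentiableWithinAt

theorem uBr_zero (n m : ℕ) : uBr n m 0 = 0 := by simp [uBr, uPer]

theorem xDom_neg {x : ℂ} (hx : x ∈ xDom) : -x ∈ xDom :=
  ⟨by simpa using hx.2, by simpa [sub_eq_add_neg] using hx.1⟩

theorem uBr_neg {n m : ℕ} (hm : 0 < m) (hmn : m < n) {x : ℂ} (hx : x ∈ xDom) :
    uBr n m (-x) = - uBr n m x := by
  have hd : ∀ y ∈ xDom, HasDerivAt (fun y => uBr n m y + uBr n m (-y)) 0 y := by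
    intro y hy
    have h1 := hasDerivAt_uBr hm hmn hy
    have h2 := (hasDerivAt_uBr hm hmn (xDom_neg hy)).scomp y (hasDerivAt_neg y)
    have h3 := h1.add h2
    have e : (1 - y) ^ (((m / n - 1 : ℝ)) : ℂ) * (1 + y) ^ (((m / n - 1 : ℝ)) : ℂ)
      + (-1 : ℂ) • ((1 - -y) ^ (((m / n - 1 : ℝ)) : ℂ) * (1 + -y) ^ (((m / n - 1 : ℝ)) : ℂ)) = 0 := by
      rw [sub_neg_eq_add, ← sub_eq_add_neg, smul_eq_mul]; ring
    rw [e] at h3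
    exact h3
  have hc := isOpen_xDom.is_const_of_deriv_eq_zero isPreconnected_xDom
    (fun y hy => (hd y hy).differentiableAt.differentiableWithinAt) (fun y hy => (hd y hy).deriv)
    hx (show (0 : ℂ) ∈ xDom by simp [xDom])
  simp only [neg_zero, uBr_zero, add_zero] at hc
  exact eq_neg_of_add_eq_zero_right hc

theorem ball_subset_xDom : Metric.ball (0 : ℂ) 1 ⊆ xDom := by
  intro x hx
  have hx' : ‖x‖ < 1 := by simpa using hx
  have h1 := abs_lt.1 ((abs_re_le_norm x).trans_lt hx')
  exact ⟨mem_slitPlane_iff.2 (Or.inl (by simp; linarith)), mem_slitPlane_iff.2 (Or.inl (by simp; linarith))⟩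

/-- Points of the uniformized curve over `xDom` in terms of the branch `uBr`. -/
theorem exists_root_uInt {n m : ℕ} (hm : 0 < m) (hmn : m < n) (z : ℂ) (hz : 1 - z ^ n ≠ 1) :
    ∃ ω : ℂ, ω ^ n = 1 ∧ uInt n m z = ω * (uPer n m - uBr n m (1 - z ^ n)) := by
  have hn : 0 < n := by omega
  have hz0 : z ≠ 0 := by rintro rfl; simp [hn.ne'] at hz
  set r := (1 - (1 - z ^ n)) ^ ((n : ℂ)⁻¹) with hr
  have hrn : r ^ n = z ^ n := by rw [hr, root_pow hn]; ring
  have hr0 : r ≠ 0 := by intro h; rw [h, zero_pow hn.ne'] at hrn; exact pow_ne_zero _ hz0 hrn.symm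
  have hω : (z / r) ^ n = 1 := by rw [div_pow, hrn, div_self (pow_ne_zero _ hz0)]
  refine ⟨(z / r) ^ m, by rw [← pow_mul, mul_comm, pow_mul, hω, one_pow], ?_⟩
  rw [uBr, ← hr, sub_sub_cancel, ← uInt_root_mul hm hω, div_mul_cancel₀ _ hr0]

end

section

open MeasureTheory Set Complex

/-- Uniform bound for `P` along the uniformized curve, on the right half-plane. -/
def StripBound (n m : ℕ) (P : ℂ → ℂ → ℂ) (L : Set ℂ) (b : ℝ) (g : ℝ → ℝ) : Prop :=
  ∀ l ∈ L, ∀ ε : ℂ, ε ^ n = 1 → ∀ τ : ℂ, (τ = 1 ∨ τ = -1) → ∀ z : ℂ,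
    0 ≤ (1 - z ^ n).re → 1 / 8 ≤ ‖1 - z ^ n‖ → Real.log ‖1 - z ^ n‖ ≤ b →
    ‖P (τ * (1 - z ^ n)) (ε * τ * (uPer n m - uInt n m z) + uPer n m * l)‖ ≤
      g (Real.log ‖1 - z ^ n‖)

theorem StripBound.extend {n m : ℕ} (hm : 0 < m) (hmn : m < n) {P : ℂ → ℂ → ℂ} {L L' : Set ℂ}
    (hL : ∀ l ∈ L, ∀ ε ε' : ℂ, ε ^ n = 1 → ε' ^ n = 1 → l + ε - ε' ∈ L' ∧ l - ε + ε' ∈ L')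
    {b : ℝ} {g : ℝ → ℝ} (h : StripBound n m P L' b g) {l : ℂ} (hl : l ∈ L) {ε τ z : ℂ}
    (hε : ε ^ n = 1) (hτ : τ = 1 ∨ τ = -1) (hs : 1 + (1 - z ^ n) ∈ slitPlane)
    (h8 : 1 / 8 ≤ ‖1 - z ^ n‖) (hb : Real.log ‖1 - z ^ n‖ ≤ b) :
    ‖P (τ * (1 - z ^ n)) (ε * τ * (uPer n m - uInt n m z) + uPer n m * l)‖ ≤
      g (Real.log ‖1 - z ^ n‖) := by
  have hn : 0 < n := by omega
  rcases le_or_gt 0 (1 - z ^ n).re with hre | hre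
  · refine h l ?_ ε hε τ hτ z hre h8 hb
    simpa using (hL l hl 1 1 (one_pow n) (one_pow n)).1
  · obtain ⟨ω, hω, hQ⟩ := exists_root_uInt hm hmn z (by
      intro h1; rw [h1] at hre; norm_num at hre)
    set x := 1 - z ^ n with hx
    have hxd : x ∈ xDom := ⟨mem_slitPlane_iff.2 (Or.inl (by rw [sub_re, one_re]; linarith)), hs⟩
    set z' : ℂ := (1 - -x) ^ ((n : ℂ)⁻¹) with hz'
    have hz'n : 1 - z' ^ n = -x := by rw [hz', root_pow hn]; ring
    have hU : uBr n m x = -(uPer n m - uInt n m z') := by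
      have := uBr_neg hm hmn (xDom_neg hxd)
      rw [neg_neg] at this
      rw [this, uBr]
    have hl' : l + τ * (ε - ε * ω) ∈ L' := by
      have h1 := hL l hl ε (ε * ω) hε (by rw [mul_pow, hε, hω, one_mul])
      rcases hτ with rfl | rfl
      · convert h1.1 using 1; ring
      · convert h1.2 using 1; ring
    have h2 := h _ hl' (ε * ω) (by rw [mul_pow, hε, hω, one_mul]) (-τ)
      (by rcases hτ with rfl | rfl <;> simp) z' (by rw [hz'n, neg_re]; linarith)
      (by rwa [hz'n, norm_neg]) (by rwa [hz'n, norm_neg])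
    rw [hz'n, norm_neg] at h2
    convert h2 using 3
    · ring
    · rw [hQ, hU]; ring

/-- The profile of the extrapolation bounds. -/
noncomputable def profile (κ l : ℝ) : ℝ := l / 3 - l ^ 2 / (12 * κ) - κ / 6

theorem mem_slitPlane_of_exp {x0 q : ℂ} (h0 : 0 ≤ x0.re) (hx0 : x0 ≠ 0) (hq : ‖q‖ ≤ 1 / 2) :
    x0 * exp q ∈ slitPlane := by
  rw [mem_slitPlane_iff_not_le_zero]
  intro hle
  rw [Complex.le_def] at hle
  obtain ⟨r, hr⟩ : ∃ r : ℝ, x0 * exp q = r := ⟨_, (Complex.ext rfl (by simpa using hle.2))⟩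
  have hr0 : r < 0 := by
    have h1 : r ≤ 0 := by have := hle.1; rw [hr] at this; simpa using this
    rcases h1.lt_or_eq with h | h
    · exact h
    · exfalso
      rw [h, ofReal_zero] at hr
      exact mul_ne_zero hx0 (exp_ne_zero q) hr
  have e : x0 = r * exp (-q) := by rw [← hr, mul_assoc, ← exp_add]; simp
  have him := (abs_im_le_norm q).trans hq
  have hc : 0 < Real.cos ((-q).im) := by
    rw [neg_im, Real.cos_neg]
    apply Real.cos_pos_of_mem_Ioo
    have := abs_le.1 him
    constructor <;> nlinarith [Real.pi_gt_three]
  have : x0.re = r * (Real.exp (-q).re * Real.cos (-q).im) := by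
    conv_lhs => rw [e]
    rw [re_ofReal_mul, exp_re]
  have h3 := Real.exp_pos (-q).re
  nlinarith [mul_pos h3 hc]

theorem log_exp_of_norm_le {q : ℂ} (hq : ‖q‖ ≤ 1 / 2) : log (exp q) = q := by
  have := abs_le.1 ((abs_im_le_norm q).trans hq)
  apply log_exp <;> nlinarith [Real.pi_gt_three]

theorem one_add_mem_slitPlane {x : ℂ} (h : x ∈ slitPlane) : 1 + x ∈ slitPlane := by
  rw [mem_slitPlane_iff] at h ⊢
  rcases h with h | h
  · left; rw [add_re, one_re]; linarith
  · right; simpa using h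

theorem norm_eq_mul_exp {x0 q : ℂ} (hx0 : x0 ≠ 0) :
    Real.log ‖x0 * exp q‖ = Real.log ‖x0‖ + q.re := by
  rw [norm_mul, Complex.norm_exp, Real.log_mul (norm_ne_zero_iff.2 hx0) (Real.exp_ne_zero _),
    Real.log_exp]

theorem max_mod_step {n m : ℕ} (hm : 0 < m) (hmn : m < n) {P : ℂ → ℂ → ℂ}
    (hP : Differentiable ℂ fun p : ℂ × ℂ => P p.1 p.2) {κ E μ T : ℝ} (hκ : 0 < κ)
    {z0 a b c : ℂ} (h0 : 0 ≤ (1 - z0 ^ n).re) (hx0 : 1 - z0 ^ n ≠ 0)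
    (hb : ∀ z q : ℂ, ‖q‖ = 1 / 2 → 1 - z ^ n = (1 - z0 ^ n) * exp q →
      ‖P (a * (1 - z ^ n)) (b * (uPer n m - uInt n m z) + c)‖ ≤
        E * Real.exp (T * (profile κ (Real.log ‖1 - z ^ n‖) + μ))) :
    ‖P (a * (1 - z0 ^ n)) (b * (uPer n m - uInt n m z0) + c)‖ ≤
        E * Real.exp (T * (profile κ (Real.log ‖1 - z0 ^ n‖) + (μ - 1 / (96 * κ)))) := by
  have hn : 0 < n := by omega
  set x0 := 1 - z0 ^ n with hx0d
  set l0 := Real.log ‖x0‖ with hl0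
  let S : Set ℂ := slitPlane ∩ log ⁻¹' Metric.ball 0 (1 / 2)
  have hSo : IsOpen S :=
    ContinuousOn.isOpen_inter_preimage (fun z hz => (continuousAt_clog hz).continuousWithinAt) isOpen_slitPlane Metric.isOpen_ball
  let φ : ℂ → ℂ := fun z => (1 - z ^ n) / x0
  have hφ : Continuous φ := by fun_prop
  let W : Set ℂ := φ ⁻¹' S
  have hWo : IsOpen W := hSo.preimage hφ
  let K : Set ℂ := exp '' Metric.closedBall 0 (1 / 2)
  have hKc : IsCompact K := (isCompact_closedBall _ _).image continuous_exp
  have hWK : closure W ⊆ φ ⁻¹' K := by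
    refine closure_minimal ?_ (hKc.isClosed.preimage hφ)
    intro z hz
    refine ⟨log (φ z), Metric.ball_subset_closedBall hz.2, exp_log (slitPlane_ne_zero hz.1)⟩
  have hcl : ∀ z ∈ closure W, ‖log (φ z)‖ ≤ 1 / 2 ∧ 1 - z ^ n = x0 * exp (log (φ z)) ∧
      φ z ∈ slitPlane := by
    intro z hz
    obtain ⟨q, hq, hqz⟩ := hWK hz
    have hq' : ‖q‖ ≤ 1 / 2 := by simpa using hq
    rw [← hqz, log_exp_of_norm_le hq']
    refine ⟨hq', ?_, ?_⟩
    · rw [hqz]; simp only [φ]; field_simp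
    · simpa using mem_slitPlane_of_exp (x0 := 1) (by simp) one_ne_zero hq'
  have hfr : ∀ z ∈ frontier W, ‖log (φ z)‖ = 1 / 2 := by
    intro z hz
    rw [hWo.frontier_eq] at hz
    obtain ⟨h1, -, h3⟩ := hcl z hz.1
    refine le_antisymm h1 (not_lt.1 fun h => hz.2 ⟨h3, by simpa using h⟩)
  have hWb : Bornology.IsBounded W := by
    obtain ⟨M, hM⟩ := hKc.isBounded.exists_norm_le
    refine (Metric.isBounded_closedBall (x := (0 : ℂ)) (r := 1 + |M| * ‖x0‖)).subset ?_
    intro z hz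
    have h1 := hM _ (hWK (subset_closure hz))
    have h2 : ‖1 - z ^ n‖ ≤ |M| * ‖x0‖ := by
      simp only [φ, norm_div] at h1
      rw [div_le_iff₀ (norm_pos_iff.2 hx0)] at h1
      exact h1.trans (mul_le_mul_of_nonneg_right (le_abs_self M) (norm_nonneg _))
    have h3 : ‖z‖ ^ n ≤ 1 + |M| * ‖x0‖ := by
      rw [← norm_pow]
      calc ‖z ^ n‖ = ‖1 - (1 - z ^ n)‖ := by rw [sub_sub_cancel]
        _ ≤ ‖(1 : ℂ)‖ + ‖1 - z ^ n‖ := norm_sub_le _ _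
        _ ≤ _ := by rw [norm_one]; linarith
    rw [mem_closedBall_zero_iff]
    rcases le_or_gt ‖z‖ 1 with h | h
    · have : 0 ≤ |M| * ‖x0‖ := by positivity
      linarith
    · exact (le_self_pow₀ h.le hn.ne').trans h3
  have hz0W : z0 ∈ W := by
    have : φ z0 = 1 := by simp only [φ]; exact div_self hx0
    refine ⟨by rw [this]; exact one_mem_slitPlane, by rw [Set.mem_preimage, this]; simp⟩
  let A1 : ℝ := 1 / 3 - l0 / (6 * κ)
  let f : ℂ → ℂ := fun z => P (a * (1 - z ^ n)) (b * (uPer n m - uInt n m z) + c) *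
    exp (-(T : ℂ) * ((profile κ l0 + μ : ℝ) + (A1 : ℝ) * log (φ z)
      - ((1 / (24 * κ) : ℝ) : ℂ) * log (φ z) ^ 2))
  have hdiff : DifferentiableOn ℂ f (closure W) := by
    intro z hz
    obtain ⟨h1, h2, h3⟩ := hcl z hz
    have hU : z ∈ uDom n := by
      have h4 := one_add_mem_slitPlane (mem_slitPlane_of_exp h0 hx0 h1)
      rw [← h2] at h4
      unfold uDom
      rw [Set.mem_ofPred_eq]
      convert h4 using 1; ring
    have hQ := (hasDerivAt_uInt n m hU).differentiableAt
    have hlog : DifferentiableAt ℂ (fun z => log (φ z)) z :=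
      DifferentiableAt.clog (by fun_prop) h3
    have hPc : DifferentiableAt ℂ
        (fun z => P (a * (1 - z ^ n)) (b * (uPer n m - uInt n m z) + c)) z :=
      DifferentiableAt.comp (g := fun p : ℂ × ℂ => P p.1 p.2)
        (f := fun z => (a * (1 - z ^ n), b * (uPer n m - uInt n m z) + c)) z (hP _)
        (DifferentiableAt.prodMk (by fun_prop) (by fun_prop))
    refine DifferentiableAt.differentiableWithinAt (hPc.mul ?_)
    fun_prop
  have hnorm : ∀ z, ‖f z‖ = ‖P (a * (1 - z ^ n)) (b * (uPer n m - uInt n m z) + c)‖ *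
      Real.exp (-T * ((profile κ l0 + μ) + A1 * (log (φ z)).re
        - (1 / (24 * κ)) * (log (φ z) ^ 2).re)) := by
    intro z
    simp only [f]
    rw [norm_mul, Complex.norm_exp, ← ofReal_neg, re_ofReal_mul, sub_re, add_re, re_ofReal_mul,
      re_ofReal_mul, ofReal_re]
  have hmax := Complex.norm_le_of_forall_mem_frontier_norm_le hWb
    (C := E * Real.exp (-T * (1 / (96 * κ)))) (DifferentiableOn.diffContOnCl hdiff) (by
      intro z hz
      have hq := hfr z hz
      obtain ⟨-, h2, -⟩ := hcl z (frontier_subset_closure hz)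
      have h3 := hb z _ hq h2
      rw [hnorm]
      refine (mul_le_mul_of_nonneg_right h3 (Real.exp_pos _).le).trans (le_of_eq ?_)
      rw [mul_assoc, ← Real.exp_add]
      congr 2
      set q := log (φ z)
      rw [h2, norm_eq_mul_exp hx0, ← hl0]
      have hqs : q.re ^ 2 + q.im ^ 2 = 1 / 4 := by
        have : ‖q‖ ^ 2 = 1 / 4 := by rw [hq]; norm_num
        rw [← this, ← Complex.normSq_eq_norm_sq, Complex.normSq_apply]; ring
      have hq2 : (q ^ 2).re = q.re ^ 2 - q.im ^ 2 := by rw [pow_two, mul_re]; ring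
      rw [hq2, show q.im ^ 2 = 1 / 4 - q.re ^ 2 by linarith]
      simp only [profile, A1]
      field_simp
      ring) (subset_closure hz0W)
  rw [hnorm] at hmax
  have hφ0 : log (φ z0) = 0 := by
    have : φ z0 = 1 := by simp only [φ]; exact div_self hx0
    rw [this, log_one]
  rw [hφ0] at hmax
  have h5 := mul_le_mul_of_nonneg_right hmax (Real.exp_pos (T * (profile κ l0 + μ))).le
  rw [mul_assoc, mul_assoc, ← Real.exp_add, ← Real.exp_add] at h5
  have e5 : -T * (profile κ l0 + μ + A1 * (0 : ℂ).re - 1 / (24 * κ) * ((0 : ℂ) ^ 2).re)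
      + T * (profile κ l0 + μ) = 0 := by simp
  rw [e5, Real.exp_zero, mul_one] at h5
  refine h5.trans (le_of_eq ?_)
  congr 2; ring

theorem StripBound.branch {n m : ℕ} (hm : 0 < m) (hmn : m < n) {P : ℂ → ℂ → ℂ} {L : Set ℂ}
    {b : ℝ} {g : ℝ → ℝ} (h : StripBound n m P L b g) {l : ℂ} (hl : l ∈ L) {ε X : ℂ}
    (hε : ε ^ n = 1) (hX : X ∈ xDom) (h8 : 1 / 8 ≤ ‖X‖) (hb : Real.log ‖X‖ ≤ b) :
    ‖P X (ε * uBr n m X + uPer n m * l)‖ ≤ g (Real.log ‖X‖) := by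
  have hn : 0 < n := by omega
  rcases le_or_gt 0 X.re with hre | hre
  · have e : 1 - ((1 - X) ^ ((n : ℂ)⁻¹)) ^ n = X := by rw [root_pow hn]; ring
    have := h l hl ε hε 1 (Or.inl rfl) ((1 - X) ^ ((n : ℂ)⁻¹))
    rw [e] at this
    simpa [uBr] using this hre h8 hb
  · have e : 1 - ((1 - -X) ^ ((n : ℂ)⁻¹)) ^ n = -X := by rw [root_pow hn]; ring
    have := h l hl ε hε (-1) (Or.inr rfl) ((1 - -X) ^ ((n : ℂ)⁻¹))
    rw [e, norm_neg] at this
    have hU := uBr_neg hm hmn (xDom_neg hX)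
    rw [neg_neg] at hU
    have := this (by rw [neg_re]; linarith) h8 hb
    rw [hU]
    unfold uBr
    convert this using 3
    · ring
    · ring

theorem small_step {n m : ℕ} (hm : 0 < m) (hmn : m < n) {P : ℂ → ℂ → ℂ}
    (hP : Differentiable ℂ fun p : ℂ × ℂ => P p.1 p.2) {L' : Set ℂ} {g : ℝ → ℝ} {b : ℝ}
    (hb : 0 ≤ b) {T : ℕ}
    (h : StripBound n m P L' b g) {l : ℂ} (hl : l ∈ L') {ε X : ℂ} (hε : ε ^ n = 1)
    (hT : ∀ t < T, iteratedDeriv t (fun X => P X (ε * uBr n m X + uPer n m * l)) 0 = 0)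
    (hX : ‖X‖ ≤ 1 / 2) :
    ‖P X (ε * uBr n m X + uPer n m * l)‖ ≤ (‖X‖ / (1 / 2)) ^ T * g (Real.log (1 / 2)) := by
  refine schwarz_order (F := fun X => P X (ε * uBr n m X + uPer n m * l)) (R := 1) (by norm_num)
    (by norm_num) ?_ ?_ hT hX
  · intro x hx
    have hU := (hasDerivAt_uBr hm hmn (ball_subset_xDom hx)).differentiableAt
    refine DifferentiableAt.differentiableWithinAt ?_
    exact DifferentiableAt.comp (g := fun p : ℂ × ℂ => P p.1 p.2)
        (f := fun X => (X, ε * uBr n m X + uPer n m * l)) x (hP _)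
        (DifferentiableAt.prodMk (by fun_prop) (by fun_prop))
  · intro x hx
    have := h.branch hm hmn hl hε (X := x) (ball_subset_xDom (by simp [hx]; norm_num))
      (by rw [hx]; norm_num) (by
        rw [hx]; exact (Real.log_nonpos (by norm_num) (by norm_num)).trans hb)
    rwa [hx] at this

theorem profile_nonneg_of_mem {κ l : ℝ} (hκ : 5 ≤ κ) (h1 : κ ≤ l) (h2 : l ≤ κ + 1) :
    0 ≤ profile κ l := by
  have : profile κ l = (4 * κ * l - l ^ 2 - 2 * κ ^ 2) / (12 * κ) := by
    unfold profile; field_simp; ring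
  rw [this]
  apply div_nonneg _ (by positivity)
  nlinarith

theorem profile_add_nonneg {κ l : ℝ} (hκ : 5 ≤ κ) (h1 : -2.08 ≤ l) (h2 : l ≤ κ) :
    0 ≤ profile κ l + κ / 3 := by
  have : profile κ l + κ / 3 = (4 * κ * l - l ^ 2 + 2 * κ ^ 2) / (12 * κ) := by
    unfold profile; field_simp; ring
  rw [this]
  apply div_nonneg _ (by positivity)
  nlinarith

theorem log_eight_lt : Real.log 8 < 2.08 := by
  have := Real.log_two_lt_d9
  rw [show (8 : ℝ) = 2 ^ 3 by norm_num, Real.log_pow]; push_cast; linarith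

theorem neg_log_le {x : ℝ} (h : 1 / 8 ≤ x) : -2.08 ≤ Real.log x := by
  have h1 := Real.log_le_log (by norm_num) h
  rw [one_div, Real.log_inv] at h1
  linarith [log_eight_lt]

theorem strip_step {n m : ℕ} (hm : 0 < m) (hmn : m < n) {P : ℂ → ℂ → ℂ}
    (hP : Differentiable ℂ fun p : ℂ × ℂ => P p.1 p.2) {L L' : Set ℂ}
    (hL : ∀ l ∈ L, ∀ ε ε' : ℂ, ε ^ n = 1 → ε' ^ n = 1 → l + ε - ε' ∈ L' ∧ l - ε + ε' ∈ L')
    {κ E μ : ℝ} (hκ : 5 ≤ κ) (hE0 : 0 ≤ E) (hμ : 0 ≤ μ) {T : ℕ}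
    (hE : StripBound n m P L' (κ + 1) fun _ => E)
    (hT : ∀ l ∈ L', ∀ ε : ℂ, ε ^ n = 1 → ∀ t < T,
      iteratedDeriv t (fun X => P X (ε * uBr n m X + uPer n m * l)) 0 = 0)
    (h : StripBound n m P L' κ fun l => E * Real.exp (T * (profile κ l + μ))) :
    StripBound n m P L κ fun l => E * Real.exp (T * (profile κ l + (μ - 1 / (96 * κ)))) := by
  intro l hl ε hε τ hτ z hre h8 hb
  have hκ0 : 0 < κ := by linarith
  have hx0 : 1 - z ^ n ≠ 0 := by intro h; rw [h, norm_zero] at h8; norm_num at h8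
  rcases le_or_gt ‖1 - z ^ n‖ (1 / 4) with h4 | h4
  · obtain ⟨ω, hω, hQ⟩ := exists_root_uInt hm hmn z (by
      intro h1; rw [h1, norm_one] at h4; norm_num at h4)
    set x := 1 - z ^ n with hx
    have hxd : x ∈ xDom := ball_subset_xDom (by rw [mem_ball_zero_iff]; linarith)
    have hεω : (ε * ω) ^ n = 1 := by rw [mul_pow, hε, hω, one_mul]
    have hl' : l + τ * (ε - ε * ω) ∈ L' := by
      have h1 := hL l hl ε (ε * ω) hε hεω
      rcases hτ with rfl | rfl
      · convert h1.1 using 1; ring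
      · convert h1.2 using 1; ring
    have hτn : ‖τ * x‖ = ‖x‖ := by rcases hτ with rfl | rfl <;> simp
    have hτU : uBr n m (τ * x) = τ * uBr n m x := by
      rcases hτ with rfl | rfl
      · simp
      · rw [neg_one_mul, uBr_neg hm hmn hxd, neg_one_mul]
    have h2 := small_step hm hmn hP hκ0.le h hl' (X := τ * x) hεω (hT _ hl' _ hεω)
      (by rw [hτn]; linarith)
    have e : ε * ω * uBr n m (τ * x) + uPer n m * (l + τ * (ε - ε * ω)) =
      ε * τ * (uPer n m - uInt n m z) + uPer n m * l := by rw [hτU, hQ]; ring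
    rw [e, hτn] at h2
    refine h2.trans ?_
    have hx8 : 0 < ‖x‖ / (1 / 2) := by positivity
    rw [← Real.exp_log hx8, ← Real.exp_nat_mul, mul_left_comm, ← Real.exp_add, ← mul_add,
      Real.log_div (by positivity) (by norm_num)]
    refine mul_le_mul_of_nonneg_left (Real.exp_le_exp.2
      (mul_le_mul_of_nonneg_left ?_ (Nat.cast_nonneg T))) hE0
    set v := Real.log ‖x‖
    have hv1 : -2.08 ≤ v := neg_log_le h8
    have hu : Real.log (1 / 2) = - Real.log 2 := by rw [one_div, Real.log_inv]
    have hv2 : v ≤ - 2 * Real.log 2 := by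
      have := Real.log_le_log (by positivity) h4
      rw [show (1 / 4 : ℝ) = ((2 : ℝ) ^ 2)⁻¹ by norm_num, Real.log_inv, Real.log_pow] at this
      push_cast at this; linarith
    rw [hu]
    set u := Real.log 2
    have hu1 : 0.69 ≤ u := by have := Real.log_two_gt_d9; linarith
    have hu2 : u ≤ 0.7 := by have := Real.log_two_lt_d9; linarith
    unfold profile
    have hk : 0 < 1 / (12 * κ) := by positivity
    have hk2 : 1 / (12 * κ) ≤ 1 / 60 := by
      apply one_div_le_one_div_of_le <;> linarith
    have e1 : 1 / (96 * κ) = (1 / (12 * κ)) / 8 := by field_simp; norm_num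
    rw [e1, div_eq_mul_one_div (v ^ 2), div_eq_mul_one_div ((-u) ^ 2)]
    set k := 1 / (12 * κ)
    have hv3 : v ^ 2 - u ^ 2 ≤ 3.9 := by nlinarith
    nlinarith [mul_le_mul_of_nonneg_right hv3 hk.le]
  · have key := max_mod_step hm hmn hP (κ := κ) (E := E) (μ := μ) (T := T) hκ0 (a := τ)
      (b := ε * τ) (c := uPer n m * l) hre hx0 ?_
    · exact key
    · intro w q hq hw
      have hsl := one_add_mem_slitPlane (mem_slitPlane_of_exp hre hx0 hq.le)
      rw [← hw] at hsl
      have hlog : Real.log ‖1 - w ^ n‖ = Real.log ‖1 - z ^ n‖ + q.re := by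
        rw [hw, norm_eq_mul_exp hx0]
      have hq1 := abs_le.1 ((abs_re_le_norm q).trans hq.le)
      have hw8 : 1 / 8 ≤ ‖1 - w ^ n‖ := by
        rw [hw, norm_mul, Complex.norm_exp]
        have h1 : 1 / 2 ≤ Real.exp q.re := by
          have := Real.add_one_le_exp q.re
          linarith [hq1.1]
        nlinarith
      rcases le_or_gt (Real.log ‖1 - w ^ n‖) κ with hk | hk
      · exact h.extend hm hmn hL hl hε hτ hsl hw8 hk
      · refine (hE.extend hm hmn hL hl hε hτ hsl hw8 (by linarith [hq1.2])).trans ?_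
        have := profile_nonneg_of_mem hκ hk.le (by linarith [hq1.2])
        exact le_mul_of_one_le_right hE0 (Real.one_le_exp (by positivity))

/-- Vanishing at the origin of all the branches forces `P` to be small on the curve. -/
theorem extrapolation {n m : ℕ} (hm : 0 < m) (hmn : m < n) {P : ℂ → ℂ → ℂ}
    (hP : Differentiable ℂ fun p : ℂ × ℂ => P p.1 p.2) {L : ℕ → Set ℂ}
    (hL : ∀ j, ∀ l ∈ L j, ∀ ε ε' : ℂ, ε ^ n = 1 → ε' ^ n = 1 →
      l + ε - ε' ∈ L (j + 1) ∧ l - ε + ε' ∈ L (j + 1))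
    {κ E : ℝ} (hκ : 5 ≤ κ) (hE0 : 0 ≤ E) {T J : ℕ} (hJ : (J : ℝ) = 32 * κ ^ 2)
    (hE : ∀ j ≤ J, StripBound n m P (L j) (κ + 1) fun _ => E)
    (hT : ∀ j ≤ J, ∀ l ∈ L j, ∀ ε : ℂ, ε ^ n = 1 → ∀ t < T,
      iteratedDeriv t (fun X => P X (ε * uBr n m X + uPer n m * l)) 0 = 0)
    {l : ℂ} (hl : l ∈ L 0) {ε X : ℂ} (hε : ε ^ n = 1) (hX : ‖X‖ = 1 / 8) :
    ‖P X (ε * uBr n m X + uPer n m * l)‖ ≤ E * Real.exp (-(T * (κ / 6))) := by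
  have hκ0 : 0 < κ := by linarith
  have key : ∀ i j : ℕ, i + j = J → StripBound n m P (L j) κ
      fun l => E * Real.exp (T * (profile κ l + j / (96 * κ))) := by
    intro i
    induction i with
    | zero =>
      intro j hj l hl ε hε τ hτ z hre h8 hb
      refine (hE j (by omega) l hl ε hε τ hτ z hre h8 (by linarith)).trans ?_
      have hj' : (j : ℝ) / (96 * κ) = κ / 3 := by
        rw [show j = J by omega, hJ]; field_simp; norm_num
      have := profile_add_nonneg hκ (neg_log_le h8) hb
      dsimp only
      rw [hj']
      exact le_mul_of_one_le_right hE0 (Real.one_le_exp (by positivity))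
    | succ i ih =>
      intro j hj
      have := strip_step hm hmn hP (hL j) hκ hE0 (μ := ((j + 1 : ℕ) : ℝ) / (96 * κ)) (by positivity)
        (hE (j + 1) (by omega)) (hT (j + 1) (by omega)) (ih (j + 1) (by omega))
      convert this using 5
      push_cast; ring
  have h0 := (key J 0 (by simp)).branch hm hmn hl hε (X := X)
    (ball_subset_xDom (by simp [hX]; norm_num)) (by rw [hX])
    (by rw [hX]; exact (Real.log_nonpos (by norm_num) (by norm_num)).trans hκ0.le)
  refine h0.trans ?_
  rw [hX]
  refine mul_le_mul_of_nonneg_left (Real.exp_le_exp.2 ?_) hE0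
  have h1 : Real.log (1 / 8) ≤ 0 := Real.log_nonpos (by norm_num) (by norm_num)
  have h2 : profile κ (Real.log (1 / 8)) ≤ - (κ / 6) := by
    unfold profile
    have : 0 ≤ Real.log (1 / 8) ^ 2 / (12 * κ) := by positivity
    linarith
  have h3 := mul_le_mul_of_nonneg_left h2 (Nat.cast_nonneg T : (0 : ℝ) ≤ T)
  simpa [mul_neg] using h3

end

section

open MeasureTheory Set Complex

theorem ofReal_mem_uDom {n : ℕ} {w : ℝ} (h0 : 0 ≤ w) (h1 : w ≤ 1) : (w : ℂ) ∈ uDom n := by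
  unfold uDom
  rw [Set.mem_ofPred_eq, mem_slitPlane_iff]
  left
  rw [← ofReal_pow, sub_re, ofReal_re]
  have := pow_le_one₀ h0 h1 (n := n)
  have h2 : (2 : ℂ).re = 2 := rfl
  rw [h2]; linarith

theorem betaIntegral_half {n m : ℕ} (hm : 0 < m) (hmn : m < n) :
    betaIntegral (1 / 2) ((m / n : ℝ) : ℂ) = 2 * uPer n m := by
  have hn : 0 < n := by omega
  have hs : (0 : ℝ) < m / n := by positivity
  have hroot : ∀ x : ℝ, 0 ≤ x → x ≤ 1 →
      0 ≤ (1 - √x) ^ ((n : ℝ)⁻¹) ∧ (1 - √x) ^ ((n : ℝ)⁻¹) ≤ 1 ∧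
      (((1 - √x) ^ ((n : ℝ)⁻¹) : ℝ) : ℂ) = (1 - ((√x : ℝ) : ℂ)) ^ ((n : ℂ)⁻¹) := by
    intro x h0 h1
    have h2 : 0 ≤ 1 - √x := by
      have := Real.sqrt_le_one.2 h1
      linarith
    refine ⟨by positivity, Real.rpow_le_one h2 (by linarith [Real.sqrt_nonneg x]) (by positivity), ?_⟩
    rw [ofReal_cpow h2]; push_cast; rfl
  have hvalint := betaIntegral_convergent (u := 1 / 2) (v := ((m / n : ℝ) : ℂ)) (by norm_num)
    (by rwa [ofReal_re])
  have key := intervalIntegral.integral_eq_sub_of_hasDerivAt_of_le (a := 0) (b := 1)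
    (f := fun x : ℝ => 2 * uBr n m ((√x : ℝ) : ℂ)) zero_le_one ?_ ?_ hvalint
  · rw [betaIntegral, key]
    simp only [Real.sqrt_one, Real.sqrt_zero, ofReal_zero, uBr_zero, ofReal_one]
    simp only [uBr, sub_self, uInt, radialInt]
    rw [zero_cpow (inv_ne_zero (Nat.cast_ne_zero.2 hn.ne'))]
    simp
  · have hc : ContinuousOn (fun x : ℝ => 2 * (uPer n m -
        uInt n m (((1 - √x) ^ ((n : ℝ)⁻¹) : ℝ) : ℂ))) (Icc 0 1) := by
      refine continuousOn_const.mul (continuousOn_const.sub ?_)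
      refine (differentiableOn_uInt n m).continuousOn.comp (s := Icc (0 : ℝ) 1)
        (f := fun x : ℝ => (((1 - √x) ^ ((n : ℝ)⁻¹) : ℝ) : ℂ)) ?_ ?_
      · refine (continuous_ofReal.comp ?_).continuousOn
        refine Continuous.rpow_const (by fun_prop) fun _ => Or.inr (by positivity)
      · intro x hx
        obtain ⟨h1, h2, -⟩ := hroot x hx.1 hx.2
        exact ofReal_mem_uDom h1 h2
    refine hc.congr fun x hx => ?_
    dsimp only
    rw [(hroot x hx.1 hx.2).2.2]
    rfl
  · intro x hx
    have hy0 : 0 < √x := Real.sqrt_pos.2 hx.1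
    have hy1 : √x < 1 := by rw [Real.sqrt_lt' one_pos]; simpa using hx.2
    have hd : ((√x : ℝ) : ℂ) ∈ xDom := ball_subset_xDom (by
      rw [mem_ball_zero_iff, norm_real, Real.norm_of_nonneg hy0.le]; exact hy1)
    have h1 := (hasDerivAt_uBr hm hmn hd).scomp x (Real.hasDerivAt_sqrt hx.1.ne').ofReal_comp
    have h2 := h1.const_mul 2
    refine HasDerivAt.congr_deriv h2 ?_
    symm
    set y := √x with hy
    have hxy : x = y * y := (Real.mul_self_sqrt hx.1.le).symm
    have hyc : (y : ℂ) ≠ 0 := ofReal_ne_zero.2 hy0.ne'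
    have e1 : (x : ℂ) ^ ((1 / 2 : ℂ) - 1) = (y : ℂ)⁻¹ := by
      rw [hxy]
      push_cast
      rw [mul_cpow_ofReal_nonneg hy0.le hy0.le, ← cpow_add _ _ hyc]
      norm_num
      rw [cpow_neg_one]
    have e2 : (1 - (x : ℂ)) ^ (((m / n : ℝ) : ℂ) - 1) =
        (1 - (y : ℂ)) ^ (((m / n - 1 : ℝ)) : ℂ) * (1 + (y : ℂ)) ^ (((m / n - 1 : ℝ)) : ℂ) := by
      have := mul_cpow_ofReal_nonneg (a := 1 - y) (b := 1 + y) (by linarith) (by linarith)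
        (((m / n - 1 : ℝ)) : ℂ)
      push_cast at this ⊢
      rw [← this]
      congr 1
      rw [hxy]; push_cast; ring
    rw [e1, e2, smul_eq_mul]
    push_cast
    field_simp

theorem gamma_quotient_eq {n m : ℕ} (hm : 0 < m) (hmn : m < n) :
    ((Real.Gamma (1 / 2) * Real.Gamma (m / n) / Real.Gamma (1 / 2 + m / n) : ℝ) : ℂ) =
      2 * uPer n m := by
  have hn : 0 < n := by omega
  have hs : (0 : ℝ) < m / n := by positivity
  have h := Gamma_mul_Gamma_eq_betaIntegral (s := ((1 / 2 : ℝ) : ℂ)) (t := ((m / n : ℝ) : ℂ))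
    (by rw [ofReal_re]; norm_num) (by rwa [ofReal_re])
  rw [← ofReal_add, Gamma_ofReal, Gamma_ofReal, Gamma_ofReal] at h
  have hne : Real.Gamma (1 / 2 + m / n) ≠ 0 := (Real.Gamma_pos_of_pos (by positivity)).ne'
  rw [← betaIntegral_half hm hmn, ofReal_div, ofReal_mul, h]
  rw [mul_div_cancel_left₀ _ (ofReal_ne_zero.2 hne)]
  congr 1
  push_cast; rfl

end

section

open Polynomial

/-- Taylor coefficients of `(1-x²)^(m/n-1)`. -/
def wCoef (n m : ℕ) : ℕ → ℚ
  | 0 => 1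
  | 1 => 0
  | k + 2 => wCoef n m k * ((k + 2 - 2 * (m / n)) / (k + 2))

/-- Taylor coefficients of `∫₀ˣ (1-t²)^(m/n-1) dt`. -/
def uCoef (n m : ℕ) : ℕ → ℚ
  | 0 => 0
  | k + 1 => wCoef n m k / (k + 1)

theorem wCoef_mem (n m : ℕ) (hm : 0 < m) (hmn : m < n) : ∀ k, 0 ≤ wCoef n m k ∧ wCoef n m k ≤ 1 := by
  have hn : (0 : ℚ) < n := by exact_mod_cast (by omega : 0 < n)
  have h1 : (m : ℚ) / n ≤ 1 := div_le_one_of_le₀ (by exact_mod_cast hmn.le) hn.le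
  have h0 : (0 : ℚ) ≤ m / n := by positivity
  intro k
  induction k using Nat.twoStepInduction with
  | zero => simp [wCoef]
  | one => simp [wCoef]
  | more k ih _ =>
    have hk : (0 : ℚ) ≤ k := Nat.cast_nonneg k
    have a1 : 0 ≤ ((k : ℚ) + 2 - 2 * (m / n)) / (k + 2) := div_nonneg (by linarith) (by linarith)
    have a2 : ((k : ℚ) + 2 - 2 * (m / n)) / (k + 2) ≤ 1 := div_le_one_of_le₀ (by linarith) (by linarith)
    rw [wCoef]
    exact ⟨mul_nonneg ih.1 a1, mul_le_one₀ ih.2 a1 a2⟩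

theorem uCoef_mem (n m : ℕ) (hm : 0 < m) (hmn : m < n) (k : ℕ) :
    0 ≤ uCoef n m k ∧ uCoef n m k ≤ 1 := by
  cases k with
  | zero => simp [uCoef]
  | succ k =>
    obtain ⟨h0, h1⟩ := wCoef_mem n m hm hmn k
    have hk : (0 : ℚ) ≤ k := Nat.cast_nonneg k
    rw [uCoef]
    exact ⟨div_nonneg h0 (by linarith), div_le_one_of_le₀ (by linarith) (by linarith)⟩

theorem wCoef_int (n m : ℕ) (hn : 0 < n) : ∀ k, ∃ z : ℤ, (k.factorial : ℚ) * n ^ k * wCoef n m k = z := by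
  have hn' : (n : ℚ) ≠ 0 := by exact_mod_cast hn.ne'
  intro k
  induction k using Nat.twoStepInduction with
  | zero => exact ⟨1, by simp [wCoef]⟩
  | one => exact ⟨0, by simp [wCoef]⟩
  | more k ih _ =>
    obtain ⟨z, hz⟩ := ih
    refine ⟨z * ((k + 1) * n * (n * (k + 2) - 2 * m)), ?_⟩
    have hk : (k : ℚ) + 2 ≠ 0 := by positivity
    push_cast
    rw [← hz, wCoef, Nat.factorial_succ, Nat.factorial_succ]
    push_cast
    field_simp
    ring

theorem uCoef_int (n m : ℕ) (hn : 0 < n) (k : ℕ) :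
    ∃ z : ℤ, (k.factorial : ℚ) * n ^ k * uCoef n m k = z := by
  cases k with
  | zero => exact ⟨0, by simp [uCoef]⟩
  | succ k =>
    obtain ⟨z, hz⟩ := wCoef_int n m hn k
    refine ⟨z * n, ?_⟩
    have hk : (k : ℚ) + 1 ≠ 0 := by positivity
    push_cast
    rw [← hz, uCoef, Nat.factorial_succ]
    push_cast
    field_simp
    ring

/-- The series of `(1-x²)^(m/n-1)` over a field. -/
noncomputable def wSer (n m : ℕ) (F : Type*) [Field F] : PowerSeries F :=
  PowerSeries.mk fun k => (wCoef n m k : F)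

noncomputable def uSer (n m : ℕ) (F : Type*) [Field F] : PowerSeries F :=
  PowerSeries.mk fun k => (uCoef n m k : F)

section
variable {F : Type*} [Field F] [CharZero F]

theorem derivative_uSer (n m : ℕ) : PowerSeries.derivative F (uSer n m F) = wSer n m F := by
  ext k
  rw [PowerSeries.coeff_derivative, uSer, wSer, PowerSeries.coeff_mk, PowerSeries.coeff_mk, uCoef]
  have : (k : F) + 1 ≠ 0 := Nat.cast_add_one_ne_zero k
  push_cast
  field_simp

theorem wSer_ode (n m : ℕ) :
    (1 - PowerSeries.X ^ 2) * PowerSeries.derivative F (wSer n m F) =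
      PowerSeries.C ((2 * (1 - (m : ℚ) / n) : ℚ) : F) * PowerSeries.X * wSer n m F := by
  ext k
  rw [sub_mul, one_mul, map_sub, mul_assoc, PowerSeries.coeff_C_mul,
    PowerSeries.coeff_derivative, wSer, PowerSeries.coeff_mk]
  cases k with
  | zero => simp [wCoef, PowerSeries.coeff_X_pow_mul']
  | succ k =>
    rw [PowerSeries.coeff_succ_X_mul, PowerSeries.coeff_mk, wCoef]
    have e : PowerSeries.coeff (k + 1) ((PowerSeries.X : PowerSeries F) ^ 2 *
        PowerSeries.derivative F (PowerSeries.mk fun k => (wCoef n m k : F))) = (wCoef n m k : F) * k := by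
      cases k with
      | zero => simp [PowerSeries.coeff_X_pow_mul']
      | succ k =>
        rw [show k + 1 + 1 = k + 2 by rfl, PowerSeries.coeff_X_pow_mul, PowerSeries.coeff_derivative,
          PowerSeries.coeff_mk]
        push_cast; rfl
    rw [e]
    have : (k : F) + 2 ≠ 0 := by exact_mod_cast (by omega : k + 2 ≠ 0)
    push_cast
    field_simp
    ring

theorem wSer_ne_zero (n m : ℕ) : wSer n m F ≠ 0 := by
  intro h
  have := congrArg (PowerSeries.coeff 0) h
  rw [wSer, PowerSeries.coeff_mk, wCoef] at this
  simp at this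

omit [CharZero F] in
theorem constantCoeff_wSer (n m : ℕ) : PowerSeries.constantCoeff (wSer n m F) = 1 := by
  rw [← PowerSeries.coeff_zero_eq_constantCoeff_apply, wSer, PowerSeries.coeff_mk, wCoef]; simp

theorem one_sub_X_sq_ne_zero : (1 - PowerSeries.X ^ 2 : PowerSeries F) ≠ 0 := by
  intro h
  have := congrArg PowerSeries.constantCoeff h
  simp at this

theorem eq_wSer {n m : ℕ} {f : PowerSeries F} (h0 : PowerSeries.constantCoeff f = 1)
    (h : (1 - PowerSeries.X ^ 2) * PowerSeries.derivative F f =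
      PowerSeries.C ((2 * (1 - (m : ℚ) / n) : ℚ) : F) * PowerSeries.X * f) : f = wSer n m F := by
  set w := wSer n m F with hw
  have hc : PowerSeries.constantCoeff w ≠ 0 := by rw [hw, constantCoeff_wSer]; exact one_ne_zero
  set g := f * w⁻¹ with hg
  have hgw : g * w = f := by rw [hg, mul_assoc, PowerSeries.inv_mul_cancel _ hc, mul_one]
  have h1 : PowerSeries.derivative F g = 0 := by
    have e := h
    rw [← hgw, Derivation.leibniz, smul_eq_mul, smul_eq_mul] at e
    have e2 := wSer_ode (F := F) n m
    rw [← hw] at e2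
    have : (1 - PowerSeries.X ^ 2) * w * PowerSeries.derivative F g = 0 := by
      linear_combination e - g * e2
    exact (mul_eq_zero.1 this).resolve_left (mul_ne_zero one_sub_X_sq_ne_zero (wSer_ne_zero n m))
  have h2 : g = 1 := by
    refine PowerSeries.derivative.ext ?_ ?_
    · rw [h1]; simp
    · rw [hg, map_mul, PowerSeries.constantCoeff_inv, h0, hw, constantCoeff_wSer]; simp
  rw [← hgw, h2, one_mul]

theorem wSer_pow_mul {n m : ℕ} (hmn : m < n) :
    wSer n m F ^ n * (1 - PowerSeries.X ^ 2) ^ (n - m) = 1 := by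
  obtain ⟨k, rfl⟩ : ∃ k, n = m + (k + 1) := ⟨n - m - 1, by omega⟩
  set n := m + (k + 1) with hn
  have hn0 : (n : F) ≠ 0 := by exact_mod_cast (by omega : n ≠ 0)
  rw [show n - m = k + 1 by omega]
  refine PowerSeries.derivative.ext ?_ ?_
  · have h : (1 - PowerSeries.X ^ 2) * PowerSeries.derivative F
        (wSer n m F ^ n * (1 - PowerSeries.X ^ 2) ^ (k + 1)) = 0 := by
      rw [Derivation.leibniz, Derivation.leibniz_pow, Derivation.leibniz_pow]
      simp only [smul_eq_mul, nsmul_eq_mul, map_sub, Derivation.leibniz_pow, Nat.add_sub_cancel,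
        PowerSeries.derivative_X, Derivation.map_one_eq_zero]
      have e2 := wSer_ode (F := F) n m
      have e3 : PowerSeries.C ((2 * (1 - (m : ℚ) / n) : ℚ) : F) * (n : PowerSeries F) =
          2 * (k + 1) := by
        rw [← map_natCast (PowerSeries.C (R := F)), ← map_mul]
        have : ((2 * (1 - (m : ℚ) / n) : ℚ) : F) * n = 2 * (k + 1) := by
          push_cast
          field_simp
          rw [hn]; push_cast; ring
        rw [this]; simp [map_ofNat]
      rw [show wSer n m F ^ n = wSer n m F ^ (n - 1) * wSer n m F by
        rw [← pow_succ, Nat.sub_add_cancel (by omega)]]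
      push_cast
      linear_combination (1 - PowerSeries.X ^ 2) ^ (k + 1) * (n : PowerSeries F) *
        wSer n m F ^ (n - 1) * e2 + (1 - PowerSeries.X ^ 2) ^ (k + 1) * wSer n m F ^ (n - 1) *
        PowerSeries.X * wSer n m F * e3
    rw [(mul_eq_zero.1 h).resolve_left one_sub_X_sq_ne_zero]
    simp
  · rw [map_mul, map_pow, constantCoeff_wSer]; simp

/-- The quotient `V = U / U'`. -/
noncomputable def vSer (n m : ℕ) (F : Type*) [Field F] : PowerSeries F :=
  uSer n m F * (wSer n m F)⁻¹

omit [CharZero F] in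
theorem vSer_mul (n m : ℕ) : vSer n m F * wSer n m F = uSer n m F := by
  rw [vSer, mul_assoc, PowerSeries.inv_mul_cancel, mul_one]
  rw [constantCoeff_wSer]; exact one_ne_zero

theorem vSer_ode (n m : ℕ) :
    (1 - PowerSeries.X ^ 2) * PowerSeries.derivative F (vSer n m F) = (1 - PowerSeries.X ^ 2) -
      PowerSeries.C ((2 * (1 - (m : ℚ) / n) : ℚ) : F) * PowerSeries.X * vSer n m F := by
  have h := derivative_uSer (F := F) n m
  rw [← vSer_mul, Derivation.leibniz, smul_eq_mul, smul_eq_mul] at h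
  have e2 := wSer_ode (F := F) n m
  refine mul_left_cancel₀ (wSer_ne_zero (F := F) n m) ?_
  linear_combination (1 - PowerSeries.X ^ 2) * h - vSer n m F * e2

end

theorem curve_zero_estimate {n m : ℕ} (hm : 0 < m) (hmn : m < n) {δ : ℂ} (hδ : δ ≠ 0)
    (p : ℕ → ℂ[X]) {A B T : ℕ} (hA : ∀ b, (p b).natDegree ≤ A) (hp : ∃ b < B, p b ≠ 0)
    (hT : PowerSeries.X ^ T ∣ ∑ b ∈ Finset.range B,
      (p b : PowerSeries ℂ) * (PowerSeries.C δ * uSer n m ℂ) ^ (n * b)) :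
    T ≤ n * B + (n * B + 1) * (A + 2 * (n * B) + 2 * (n * B)) := by
  classical
  have hn : 0 < n := by omega
  obtain ⟨b1, hb1, hpb1⟩ := hp
  let S := (Finset.range B).filter fun b => p b ≠ 0
  have hS : S.Nonempty := ⟨b1, by simp [S, hb1, hpb1]⟩
  let M := S.max' hS
  have hM : M ∈ S := S.max'_mem hS
  have hMB : M < B := by simpa using (Finset.mem_filter.1 hM).1
  have hpM : p M ≠ 0 := (Finset.mem_filter.1 hM).2
  have hgt : ∀ b, M < b → b < B → p b = 0 := by
    intro b h1 h2
    by_contra h3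
    exact absurd (S.le_max' b (by simp [S, h2, h3])) (not_le.2 h1)
  let q : ℂ[X] := 1 - X ^ 2
  have hq0 : q ≠ 0 := by
    intro h
    have := congrArg (Polynomial.eval 0) h
    simp [q] at this
  have hqd : q.natDegree ≤ 2 := by
    simp only [q]; compute_degree
  let g : ℕ → ℂ[X] := fun b => C (δ ^ (n * b)) * p b * q ^ ((n - m) * (B - b))
  let G : ℕ → ℂ[X] := fun j => if n ∣ j ∧ j ≤ n * M then g (j / n) else 0
  have hGb : ∀ b ≤ M, G (n * b) = g b := by
    intro b hb
    simp only [G]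
    rw [if_pos ⟨dvd_mul_right _ _, Nat.mul_le_mul_left n hb⟩, Nat.mul_div_cancel_left _ hn]
  set a : ℚ := 2 * (1 - (m : ℚ) / n) with ha
  have hn' : (0 : ℚ) < n := by exact_mod_cast hn
  have ha0 : 0 < a := by
    have : (m : ℚ) / n < 1 := by rw [div_lt_one hn']; exact_mod_cast hmn
    rw [ha]; linarith
  have ha2 : a < 2 := by
    have : 0 < (m : ℚ) / n := div_pos (by exact_mod_cast hm) hn'
    rw [ha]; linarith
  have hev : evalSer (n * M) G (vSer n m ℂ) = (1 - PowerSeries.X ^ 2) ^ ((n - m) * B) *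
      ∑ b ∈ Finset.range B, (p b : PowerSeries ℂ) * (PowerSeries.C δ * uSer n m ℂ) ^ (n * b) := by
    rw [Finset.mul_sum, ← Finset.sum_subset (Finset.range_subset_range.2 (show M + 1 ≤ B from hMB))]
    · unfold evalSer
      rw [← Finset.sum_subset (s₁ := (Finset.range (M + 1)).image (n * ·))]
      · rw [Finset.sum_image (fun x _ y _ h => Nat.eq_of_mul_eq_mul_left hn h)]
        refine Finset.sum_congr rfl fun b hb => ?_
        have hbM : b ≤ M := by simpa [Nat.lt_succ_iff] using hb
        rw [hGb b hbM]
        simp only [g, q]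
        rw [← vSer_mul]
        have h1 := wSer_pow_mul (F := ℂ) hmn
        have h2 : wSer n m ℂ ^ (n * b) * (1 - PowerSeries.X ^ 2) ^ ((n - m) * b) = 1 := by
          rw [pow_mul, pow_mul, ← mul_pow, h1, one_pow]
        rw [show (n - m) * B = (n - m) * b + (n - m) * (B - b) by rw [← mul_add]; congr 1; omega]
        push_cast
        rw [pow_add, mul_pow, mul_pow, ← map_pow]
        linear_combination (-(p b : PowerSeries ℂ) * PowerSeries.C (δ ^ (n * b)) *
          vSer n m ℂ ^ (n * b) * (1 - PowerSeries.X ^ 2) ^ ((n - m) * (B - b))) * h2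
      · intro j hj
        obtain ⟨b, hb, rfl⟩ := Finset.mem_image.1 hj
        have hbM : b ≤ M := by simpa [Nat.lt_succ_iff] using hb
        simpa [Nat.lt_succ_iff] using Nat.mul_le_mul_left n hbM
      · intro j hj hj'
        have : ¬ n ∣ j := by
          rintro ⟨b, rfl⟩
          apply hj'
          have : n * b ≤ n * M := by simpa [Nat.lt_succ_iff] using hj
          exact Finset.mem_image.2 ⟨b, by
            simpa [Nat.lt_succ_iff] using Nat.le_of_mul_le_mul_left this hn, rfl⟩
        simp [G, this]
    · intro b hb hb'
      rw [hgt b (by simpa using hb') (by simpa using hb)]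
      simp
  have key := zero_estimate (F := ℂ) (a : ℂ) (by exact_mod_cast ha0.ne')
    (by
      intro k hk h
      have : (2 * (k : ℚ) + a : ℚ) = 0 := by exact_mod_cast h
      have hk' : (0 : ℚ) ≤ k := Nat.cast_nonneg k
      linarith)
    (by
      intro k hk h
      have h1 : a = k := by exact_mod_cast h
      have hk' : (2 : ℚ) ≤ k := by exact_mod_cast hk
      linarith) (vSer n m ℂ) (vSer_ode n m) (n * M) (A + 2 * (n * B)) T G
    (by
      rw [hGb M le_rfl]
      exact mul_ne_zero (mul_ne_zero (C_ne_zero.2 (pow_ne_zero _ hδ)) hpM) (pow_ne_zero _ hq0))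
    (by intro j hj; simp only [G]; rw [if_neg (fun h => absurd h.2 (not_le.2 hj))])
    (by
      intro j
      simp only [G]
      split_ifs
      · refine natDegree_mul_le.trans (add_le_add ((natDegree_C_mul_le _ _).trans (hA _)) ?_)
        refine natDegree_pow_le.trans ?_
        calc (n - m) * (B - j / n) * q.natDegree ≤ n * B * 2 :=
              Nat.mul_le_mul (Nat.mul_le_mul (Nat.sub_le _ _) (Nat.sub_le _ _)) hqd
          _ = 2 * (n * B) := by ring
      · simp)
    (by rw [hev]; exact hT.mul_left _)
  have hMB' : n * M ≤ n * B := Nat.mul_le_mul_left n hMB.le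
  exact key.trans (by gcongr)

theorem taylorSer_uBr {n m : ℕ} (hm : 0 < m) (hmn : m < n) : taylorSer (uBr n m) = uSer n m ℂ := by
  set s : ℂ := (((m / n - 1 : ℝ)) : ℂ) with hs
  let h : ℂ → ℂ := fun x => (1 - x) ^ s * (1 + x) ^ s
  have h0 : xDom ∈ nhds (0 : ℂ) := isOpen_xDom.mem_nhds (ball_subset_xDom (by simp))
  have hU : deriv (uBr n m) =ᶠ[nhds 0] h := by
    filter_upwards [h0] with x hx
    exact (hasDerivAt_uBr hm hmn hx).deriv
  have hdh : ∀ x ∈ xDom, HasDerivAt h (-(s * (1 - x) ^ (s - 1)) * (1 + x) ^ s +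
      (1 - x) ^ s * (s * (1 + x) ^ (s - 1))) x := by
    intro x hx
    have h1 : HasDerivAt (fun x : ℂ => (1 - x) ^ s) (s * (1 - x) ^ (s - 1) * (-1)) x :=
      HasDerivAt.cpow_const (by simpa using (hasDerivAt_id x).const_sub 1) hx.1
    have h2 : HasDerivAt (fun x : ℂ => (1 + x) ^ s) (s * (1 + x) ^ (s - 1) * 1) x :=
      HasDerivAt.cpow_const (by simpa using (hasDerivAt_id x).const_add 1) hx.2
    refine (h1.mul h2).congr_deriv ?_
    ring
  have hode : (fun x => (1 - x ^ 2) * deriv h x) =ᶠ[nhds 0] fun x => (-(2 * s) * x) * h x := by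
    filter_upwards [h0] with x hx
    rw [(hdh x hx).deriv]
    have a1 := Complex.slitPlane_ne_zero hx.1
    have a2 := Complex.slitPlane_ne_zero hx.2
    simp only [h]
    rw [Complex.cpow_sub _ _ a1, Complex.cpow_sub _ _ a2, Complex.cpow_one, Complex.cpow_one]
    field_simp
    ring
  have hha : AnalyticAt ℂ h 0 :=
    DifferentiableOn.analyticAt (fun x hx => (hdh x hx).differentiableAt.differentiableWithinAt) h0
  have e1 := taylorSer_congr hode
  have hid : taylorSer (fun x => x ^ 2) = PowerSeries.X ^ 2 := by
    rw [taylorSer_pow (f := fun x => x) analyticAt_id, taylorSer_id]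
  have hq : taylorSer (fun x => 1 - x ^ 2) = 1 - PowerSeries.X ^ 2 := by
    have : (fun x : ℂ => 1 - x ^ 2) = fun x => 1 + (-1) * x ^ 2 := by ext; ring
    rw [this, taylorSer_add (f := fun _ => 1) (g := fun x => (-1) * x ^ 2) (by fun_prop) (by fun_prop),
      taylorSer_mul (f := fun _ => -1) (g := fun x => x ^ 2) (by fun_prop) (by fun_prop), hid,
      taylorSer_const, taylorSer_const]
    simp [sub_eq_add_neg]
  rw [taylorSer_mul (f := fun x => 1 - x ^ 2) (g := deriv h) (by fun_prop) hha.deriv, hq,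
    taylorSer_deriv, taylorSer_mul (f := fun x => -(2 * s) * x) (g := h) (by fun_prop) hha,
    taylorSer_mul (f := fun x => -(2 * s)) (g := fun x => x) (by fun_prop) analyticAt_id,
    taylorSer_id, taylorSer_const] at e1
  have hw : taylorSer h = wSer n m ℂ := by
    refine eq_wSer ?_ ?_
    · rw [← PowerSeries.coeff_zero_eq_constantCoeff_apply, coeff_taylorSer]
      simp [h]
    · rw [e1]
      congr 3
      rw [hs]; push_cast; ring
  refine PowerSeries.derivative.ext ?_ ?_
  · rw [← taylorSer_deriv, taylorSer_congr hU, hw, derivative_uSer]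
  · rw [← PowerSeries.coeff_zero_eq_constantCoeff_apply, coeff_taylorSer,
      ← PowerSeries.coeff_zero_eq_constantCoeff_apply, uSer, PowerSeries.coeff_mk]
    simp [uBr_zero, uCoef]

end

section

open NumberField

theorem exists_siegel_const (K : Type) [Field K] [NumberField K] :
    ∃ c : ℝ, ∀ (α β : Type) [Fintype α] [Fintype β] (a : Matrix α β (𝓞 K)) (p : ℕ) (A : ℝ),
      a ≠ 0 → 0 < p → Fintype.card α = p → Fintype.card β = 2 * p →
      (∀ k l, house ((algebraMap (𝓞 K) K) (a k l)) ≤ A) →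
      ∃ ξ : β → 𝓞 K, ξ ≠ 0 ∧ a.mulVec ξ = 0 ∧
        ∀ l, house (ξ l).1 ≤ c * ((c * (2 * p : ℕ) * A) ^ ((p : ℝ) / ((2 * p : ℕ) - p))) := by
  classical
  exact ⟨_, fun α β _ _ a p A ha hp hα hβ hA =>
    house.exists_ne_zero_int_vec_house_le K a ha hp (by omega) hβ hA hα⟩

theorem exists_siegel_const' (K : Type) [Field K] [NumberField K] :
    ∃ c : ℝ, ∀ (α β : Type) [Fintype α] [Fintype β] (a : Matrix α β (𝓞 K)) (p : ℕ) (A : ℝ),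
      a ≠ 0 → 0 < p → Fintype.card α = p → Fintype.card β = 2 * p →
      (∀ k l, house ((algebraMap (𝓞 K) K) (a k l)) ≤ A) →
      ∃ ξ : β → 𝓞 K, ξ ≠ 0 ∧ a.mulVec ξ = 0 ∧
        ∀ l, house ((algebraMap (𝓞 K) K) (ξ l)) ≤ c * (2 * p) * A := by
  obtain ⟨c, hc⟩ := exists_siegel_const K
  refine ⟨c * c, fun α β _ _ a p A ha hp hα hβ hA => ?_⟩
  obtain ⟨ξ, h1, h2, h3⟩ := hc α β a p A ha hp hα hβ hA
  refine ⟨ξ, h1, h2, fun l => (h3 l).trans (le_of_eq ?_)⟩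
  have hp' : (p : ℝ) ≠ 0 := by exact_mod_cast hp.ne'
  have e : (p : ℝ) / ((2 * p : ℕ) - p) = 1 := by
    push_cast; rw [show (2 * p - p : ℝ) = p by ring, div_self hp']
  rw [e, Real.rpow_one]
  push_cast; ring

section
variable {K : Type} [Field K]

/-- Power series whose `t`-th coefficient has denominator dividing `t! n^t`. -/
def IsDen (n : ℕ) (f : PowerSeries K) : Prop :=
  ∀ t, IsIntegral ℤ ((t.factorial : K) * (n : K) ^ t * PowerSeries.coeff t f)

theorem IsDen.add {n : ℕ} {f g : PowerSeries K} (hf : IsDen n f) (hg : IsDen n g) :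
    IsDen n (f + g) := by
  intro t
  rw [map_add, mul_add]
  exact (hf t).add (hg t)

theorem IsDen.mul {n : ℕ} {f g : PowerSeries K} (hf : IsDen n f) (hg : IsDen n g) :
    IsDen n (f * g) := by
  intro t
  rw [PowerSeries.coeff_mul, Finset.mul_sum]
  refine IsIntegral.sum _ fun x hx => ?_
  rw [Finset.HasAntidiagonal.mem_antidiagonal] at hx
  have e : (t.factorial : K) = (t.choose x.2 : ℕ) * x.1.factorial * x.2.factorial := by
    rw [← hx]
    exact_mod_cast congrArg (Nat.cast (R := K)) (Nat.add_choose_mul_factorial_mul_factorial x.1 x.2).symm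
  have e2 : (t.factorial : K) * n ^ t * (PowerSeries.coeff x.1 f * PowerSeries.coeff x.2 g) =
      (t.choose x.2 : ℕ) * ((x.1.factorial : K) * n ^ x.1 * PowerSeries.coeff x.1 f) *
      ((x.2.factorial : K) * n ^ x.2 * PowerSeries.coeff x.2 g) := by
    rw [e]
    conv_lhs => rw [← hx, pow_add]
    rw [← hx]; ring
  rw [e2]
  exact ((isIntegral_natCast _).mul (hf _)).mul (hg _)

theorem IsDen.C {n : ℕ} {x : K} (hx : IsIntegral ℤ x) : IsDen n (PowerSeries.C x) := by
  intro t
  rw [PowerSeries.coeff_C]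
  split_ifs with h
  · rw [h]; simpa using hx
  · simp [isIntegral_zero]

theorem IsDen.X {n : ℕ} : IsDen n (PowerSeries.X : PowerSeries K) := by
  intro t
  rw [PowerSeries.coeff_X]
  split_ifs with h
  · rw [h]; simpa using isIntegral_natCast n
  · simp [isIntegral_zero]

theorem IsDen.pow {n : ℕ} {f : PowerSeries K} (hf : IsDen n f) (k : ℕ) : IsDen n (f ^ k) := by
  induction k with
  | zero =>
    rw [pow_zero]
    simpa using IsDen.C (n := n) (K := K) isIntegral_one
  | succ k ih => rw [pow_succ]; exact ih.mul hf

theorem IsDen.sum {n : ℕ} {ι : Type*} (s : Finset ι) (f : ι → PowerSeries K)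
    (hf : ∀ i ∈ s, IsDen n (f i)) : IsDen n (∑ i ∈ s, f i) := by
  intro t
  rw [map_sum, Finset.mul_sum]
  exact IsIntegral.sum _ fun i hi => hf i hi t

theorem IsDen.uSer [CharZero K] {n m : ℕ} (hn : 0 < n) : IsDen n (uSer n m K) := by
  intro t
  obtain ⟨z, hz⟩ := uCoef_int n m hn t
  rw [_root_.uSer, PowerSeries.coeff_mk]
  have : ((t.factorial : K) * n ^ t * (uCoef n m t : K)) = z := by exact_mod_cast congrArg (Rat.cast (K := K)) hz
  rw [this]
  exact isIntegral_intCast z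

variable [NumberField K]

/-- Sum of the houses of the coefficients up to degree `t`. -/
noncomputable def houseSum (t : ℕ) (f : PowerSeries K) : ℝ :=
  ∑ i ∈ Finset.range (t + 1), house (PowerSeries.coeff i f)

theorem houseSum_nonneg (t : ℕ) (f : PowerSeries K) : 0 ≤ houseSum t f :=
  Finset.sum_nonneg fun _ _ => house_nonneg _

theorem house_coeff_le (t : ℕ) (f : PowerSeries K) : house (PowerSeries.coeff t f) ≤ houseSum t f :=
  Finset.single_le_sum (f := fun i => house (PowerSeries.coeff i f)) (fun _ _ => house_nonneg _)
    (by simp)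

theorem houseSum_mul (t : ℕ) (f g : PowerSeries K) :
    houseSum t (f * g) ≤ houseSum t f * houseSum t g := by
  classical
  unfold houseSum
  rw [Finset.sum_mul_sum, ← Finset.sum_product']
  calc ∑ i ∈ Finset.range (t + 1), house (PowerSeries.coeff i (f * g))
      ≤ ∑ i ∈ Finset.range (t + 1), ∑ x ∈ Finset.HasAntidiagonal.antidiagonal i,
        house (PowerSeries.coeff x.1 f) * house (PowerSeries.coeff x.2 g) := by
        refine Finset.sum_le_sum fun i _ => ?_
        rw [PowerSeries.coeff_mul]
        exact (house_sum_le_sum_house _ _).trans (Finset.sum_le_sum fun x _ => house_mul_le _ _)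
    _ = ∑ x ∈ (Finset.range (t + 1)).biUnion fun i => Finset.HasAntidiagonal.antidiagonal i,
        house (PowerSeries.coeff x.1 f) * house (PowerSeries.coeff x.2 g) := by
        rw [Finset.sum_biUnion]
        intro i _ j _ hij
        rw [Function.onFun, Finset.disjoint_left]
        intro x hx hx'
        rw [Finset.HasAntidiagonal.mem_antidiagonal] at hx hx'
        exact hij (hx.symm.trans hx')
    _ ≤ _ := by
        refine Finset.sum_le_sum_of_subset_of_nonneg ?_ fun x _ _ =>
          mul_nonneg (house_nonneg _) (house_nonneg _)
        intro x hx
        simp only [Finset.mem_biUnion, Finset.mem_range, Finset.HasAntidiagonal.mem_antidiagonal] at hx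
        obtain ⟨i, hi, hx⟩ := hx
        simp only [Finset.mem_product, Finset.mem_range]
        omega

theorem houseSum_add (t : ℕ) (f g : PowerSeries K) :
    houseSum t (f + g) ≤ houseSum t f + houseSum t g := by
  unfold houseSum
  rw [← Finset.sum_add_distrib]
  exact Finset.sum_le_sum fun i _ => by rw [map_add]; exact house_add_le _ _

theorem house_zero : house (0 : K) = 0 := by simp [house]

theorem house_one : house (1 : K) = 1 := by simpa using house_intCast (K := K) 1

theorem houseSum_C (t : ℕ) (x : K) : houseSum t (PowerSeries.C x) = house x := by
  unfold houseSum
  rw [Finset.sum_eq_single 0]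
  · simp
  · intro i _ hi; rw [PowerSeries.coeff_C, if_neg hi, house_zero]
  · simp

theorem houseSum_pow (t : ℕ) (f : PowerSeries K) (k : ℕ) : houseSum t (f ^ k) ≤ houseSum t f ^ k := by
  induction k with
  | zero => rw [pow_zero, pow_zero, ← map_one (PowerSeries.C (R := K)), houseSum_C, house_one]
  | succ k ih =>
    rw [pow_succ, pow_succ]
    exact (houseSum_mul t _ _).trans (mul_le_mul_of_nonneg_right ih (houseSum_nonneg _ _))

theorem houseSum_X_pow (t k : ℕ) : houseSum t (PowerSeries.X ^ k : PowerSeries K) ≤ 1 := by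
  unfold houseSum
  simp only [PowerSeries.coeff_X_pow]
  calc _ = ∑ i ∈ Finset.range (t + 1), if i = k then (1 : ℝ) else 0 := by
        refine Finset.sum_congr rfl fun i _ => ?_
        split_ifs
        · exact house_one
        · exact house_zero
    _ ≤ 1 := by
        rw [Finset.sum_ite_eq']; split_ifs <;> norm_num

theorem house_ratCast (r : ℚ) : house (r : K) ≤ |(r : ℝ)| := by
  refine (pi_norm_le_iff_of_nonneg (abs_nonneg _)).2 fun σ => ?_
  simp

theorem houseSum_uSer {n m : ℕ} (hm : 0 < m) (hmn : m < n) (t : ℕ) :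
    houseSum t (uSer n m K) ≤ t + 1 := by
  unfold houseSum
  calc _ ≤ ∑ i ∈ Finset.range (t + 1), (1 : ℝ) := by
        refine Finset.sum_le_sum fun i _ => ?_
        obtain ⟨h0, h1⟩ := uCoef_mem n m hm hmn i
        rw [uSer, PowerSeries.coeff_mk]
        refine (house_ratCast _).trans ?_
        rw [abs_of_nonneg (by exact_mod_cast h0)]
        exact_mod_cast h1
    _ = _ := by simp

theorem house_root_of_unity {n : ℕ} (hn : 0 < n) {e : K} (he : e ^ n = 1) : house e ≤ 1 := by
  unfold house
  rw [pi_norm_le_iff_of_nonneg zero_le_one]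
  intro σ
  have h1 : (σ e) ^ n = 1 := by rw [← map_pow, he, map_one]
  have h2 : ‖σ e‖ = 1 := by
    have := congrArg norm h1
    rw [norm_pow, norm_one] at this
    exact (pow_eq_one_iff_of_nonneg (norm_nonneg _) hn.ne').1 this
  simpa using h2.le

theorem eq_zero_of_liouville (σ : K →+* ℂ) {γ : K} (hγ : IsIntegral ℤ γ) {S H : ℝ} (hS : ‖σ γ‖ ≤ S)
    (hH : house γ ≤ H) (hlt : S * H ^ (Module.finrank ℚ K - 1) < 1) : γ = 0 := by
  by_contra hne
  have h1 := norm_norm_le_norm_mul_house_pow γ σ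
  have h2 : 1 ≤ ‖Algebra.norm ℚ γ‖ := by
    have hi : IsIntegral ℤ (Algebra.norm ℚ γ) := Algebra.isIntegral_norm ℚ hγ
    obtain ⟨z, hz⟩ := IsIntegrallyClosed.isIntegral_iff.1 hi
    have hz0 : z ≠ 0 := by
      rintro rfl
      rw [map_zero] at hz
      exact hne (Algebra.norm_eq_zero_iff.1 hz.symm)
    rw [← hz]
    have : (1 : ℝ) ≤ |(z : ℝ)| := by exact_mod_cast Int.one_le_abs hz0
    rw [show ‖(algebraMap ℤ ℚ z)‖ = |(z : ℝ)| by simp [Int.norm_eq_abs]]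
    exact this
  have h3 : ‖σ γ‖ * house γ ^ (Module.finrank ℚ K - 1) ≤ S * H ^ (Module.finrank ℚ K - 1) :=
    mul_le_mul hS (pow_le_pow_left₀ (house_nonneg _) hH _) (pow_nonneg (house_nonneg _) _)
      ((norm_nonneg _).trans hS)
  linarith

end

end

section

open NumberField

section
variable {K : Type} [Field K]

/-- The linear form `d (e u + c l)`. -/
noncomputable def lin (n m d : ℕ) (c e l : K) : PowerSeries K :=
  PowerSeries.C (d * e) * uSer n m K + PowerSeries.C (d * c * l)

noncomputable def mon (n m d : ℕ) (c : K) (a b : ℕ) (e l : K) : PowerSeries K :=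
  PowerSeries.X ^ a * lin n m d c e l ^ (n * b)

noncomputable def auxSer (n m d : ℕ) (c : K) {A B : ℕ} (p : Fin A × Fin B → K) (e l : K) :
    PowerSeries K :=
  ∑ x, PowerSeries.C (p x) * mon n m d c x.1 x.2 e l

noncomputable def auxFun (n d : ℕ) (σ : K →+* ℂ) {A B : ℕ} (p : Fin A × Fin B → K) (X Y : ℂ) : ℂ :=
  ∑ x, σ (p x) * (X ^ (x.1 : ℕ) * (d * Y) ^ (n * x.2))

/-- Integral combination of powers of `ω`. -/
def cyc {n : ℕ} (ω : K) (k : Fin n → ℤ) : K := ∑ i, (k i : K) * ω ^ (i : ℕ)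

def cycSet (n : ℕ) (σ : K →+* ℂ) (ω : K) (N : ℕ) : Set ℂ :=
  {l | ∃ k : Fin n → ℤ, (∀ i, |k i| ≤ N) ∧ l = σ (cyc ω k)}

theorem cyc_add {n : ℕ} (ω : K) (k k' : Fin n → ℤ) : cyc ω (k + k') = cyc ω k + cyc ω k' := by
  simp [cyc, add_mul, Finset.sum_add_distrib]

theorem cyc_neg {n : ℕ} (ω : K) (k : Fin n → ℤ) : cyc ω (-k) = -cyc ω k := by
  simp [cyc]

theorem cyc_single {n : ℕ} (ω : K) (i : Fin n) : cyc ω (Pi.single i 1) = ω ^ (i : ℕ) := by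
  rw [cyc, Finset.sum_eq_single i]
  · simp
  · intro j _ hj; simp [Pi.single_eq_of_ne hj]
  · simp

theorem cyc_zero {n : ℕ} (ω : K) : cyc ω (0 : Fin n → ℤ) = 0 := by simp [cyc]

theorem abs_single_sub_le {n : ℕ} (a b i : Fin n) :
    |(Pi.single a 1 : Fin n → ℤ) i - (Pi.single b 1 : Fin n → ℤ) i| ≤ 1 := by
  simp only [Pi.single_apply]
  split_ifs <;> simp

theorem exists_pow_eq {n : ℕ} (hn : 0 < n) (σ : K →+* ℂ) {ω : K} (hω : IsPrimitiveRoot ω n) {ε : ℂ}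
    (hε : ε ^ n = 1) : ∃ a : Fin n, σ (ω ^ (a : ℕ)) = ε := by
  have : NeZero n := ⟨hn.ne'⟩
  obtain ⟨a, ha, h⟩ := (hω.map_of_injective σ.injective).eq_pow_of_pow_eq_one hε
  exact ⟨⟨a, ha⟩, by simpa using h⟩

theorem cycSet_add {n : ℕ} (hn : 0 < n) (σ : K →+* ℂ) {ω : K} (hω : IsPrimitiveRoot ω n) {N : ℕ} {l : ℂ}
    (hl : l ∈ cycSet n σ ω N) {ε ε' : ℂ} (hε : ε ^ n = 1) (hε' : ε' ^ n = 1) :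
    l + ε - ε' ∈ cycSet n σ ω (N + 1) := by
  obtain ⟨k, hk, rfl⟩ := hl
  obtain ⟨a, rfl⟩ := exists_pow_eq hn σ hω hε
  obtain ⟨b, rfl⟩ := exists_pow_eq hn σ hω hε'
  refine ⟨k + (Pi.single a 1 + -Pi.single b 1), fun i => ?_, ?_⟩
  · have h1 := hk i
    have h2 := abs_single_sub_le a b i
    have : (k + ((Pi.single a 1 : Fin n → ℤ) + -(Pi.single b 1 : Fin n → ℤ))) i =
      k i + ((Pi.single a 1 : Fin n → ℤ) i - (Pi.single b 1 : Fin n → ℤ) i) := by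
      simp [sub_eq_add_neg]
    rw [this]
    push_cast
    exact (abs_add_le _ _).trans (add_le_add h1 h2)
  · rw [cyc_add, cyc_add, cyc_neg, cyc_single, cyc_single]
    simp only [map_add, map_neg]
    ring

theorem cycSet_mono (n : ℕ) (σ : K →+* ℂ) (ω : K) {N N' : ℕ} (h : N ≤ N') :
    cycSet n σ ω N ⊆ cycSet n σ ω N' := by
  rintro l ⟨k, hk, rfl⟩
  exact ⟨k, fun i => (hk i).trans (by exact_mod_cast h), rfl⟩

theorem isIntegral_cyc {n : ℕ} (hn : 0 < n) {ω : K} (hω : ω ^ n = 1) (k : Fin n → ℤ) :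
    IsIntegral ℤ (cyc ω k) := by
  have : IsIntegral ℤ ω := IsIntegral.of_pow hn (by rw [hω]; exact isIntegral_one)
  exact IsIntegral.sum _ fun i _ => (isIntegral_intCast _).mul (this.pow _)

theorem isDen_lin [CharZero K] {n m d : ℕ} (hn : 0 < n) {c e l : K} (hc : IsIntegral ℤ (d * c))
    (he : IsIntegral ℤ e) (hl : IsIntegral ℤ l) : IsDen n (lin n m d c e l) :=
  ((IsDen.C ((isIntegral_natCast _).mul he)).mul (IsDen.uSer hn)).add (IsDen.C (hc.mul hl))

theorem isDen_mon [CharZero K] {n m d : ℕ} (hn : 0 < n) {c e l : K} (hc : IsIntegral ℤ (d * c))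
    (he : IsIntegral ℤ e) (hl : IsIntegral ℤ l) (a b : ℕ) : IsDen n (mon n m d c a b e l) :=
  (IsDen.X.pow _).mul ((isDen_lin hn hc he hl).pow _)

theorem isDen_auxSer [CharZero K] {n m d : ℕ} (hn : 0 < n) {c e l : K} (hc : IsIntegral ℤ (d * c))
    (he : IsIntegral ℤ e) (hl : IsIntegral ℤ l) {A B : ℕ} {p : Fin A × Fin B → K}
    (hp : ∀ x, IsIntegral ℤ (p x)) : IsDen n (auxSer n m d c p e l) :=
  IsDen.sum _ _ fun x _ => (IsDen.C (hp x)).mul (isDen_mon hn hc he hl _ _)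

theorem analyticAt_uBr {n m : ℕ} (hm : 0 < m) (hmn : m < n) : AnalyticAt ℂ (uBr n m) 0 :=
  (differentiableOn_uBr hm hmn).analyticAt (isOpen_xDom.mem_nhds (ball_subset_xDom (by simp)))

theorem map_uSer [CharZero K] (n m : ℕ) (σ : K →+* ℂ) :
    PowerSeries.map σ (uSer n m K) = uSer n m ℂ := by
  ext t; simp [uSer]

theorem map_auxSer [CharZero K] {n m d : ℕ} (hm : 0 < m) (hmn : m < n) (σ : K →+* ℂ) {c : K}
    (hc : σ c = uPer n m) {A B : ℕ} (p : Fin A × Fin B → K) (e l : K) :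
    PowerSeries.map σ (auxSer n m d c p e l) =
      taylorSer (fun X => auxFun n d σ p X (σ e * uBr n m X + uPer n m * σ l)) := by
  have hu := analyticAt_uBr hm hmn
  have h1 : taylorSer (fun X => (d : ℂ) * (σ e * uBr n m X + uPer n m * σ l)) =
      PowerSeries.map σ (lin n m d c e l) := by
    have : (fun X => (d : ℂ) * (σ e * uBr n m X + uPer n m * σ l)) =
        fun X => (d * σ e) * uBr n m X + d * uPer n m * σ l := by ext; ring
    rw [this, taylorSer_add (f := fun X => (d * σ e) * uBr n m X) (g := fun _ => _) (by fun_prop)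
      (by fun_prop), taylorSer_mul (f := fun _ => d * σ e) (by fun_prop) hu, taylorSer_const,
      taylorSer_const, taylorSer_uBr hm hmn]
    simp [lin, map_uSer, hc]
  unfold auxSer auxFun
  rw [taylorSer_sum, map_sum]
  · refine Finset.sum_congr rfl fun x _ => ?_
    rw [taylorSer_mul (f := fun _ => σ (p x))
      (g := fun X => X ^ (x.1 : ℕ) * (d * (σ e * uBr n m X + uPer n m * σ l)) ^ (n * x.2))
      (by fun_prop) (by fun_prop), taylorSer_mul (f := fun X => X ^ (x.1 : ℕ))
      (g := fun X => (d * (σ e * uBr n m X + uPer n m * σ l)) ^ (n * x.2)) (by fun_prop)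
      (by fun_prop), taylorSer_const, taylorSer_pow (f := fun X => X) (by fun_prop), taylorSer_id,
      taylorSer_pow (f := fun X => d * (σ e * uBr n m X + uPer n m * σ l)) (by fun_prop), h1]
    simp [mon]
  · intro x; fun_prop

variable [NumberField K]

theorem house_cyc_le {n : ℕ} (hn : 0 < n) {ω : K} (hω : ω ^ n = 1) {k : Fin n → ℤ} {N : ℕ}
    (hk : ∀ i, |k i| ≤ N) : house (cyc ω k) ≤ n * N := by
  refine (house_sum_le_sum_house _ _).trans ?_
  calc _ ≤ ∑ i : Fin n, (N : ℝ) := by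
        refine Finset.sum_le_sum fun i _ => (house_mul_le _ _).trans ?_
        have h1 : house ((k i : ℤ) : K) ≤ N := by
          rw [house_intCast]; exact_mod_cast hk i
        have h2 : house (ω ^ (i : ℕ)) ≤ 1 :=
          house_root_of_unity hn (by rw [← pow_mul, mul_comm, pow_mul, hω, one_pow])
        calc _ ≤ (N : ℝ) * 1 := mul_le_mul h1 h2 (house_nonneg _) (Nat.cast_nonneg _)
          _ = N := mul_one _
    _ = _ := by simp

theorem houseSum_lin_le {n m d : ℕ} (hm : 0 < m) (hmn : m < n) {c e l : K} {L : ℝ}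
    (he : e ^ n = 1) (hl : house l ≤ L) (t : ℕ) :
    houseSum t (lin n m d c e l) ≤ d * (t + 1) + d * house c * L := by
  have hd : house (d : K) = d := by simpa using house_intCast (K := K) (d : ℤ)
  have he' := house_root_of_unity (by omega) he
  refine (houseSum_add t _ _).trans (add_le_add ((houseSum_mul t _ _).trans ?_) ?_)
  · rw [houseSum_C]
    refine mul_le_mul ?_ (houseSum_uSer hm hmn t) (houseSum_nonneg _ _) (Nat.cast_nonneg _)
    refine (house_mul_le _ _).trans ?_
    rw [hd]
    exact mul_le_of_le_one_right (Nat.cast_nonneg _) he'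
  · rw [houseSum_C]
    refine (house_mul_le _ _).trans (mul_le_mul ?_ hl (house_nonneg _)
      (mul_nonneg (Nat.cast_nonneg _) (house_nonneg _)))
    exact (house_mul_le _ _).trans_eq (by rw [hd])

theorem house_coeff_mon_le {n m d : ℕ} (hm : 0 < m) (hmn : m < n) (hd : 0 < d) {c e l : K} {L : ℝ}
    (he : e ^ n = 1) (hl : house l ≤ L) (t a : ℕ) {b B : ℕ} (hb : b ≤ B) :
    house (PowerSeries.coeff t (mon n m d c a b e l)) ≤
      (d * (t + 1) + d * house c * L) ^ (n * B) := by
  have hd' : (1 : ℝ) ≤ d := by exact_mod_cast hd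
  have hL : 0 ≤ L := (house_nonneg _).trans hl
  have h1 : (1 : ℝ) ≤ d * (t + 1) + d * house c * L := by
    have : 0 ≤ d * house c * L := mul_nonneg (mul_nonneg (Nat.cast_nonneg _) (house_nonneg _)) hL
    nlinarith [(Nat.cast_nonneg t : (0 : ℝ) ≤ t)]
  calc _ ≤ houseSum t (mon n m d c a b e l) := house_coeff_le _ _
    _ ≤ 1 * (d * (t + 1) + d * house c * L) ^ (n * b) := by
      refine (houseSum_mul t _ _).trans (mul_le_mul (houseSum_X_pow _ _) ?_ (houseSum_nonneg _ _)
        zero_le_one)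
      exact (houseSum_pow _ _ _).trans
        (pow_le_pow_left₀ (houseSum_nonneg _ _) (houseSum_lin_le hm hmn he hl t) _)
    _ ≤ _ := by
      rw [one_mul]
      exact pow_le_pow_right₀ h1 (Nat.mul_le_mul_left n hb)

theorem house_coeff_auxSer_le {n m d : ℕ} (hm : 0 < m) (hmn : m < n) (hd : 0 < d) {c e l : K} {L : ℝ}
    (he : e ^ n = 1) (hl : house l ≤ L) {A B : ℕ} {p : Fin A × Fin B → K} {Q : ℝ}
    (hQ : ∀ x, house (p x) ≤ Q) (t : ℕ) :
    house (PowerSeries.coeff t (auxSer n m d c p e l)) ≤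
      A * B * Q * (d * (t + 1) + d * house c * L) ^ (n * B) := by
  unfold auxSer
  rw [map_sum]
  refine (house_sum_le_sum_house _ _).trans ?_
  calc _ ≤ ∑ x : Fin A × Fin B, Q * (d * (t + 1) + d * house c * L) ^ (n * B) := by
        refine Finset.sum_le_sum fun x _ => ?_
        rw [PowerSeries.coeff_C_mul]
        exact (house_mul_le _ _).trans (mul_le_mul (hQ x)
          (house_coeff_mon_le hm hmn hd he hl t _ x.2.2.le) (house_nonneg _)
          ((house_nonneg _).trans (hQ x)))
    _ = _ := by simp; ring

theorem norm_auxFun_le {n d : ℕ} (σ : K →+* ℂ) {A B : ℕ} {p : Fin A × Fin B → K} {Q R Y : ℝ}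
    (hQ : ∀ x, house (p x) ≤ Q) (hR : 1 ≤ R) (hY : 1 ≤ Y) {x y : ℂ} (hx : ‖x‖ ≤ R)
    (hy : d * ‖y‖ ≤ Y) : ‖auxFun n d σ p x y‖ ≤ A * B * Q * (R ^ A * Y ^ (n * B)) := by
  unfold auxFun
  refine (norm_sum_le _ _).trans ?_
  calc _ ≤ ∑ x : Fin A × Fin B, Q * (R ^ A * Y ^ (n * B)) := by
        refine Finset.sum_le_sum fun i _ => ?_
        rw [norm_mul, norm_mul, norm_pow, norm_pow, norm_mul, Complex.norm_natCast]
        have hQ0 := (house_nonneg _).trans (hQ i)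
        gcongr
        · exact (norm_embedding_le_house _ _).trans (hQ i)
        · exact (pow_le_pow_left₀ (norm_nonneg _) hx _).trans (pow_le_pow_right₀ hR i.1.2.le)
        · exact (pow_le_pow_left₀ (by positivity) hy _).trans
            (pow_le_pow_right₀ hY (Nat.mul_le_mul_left n i.2.2.le))
    _ = _ := by simp; ring

theorem stripBound_auxFun {n m d : ℕ} (hm : 0 < m) (hmn : m < n) (hd : 0 < d) (σ : K →+* ℂ) {ω : K}
    (hω : ω ^ n = 1) {A B N : ℕ} {p : Fin A × Fin B → K} {Q b : ℝ} (hb : 0 ≤ b)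
    (hQ : ∀ x, house (p x) ≤ Q) :
    StripBound n m (auxFun n d σ p) (cycSet n σ ω N) b fun _ =>
      A * B * Q * (Real.exp b ^ A *
        (d * (‖uPer n m‖ + n * (1 + Real.exp b) + ‖uPer n m‖ * (n * N))) ^ (n * B)) := by
  rintro l ⟨k, hk, rfl⟩ ε hε τ hτ z hz h8 hlog
  have hd' : (1 : ℝ) ≤ d := by exact_mod_cast hd
  have hn' : (1 : ℝ) ≤ n := by exact_mod_cast (by omega : 1 ≤ n)
  have hτ1 : ‖τ‖ = 1 := by rcases hτ with rfl | rfl <;> simp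
  have hε1 : ‖ε‖ = 1 := by
    have := congrArg norm hε
    rw [norm_pow, norm_one] at this
    exact (pow_eq_one_iff_of_nonneg (norm_nonneg _) (by omega)).1 this
  have hx : ‖1 - z ^ n‖ ≤ Real.exp b := by
    rw [← Real.log_le_iff_le_exp (by linarith)]; exact hlog
  have hl : ‖σ (cyc ω k)‖ ≤ n * N := (norm_embedding_le_house _ _).trans (house_cyc_le (by omega) hω hk)
  have hu := norm_uInt_le hm hmn hz
  have hbig : (1 : ℝ) ≤ ‖uPer n m‖ + n * (1 + Real.exp b) + ‖uPer n m‖ * (n * N) := by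
    have h1 : 0 ≤ ‖uPer n m‖ * (n * N) := by positivity
    nlinarith [norm_nonneg (uPer n m), Real.exp_pos b]
  refine norm_auxFun_le σ hQ (Real.one_le_exp hb) (one_le_mul_of_one_le_of_one_le hd' hbig) ?_ ?_
  · rw [norm_mul, hτ1, one_mul]; exact hx
  · gcongr
    refine (norm_add_le _ _).trans ?_
    rw [norm_mul, norm_mul, hε1, hτ1, norm_mul, one_mul, one_mul]
    have h2 : (n : ℝ) * (1 + ‖1 - z ^ n‖) ≤ n * (1 + Real.exp b) := by gcongr
    have h3 : ‖uPer n m‖ * ‖σ (cyc ω k)‖ ≤ ‖uPer n m‖ * (n * N) := by gcongr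
    linarith [norm_sub_le (uPer n m) (uInt n m z)]

/-- One step of the induction: order `T` on a large set of periods improves to order `T'` on a smaller one. -/
theorem order_step {n m d : ℕ} (hm : 0 < m) (hmn : m < n) (σ : K →+* ℂ) {ω c : K}
    (hω : IsPrimitiveRoot ω n) (hc : σ c = uPer n m) (hdc : IsIntegral ℤ (d * c))
    {A B N J T T' : ℕ} {p : Fin A × Fin B → K} (hp : ∀ x, IsIntegral ℤ (p x)) {κ E S H : ℝ}
    (hκ : 5 ≤ κ) (hE0 : 0 ≤ E) (hJ : (J : ℝ) = 32 * κ ^ 2)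
    (hE : StripBound n m (auxFun n d σ p) (cycSet n σ ω (N + J)) (κ + 1) fun _ => E)
    (hz : ∀ k : Fin n → ℤ, (∀ i, |k i| ≤ (N + J : ℕ)) → ∀ e : K, e ^ n = 1 → ∀ t < T,
      PowerSeries.coeff t (auxSer n m d c p e (cyc ω k)) = 0)
    (hS : ∀ t < T', (t.factorial : ℝ) * n ^ t * 8 ^ t * E ≤ S)
    (hH : ∀ t < T', ∀ k : Fin n → ℤ, (∀ i, |k i| ≤ N) → ∀ e : K, e ^ n = 1 →
      (t.factorial : ℝ) * n ^ t * house (PowerSeries.coeff t (auxSer n m d c p e (cyc ω k))) ≤ H)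
    (hlt : S * Real.exp (-(T * (κ / 6))) * H ^ (Module.finrank ℚ K - 1) < 1) :
    ∀ k : Fin n → ℤ, (∀ i, |k i| ≤ N) → ∀ e : K, e ^ n = 1 → ∀ t < T',
      PowerSeries.coeff t (auxSer n m d c p e (cyc ω k)) = 0 := by
  intro k hk e he t ht
  have hn : 0 < n := by omega
  have hP : Differentiable ℂ fun q : ℂ × ℂ => auxFun n d σ p q.1 q.2 := by
    unfold auxFun; fun_prop
  have hroot : ∀ e' : K, e' ^ n = 1 → (σ e') ^ n = 1 := fun e' h => by rw [← map_pow, h, map_one]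
  have hex : ∀ X : ℂ, ‖X‖ = 1 / 8 → ‖auxFun n d σ p X (σ e * uBr n m X + uPer n m * σ (cyc ω k))‖ ≤
      E * Real.exp (-(T * (κ / 6))) := by
    intro X hX
    refine extrapolation hm hmn hP (L := fun j => cycSet n σ ω (N + j)) ?_ hκ hE0 hJ ?_ ?_
      ⟨k, by simpa using hk, rfl⟩ (hroot e he) hX
    · intro j l hl ε ε' hε hε'
      refine ⟨cycSet_add hn σ hω hl hε hε', ?_⟩
      have := cycSet_add hn σ hω hl hε' hε
      rwa [show l - ε + ε' = l + ε' - ε by ring]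
    · intro j hj l hl
      exact hE l (cycSet_mono n σ ω (by omega) hl)
    · rintro j hj l hl ε hε t ht
      obtain ⟨k', hk', rfl⟩ := cycSet_mono n σ ω (show N + j ≤ N + J by omega) hl
      obtain ⟨a, rfl⟩ := exists_pow_eq hn σ hω hε
      have h0 := hz k' hk' (ω ^ (a : ℕ)) (by rw [← pow_mul, mul_comm, pow_mul, hω.pow_eq_one, one_pow]) t ht
      have h1 := congrArg σ h0
      rw [← PowerSeries.coeff_map, map_auxSer hm hmn σ hc, coeff_taylorSer, map_zero, div_eq_zero_iff] at h1
      exact h1.resolve_right (Nat.cast_ne_zero.2 t.factorial_ne_zero)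
  have hdiff : DifferentiableOn ℂ (fun X => auxFun n d σ p X (σ e * uBr n m X + uPer n m * σ (cyc ω k)))
      (Metric.closedBall 0 (1 / 8)) := by
    have hu : DifferentiableOn ℂ (uBr n m) (Metric.closedBall 0 (1 / 8)) :=
      (differentiableOn_uBr hm hmn).mono ((Metric.closedBall_subset_ball (by norm_num)).trans
        ball_subset_xDom)
    unfold auxFun
    fun_prop
  have hb := norm_coeff_taylorSer_le (by norm_num) hdiff hex t
  rw [← map_auxSer hm hmn σ hc, PowerSeries.coeff_map] at hb
  have hn0 : (0 : ℝ) ≤ t.factorial * n ^ t := by positivity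
  have hnat : ∀ x : ℕ, house (x : K) = x := fun x => by simpa using house_intCast (K := K) (x : ℤ)
  have hei : IsIntegral ℤ e := IsIntegral.of_pow hn (by rw [he]; exact isIntegral_one)
  have hγ := isDen_auxSer (m := m) hn hdc hei (isIntegral_cyc hn hω.pow_eq_one k) hp t
  have h0 := eq_zero_of_liouville σ hγ (S := S * Real.exp (-(T * (κ / 6)))) (H := H) ?_ ?_ hlt
  · refine (mul_eq_zero.1 h0).resolve_left (mul_ne_zero ?_ (pow_ne_zero _ ?_))
    · exact Nat.cast_ne_zero.2 t.factorial_ne_zero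
    · exact Nat.cast_ne_zero.2 hn.ne'
  · rw [map_mul, map_mul, map_pow, map_natCast, map_natCast, norm_mul, norm_mul, norm_pow,
      Complex.norm_natCast, Complex.norm_natCast]
    calc _ ≤ (t.factorial : ℝ) * n ^ t * (E * Real.exp (-(T * (κ / 6))) / (1 / 8) ^ t) := by gcongr
      _ = (t.factorial : ℝ) * n ^ t * 8 ^ t * E * Real.exp (-(T * (κ / 6))) := by
        rw [one_div, inv_pow]; field_simp
      _ ≤ _ := by gcongr; exact hS t ht
  · refine le_trans ?_ (hH t ht k hk e he)
    refine (house_mul_le _ _).trans (mul_le_mul_of_nonneg_right ?_ (house_nonneg _))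
    refine (house_mul_le _ _).trans ?_
    rw [hnat]
    exact mul_le_mul_of_nonneg_left ((house_pow_le _ _).trans_eq (by rw [hnat])) (Nat.cast_nonneg _)

end

end

section

open NumberField

section
variable {K : Type} [Field K] [NumberField K]

/-- Siegel's lemma applied to the vanishing conditions. -/
theorem exists_auxSer (K : Type) [Field K] [NumberField K] : ∃ c₁ : ℝ, ∀ {n m d : ℕ} (_ : 0 < m)
    (_ : m < n) (_ : 0 < d) {ω c : K} (_ : IsPrimitiveRoot ω n) (_ : IsIntegral ℤ (d * c))
    {A B N T : ℕ} (_ : 0 < T) (_ : 0 < A) (_ : 0 < B)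
    (_ : A * B = 2 * (T * (n * (2 * N + 1) ^ n))),
    ∃ p : Fin A × Fin B → K, (∃ x, p x ≠ 0) ∧ (∀ x, IsIntegral ℤ (p x)) ∧
      (∀ x, house (p x) ≤ c₁ * (A * B : ℕ) *
        (T.factorial * n ^ T * (d * (T + 1) + d * house c * (n * N)) ^ (n * B))) ∧
      ∀ k : Fin n → ℤ, (∀ i, |k i| ≤ N) → ∀ e : K, e ^ n = 1 → ∀ t < T,
        PowerSeries.coeff t (auxSer n m d c p e (cyc ω k)) = 0 := by
  obtain ⟨c₁, hc₁⟩ := exists_siegel_const' K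
  refine ⟨c₁, fun {n m d} hm hmn hd {ω c} hω hdc {A B N T} hT hA hB hAB => ?_⟩
  have hn : 0 < n := by omega
  have hpow : ∀ a : ℕ, (ω ^ a) ^ n = 1 := fun a => by
    rw [← pow_mul, mul_comm, pow_mul, hω.pow_eq_one, one_pow]
  let kk : (Fin n → Fin (2 * N + 1)) → Fin n → ℤ := fun f i => (f i : ℕ) - (N : ℤ)
  have hkk : ∀ f i, |kk f i| ≤ N := fun f i => by
    have := (f i).2
    simp only [kk, abs_le]; omega
  let ent : (Fin T × Fin n × (Fin n → Fin (2 * N + 1))) → (Fin A × Fin B) → K := fun r x =>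
    ((r.1 : ℕ).factorial : K) * (n : K) ^ (r.1 : ℕ) *
      PowerSeries.coeff r.1 (mon n m d c x.1 x.2 (ω ^ (r.2.1 : ℕ)) (cyc ω (kk r.2.2)))
  have hωi : IsIntegral ℤ ω := IsIntegral.of_pow hn (by rw [hω.pow_eq_one]; exact isIntegral_one)
  have hent : ∀ r x, IsIntegral ℤ (ent r x) := fun r x =>
    isDen_mon hn hdc (hωi.pow _) (isIntegral_cyc hn hω.pow_eq_one _) _ _ _
  let a : Matrix (Fin T × Fin n × (Fin n → Fin (2 * N + 1))) (Fin A × Fin B) (𝓞 K) :=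
    fun r x => ⟨ent r x, hent r x⟩
  have ha : ∀ r x, algebraMap (𝓞 K) K (a r x) = ent r x := fun r x => rfl
  have ha0 : a ≠ 0 := by
    intro h
    have h1 := ha (⟨0, hT⟩, ⟨0, hn⟩, fun _ => 0) (⟨0, hA⟩, ⟨0, hB⟩)
    rw [h] at h1
    simp [ent, mon] at h1
  have hnat : ∀ x : ℕ, house (x : K) = x := fun x => by simpa using house_intCast (K := K) (x : ℤ)
  have hP : 0 < T * (n * (2 * N + 1) ^ n) := by positivity
  have hhc := house_nonneg c
  obtain ⟨ξ, h1, h2, h3⟩ := hc₁ _ _ a (T * (n * (2 * N + 1) ^ n))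
    (T.factorial * n ^ T * (d * (T + 1) + d * house c * (n * N)) ^ (n * B)) ha0 hP (by simp)
    (by simp [hAB]) (by
      intro r x
      rw [ha]
      have ht := r.1.2
      have hn1 : (1 : ℝ) ≤ n := by exact_mod_cast hn
      refine (house_mul_le _ _).trans ?_
      refine mul_le_mul ?_ ?_ (house_nonneg _) (by positivity)
      · refine (house_mul_le _ _).trans ?_
        rw [hnat]
        refine mul_le_mul ?_ ?_ (house_nonneg _) (by positivity)
        · exact_mod_cast Nat.factorial_le ht.le
        · refine (house_pow_le _ _).trans ?_
          rw [hnat]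
          exact pow_le_pow_right₀ hn1 ht.le
      · refine (house_coeff_mon_le hm hmn hd (hpow _)
          (house_cyc_le hn hω.pow_eq_one (hkk _)) _ _ x.2.2.le).trans ?_
        gcongr)
  refine ⟨fun x => algebraMap (𝓞 K) K (ξ x), ?_, fun x => RingOfIntegers.isIntegral_coe _, ?_, ?_⟩
  · obtain ⟨x, hx⟩ := Function.ne_iff.1 h1
    exact ⟨x, fun h => hx ((map_eq_zero_iff _ RingOfIntegers.coe_injective).1 h)⟩
  · intro x
    refine (h3 x).trans_eq ?_
    rw [hAB]; push_cast; ring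
  · intro k hk e he t ht
    have : NeZero n := ⟨hn.ne'⟩
    obtain ⟨b, hb, rfl⟩ := hω.eq_pow_of_pow_eq_one he
    let f : Fin n → Fin (2 * N + 1) := fun i => ⟨(k i + N).toNat, by
      have := abs_le.1 (hk i); omega⟩
    have hf : kk f = k := by
      ext i
      have := abs_le.1 (hk i)
      simp only [kk, f]; omega
    have h4 := congrArg (algebraMap (𝓞 K) K) (congrFun h2 (⟨t, ht⟩, ⟨b, hb⟩, f))
    simp only [Matrix.mulVec, dotProduct, map_sum, map_mul, ha, Pi.zero_apply, map_zero] at h4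
    have h5 : ((t.factorial : K) * (n : K) ^ t) *
        PowerSeries.coeff t (auxSer n m d c (fun x => algebraMap (𝓞 K) K (ξ x)) (ω ^ b) (cyc ω k)) = 0 := by
      rw [← h4, auxSer, map_sum, Finset.mul_sum]
      refine Finset.sum_congr rfl fun x _ => ?_
      rw [PowerSeries.coeff_C_mul]
      simp only [ent, hf]
      ring
    exact (mul_eq_zero.1 h5).resolve_left (mul_ne_zero (Nat.cast_ne_zero.2 t.factorial_ne_zero)
      (pow_ne_zero _ (Nat.cast_ne_zero.2 hn.ne')))

open Polynomial in
theorem order_auxSer_le {n m d : ℕ} (hm : 0 < m) (hmn : m < n) (hd : 0 < d) (σ : K →+* ℂ) {c : K}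
    {A B T : ℕ} {p : Fin A × Fin B → K} (hp : ∃ x, p x ≠ 0)
    (hT : ∀ t < T, PowerSeries.coeff t (auxSer n m d c p 1 0) = 0) :
    T ≤ n * B + (n * B + 1) * (A + 2 * (n * B) + 2 * (n * B)) := by
  obtain ⟨x, hx⟩ := hp
  let q : ℕ → ℂ[X] := fun b => if hb : b < B then ∑ a : Fin A, Polynomial.C (σ (p (a, ⟨b, hb⟩))) * X ^ (a : ℕ) else 0
  have hd0 : (d : ℂ) ≠ 0 := Nat.cast_ne_zero.2 hd.ne'
  refine curve_zero_estimate hm hmn hd0 q (A := A) (B := B) ?_ ?_ ?_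
  · intro b
    by_cases hb : b < B
    · simp only [q, dif_pos hb]
      refine natDegree_sum_le_of_forall_le _ _ fun a _ => ?_
      exact (natDegree_C_mul_X_pow_le _ _).trans a.2.le
    · simp [q, hb]
  · refine ⟨x.2, x.2.2, fun h => hx ?_⟩
    have h1 := congrArg (fun r : ℂ[X] => r.coeff x.1) h
    simp only [q, dif_pos x.2.2, finsetSum_coeff, coeff_C_mul_X_pow, coeff_zero] at h1
    rw [Finset.sum_eq_single x.1] at h1
    · simpa using h1
    · intro b _ hb
      rw [if_neg]
      exact fun h => hb (Fin.ext h.symm)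
    · simp
  · have h1 : PowerSeries.X ^ T ∣ PowerSeries.map σ (auxSer n m d c p 1 0) := by
      rw [PowerSeries.X_pow_dvd_iff]
      intro t ht
      rw [PowerSeries.coeff_map, hT t ht, map_zero]
    convert h1 using 1
    rw [Finset.sum_range, auxSer, map_sum, Fintype.sum_prod_type_right]
    refine Finset.sum_congr rfl fun b _ => ?_
    simp only [q, dif_pos b.2]
    have : ((∑ a : Fin A, Polynomial.C (σ (p (a, ⟨(b : ℕ), b.2⟩))) * X ^ (a : ℕ) : ℂ[X]) : PowerSeries ℂ) =
        ∑ a : Fin A, PowerSeries.C (σ (p (a, b))) * PowerSeries.X ^ (a : ℕ) := by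
      rw [← Polynomial.coeToPowerSeries.ringHom_apply, map_sum]
      simp
    rw [this, Finset.sum_mul]
    refine Finset.sum_congr rfl fun a _ => ?_
    simp [mon, lin, map_uSer]
    ring
end

theorem factorial_mul_le {β n M t T : ℕ} (h8 : 8 ≤ β) (hn : n ≤ β) (htM : t ≤ β ^ M) (htT : t ≤ T) :
    (t.factorial : ℝ) * n ^ t * 8 ^ t ≤ (β : ℝ) ^ ((M + 2) * T) := by
  have h : t.factorial * n ^ t * 8 ^ t ≤ β ^ ((M + 2) * T) :=
    calc t.factorial * n ^ t * 8 ^ t ≤ (β ^ M) ^ t * β ^ t * β ^ t := by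
          gcongr
          exact (Nat.factorial_le_pow t).trans (Nat.pow_le_pow_left htM t)
      _ = β ^ ((M + 2) * t) := by ring
      _ ≤ _ := Nat.pow_le_pow_right (by omega) (Nat.mul_le_mul_left _ htT)
  exact_mod_cast h

theorem base_pow_le {β n d M t N B T : ℕ} {h : ℝ} (h3 : 3 ≤ β) (hn : n ≤ β) (hd : d ≤ β) (h0 : 0 ≤ h)
    (hh : h ≤ β) (hN : N ≤ β ^ 6) (hM : 9 ≤ M) (ht : t ≤ β ^ M) (hBT : n * B ≤ T) :
    ((d : ℝ) * (t + 1) + d * h * (n * N)) ^ (n * B) ≤ (β : ℝ) ^ ((M + 2) * T) := by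
  have hn' : (n : ℝ) ≤ β := by exact_mod_cast hn
  have hd' : (d : ℝ) ≤ β := by exact_mod_cast hd
  have hN' : (N : ℝ) ≤ β ^ 6 := by exact_mod_cast hN
  have ht' : (t : ℝ) ≤ β ^ M := by exact_mod_cast ht
  have h3' : (3 : ℝ) ≤ β := by exact_mod_cast h3
  have h1 : (1 : ℝ) ≤ β := by linarith
  have hb : (d : ℝ) * (t + 1) + d * h * (n * N) ≤ β ^ (M + 2) :=
    calc _ ≤ (β : ℝ) * (β ^ M + β ^ M) + β * β * (β * β ^ 6) := by
          gcongr
          exact one_le_pow₀ h1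
      _ = 2 * β ^ (M + 1) + β ^ 9 := by ring
      _ ≤ 2 * β ^ (M + 1) + β ^ (M + 1) := by
          gcongr
          omega
      _ = 3 * β ^ (M + 1) := by ring
      _ ≤ β * β ^ (M + 1) := by gcongr
      _ = _ := by ring
  calc _ ≤ ((β : ℝ) ^ (M + 2)) ^ (n * B) := pow_le_pow_left₀ (by positivity) hb _
    _ = (β : ℝ) ^ ((M + 2) * (n * B)) := by rw [← pow_mul]
    _ ≤ _ := pow_le_pow_right₀ h1 (Nat.mul_le_mul_left _ hBT)

theorem growth_pow_le {β n d N B : ℕ} {u : ℝ} (h9 : 9 ≤ β) (hn : n ≤ β) (hd : d ≤ β) (h0 : 0 ≤ u)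
    (hu : u ≤ β) (hN : N ≤ β ^ 6) :
    Real.exp ((β : ℝ) ^ 2 + 1) ^ B *
      (d * (u + n * (1 + Real.exp ((β : ℝ) ^ 2 + 1)) + u * (n * N))) ^ (n * B) ≤
      (β : ℝ) ^ (11 * (β ^ 4 * B)) := by
  have hn' : (n : ℝ) ≤ β := by exact_mod_cast hn
  have hd' : (d : ℝ) ≤ β := by exact_mod_cast hd
  have hN' : (N : ℝ) ≤ β ^ 6 := by exact_mod_cast hN
  have h9' : (9 : ℝ) ≤ β := by exact_mod_cast h9
  have h1 : (1 : ℝ) ≤ β := by linarith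
  set x := Real.exp ((β : ℝ) ^ 2 + 1) with hx
  have hx1 : 1 ≤ x := Real.one_le_exp (by positivity)
  have hin : d * (u + n * (1 + x) + u * (n * N)) ≤ β ^ 10 * x :=
    calc _ ≤ (β : ℝ) * (β * x + β * (x + x) + β * (β * β ^ 6) * x) := by
          have i1 : u ≤ β * x := hu.trans (le_mul_of_one_le_right (by positivity) hx1)
          have i2 : u * (n * N) ≤ β * (β * β ^ 6) * x :=
            le_trans (by gcongr) (le_mul_of_one_le_right (by positivity) hx1)
          gcongr
      _ = (3 * β ^ 2 + β ^ 9) * x := by ring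
      _ ≤ (3 * β ^ 9 + β ^ 9) * x := by
          gcongr
          norm_num
      _ = 4 * β ^ 9 * x := by ring
      _ ≤ β * β ^ 9 * x := by gcongr; linarith
      _ = _ := by ring
  have hxB : x ^ (B + n * B) ≤ (β : ℝ) ^ (β ^ 4 * B) := by
    have he : Real.exp 1 ≤ β := by
      have := Real.exp_one_lt_d9
      linarith
    have hle : (β ^ 2 + 1) * (B + n * B) ≤ β ^ 4 * B := by
      have h2 : (β ^ 2 + 1) * (1 + n) ≤ β ^ 4 := by
        calc (β ^ 2 + 1) * (1 + n) ≤ (β ^ 2 + β ^ 2) * (β + β) := by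
              gcongr
              · exact Nat.one_le_pow _ _ (by omega)
              · omega
          _ = 4 * β ^ 3 := by ring
          _ ≤ β * β ^ 3 := by gcongr; omega
          _ = _ := by ring
      calc _ = (β ^ 2 + 1) * (1 + n) * B := by ring
        _ ≤ _ := Nat.mul_le_mul_right _ h2
    calc x ^ (B + n * B) = Real.exp 1 ^ ((β ^ 2 + 1) * (B + n * B)) := by
          rw [pow_mul, ← Real.exp_nat_mul 1 (β ^ 2 + 1), hx]
          push_cast; rw [mul_one]
      _ ≤ (β : ℝ) ^ ((β ^ 2 + 1) * (B + n * B)) := pow_le_pow_left₀ (Real.exp_pos 1).le he _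
      _ ≤ _ := pow_le_pow_right₀ h1 hle
  have hnB : n * B ≤ β ^ 4 * B := by
    refine Nat.mul_le_mul_right _ (hn.trans ?_)
    exact Nat.le_self_pow (by norm_num) β
  calc _ ≤ x ^ B * (β ^ 10 * x) ^ (n * B) := by
        gcongr
    _ = (β : ℝ) ^ (10 * (n * B)) * x ^ (B + n * B) := by
        rw [mul_pow, ← pow_mul, pow_add]; ring
    _ ≤ (β : ℝ) ^ (10 * (β ^ 4 * B)) * (β : ℝ) ^ (β ^ 4 * B) := by
        gcongr
    _ = _ := by rw [← pow_add]; congr 1; ring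

theorem decay_lt_one {β C₁ C₂ h T : ℕ} (hβ : 0 < β) (hT : 0 < T)
    (hlog : ((C₁ + C₂ * h : ℕ) : ℝ) * Real.log β < β / 6) :
    (β : ℝ) ^ (C₁ * (β * T)) * Real.exp (-(T * ((β : ℝ) ^ 2 / 6))) * ((β : ℝ) ^ (C₂ * (β * T))) ^ h < 1 := by
  have hβ' : (0 : ℝ) < β := by exact_mod_cast hβ
  have hT' : (0 : ℝ) < T := by exact_mod_cast hT
  have e1 : (β : ℝ) ^ (C₁ * (β * T)) * ((β : ℝ) ^ (C₂ * (β * T))) ^ h =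
      Real.exp (β * T * (((C₁ + C₂ * h : ℕ) : ℝ) * Real.log β)) := by
    rw [← pow_mul, ← pow_add, ← Real.rpow_natCast, Real.rpow_def_of_pos hβ']
    congr 1
    push_cast; ring
  have e2 : (β : ℝ) ^ (C₁ * (β * T)) * Real.exp (-(T * ((β : ℝ) ^ 2 / 6))) * ((β : ℝ) ^ (C₂ * (β * T))) ^ h =
      Real.exp (β * T * (((C₁ + C₂ * h : ℕ) : ℝ) * Real.log β) - T * ((β : ℝ) ^ 2 / 6)) := by
    rw [sub_eq_add_neg, Real.exp_add, ← e1]; ring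
  rw [e2, Real.exp_lt_one_iff]
  have := mul_lt_mul_of_pos_left hlog (mul_pos hβ' hT')
  nlinarith

end

section

open NumberField

theorem uPer_not_in_numberField {K : Type} [Field K] [NumberField K] {n m d : ℕ} (hm : 0 < m)
    (hmn : m < n) (hd : 0 < d) (σ : K →+* ℂ) {ω c : K} (hω : IsPrimitiveRoot ω n)
    (hc : σ c = uPer n m) (hdc : IsIntegral ℤ (d * c)) : False := by
  obtain ⟨c₁, hc₁⟩ := exists_auxSer K
  obtain ⟨M, hM⟩ : ∃ M, M = 14 * n + 20 := ⟨_, rfl⟩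
  obtain ⟨h, hh⟩ : ∃ h, h = Module.finrank ℚ K - 1 := ⟨_, rfl⟩
  obtain ⟨I, hI⟩ : ∃ I, I = 7 * n + 10 := ⟨_, rfl⟩
  have hev : ∀ᶠ β : ℕ in Filter.atTop,
      (((5 * M + 18) + (6 * M + 9) * h : ℕ) : ℝ) * Real.log β < β / 6 := by
    set C : ℕ := (5 * M + 18) + (6 * M + 9) * h with hC
    have h1 : Real.log =o[Filter.atTop] (id : ℝ → ℝ) := Real.isLittleO_log_id_atTop
    have h2 := (h1.bound (show (0 : ℝ) < 1 / (12 * (C + 1)) by positivity))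
    have h3 := tendsto_natCast_atTop_atTop (R := ℝ) |>.eventually h2
    filter_upwards [h3, Filter.eventually_ge_atTop 1] with β hβ h1β
    have hβ' : (1 : ℝ) ≤ β := by exact_mod_cast h1β
    rw [Real.norm_eq_abs, abs_of_nonneg (Real.log_nonneg hβ'), id, Real.norm_eq_abs,
      abs_of_nonneg (by linarith)] at hβ
    have hCp : (0 : ℝ) ≤ C := Nat.cast_nonneg _
    calc (C : ℝ) * Real.log β ≤ C * (1 / (12 * (C + 1)) * β) := by gcongr
      _ ≤ (C + 1) * (1 / (12 * (C + 1)) * β) := by gcongr; linarith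
      _ = β / 12 := by field_simp
      _ < β / 6 := by linarith
  obtain ⟨β, hlog, hβ⟩ := (hev.and (Filter.eventually_ge_atTop
    (32 + I + d + ⌈house c⌉₊ + ⌈‖uPer n m‖⌉₊ + ⌈c₁⌉₊))).exists
  have hhc : house c ≤ β := (Nat.le_ceil _).trans (by exact_mod_cast (by omega))
  have hu : ‖uPer n m‖ ≤ β := (Nat.le_ceil _).trans (by exact_mod_cast (by omega))
  have hcc : c₁ ≤ β := (Nat.le_ceil _).trans (by exact_mod_cast (by omega))
  have h32 : 32 ≤ β := by omega
  have hIβ : I ≤ β := by omega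
  have hdβ : d ≤ β := by omega
  have hnβ : n ≤ β := by omega
  have hβ1 : (1 : ℝ) ≤ β := by exact_mod_cast (by omega : 1 ≤ β)
  clear hev hβ
  have hp1 : ∀ k, 1 ≤ β ^ k := fun k => Nat.one_le_pow _ _ (by omega)
  obtain ⟨J, hJ⟩ : ∃ J, J = 32 * β ^ 4 := ⟨_, rfl⟩
  obtain ⟨N, hN⟩ : ∃ N, N = I * J := ⟨_, rfl⟩
  obtain ⟨B, hB⟩ : ∃ B, B = 2 * n * β ^ 4 * (2 * N + 1) ^ n := ⟨_, rfl⟩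
  obtain ⟨T₀, hT₀⟩ : ∃ T₀, T₀ = β ^ 4 * B := ⟨_, rfl⟩
  have hN6 : N ≤ β ^ 6 := by
    calc N ≤ β * (β * β ^ 4) := by rw [hN, hJ]; gcongr
      _ = _ := by ring
  have hBle : B ≤ β ^ (7 * n + 6) := by
    calc B ≤ β * β * β ^ 4 * (β ^ 7) ^ n := by
          rw [hB]
          gcongr
          · omega
          · calc 2 * N + 1 ≤ 2 * β ^ 6 + β ^ 6 := by have := hp1 6; omega
              _ = 3 * β ^ 6 := by ring
              _ ≤ β * β ^ 6 := by gcongr; omega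
              _ = _ := by ring
      _ = _ := by ring
  have hB1 : 0 < B := by rw [hB]; have := hp1 4; have : 0 < n := by omega
                         positivity
  have hT1 : 0 < T₀ := by rw [hT₀]; exact Nat.mul_pos (hp1 4) hB1
  have hT₀le : T₀ ≤ β ^ (7 * n + 10) := by
    calc T₀ ≤ β ^ 4 * β ^ (7 * n + 6) := by rw [hT₀]; gcongr
      _ = _ := by ring
  have hTi : ∀ i ≤ I, β ^ i * T₀ ≤ β ^ M := fun i hi => by
    calc _ ≤ β ^ I * β ^ (7 * n + 10) := by gcongr; omega
      _ = _ := by rw [← pow_add, hM, hI]; congr 1; ring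
  have hT₀M : T₀ ≤ β ^ M := by simpa using hTi 0 (Nat.zero_le _)
  have hnB : n * B ≤ T₀ := by
    rw [hT₀]; exact Nat.mul_le_mul_right _ (hnβ.trans (Nat.le_self_pow (by norm_num) β))
  have hBB : B * B ≤ β ^ (M * T₀) := by
    calc B * B ≤ β ^ (7 * n + 6) * β ^ (7 * n + 6) := by gcongr
      _ = β ^ (14 * n + 12) := by rw [← pow_add]; congr 1; ring
      _ ≤ β ^ (M * T₀) := by
        refine Nat.pow_le_pow_right (by omega) ?_
        have : M * 1 ≤ M * T₀ := Nat.mul_le_mul_left _ hT1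
        omega
  have hBBr : (B : ℝ) * B ≤ (β : ℝ) ^ (M * T₀) := by exact_mod_cast hBB
  obtain ⟨p, hp0, hpi, hph, hpz⟩ := hc₁ (n := n) (m := m) (d := d) hm hmn hd hω hdc (A := B) (B := B)
    (N := N) hT1 hB1 hB1 (by
      calc B * B = 2 * n * β ^ 4 * (2 * N + 1) ^ n * B := by rw [← hB]
        _ = _ := by rw [hT₀]; ring)
  have hmono : ∀ {a b : ℕ}, a ≤ b → (β : ℝ) ^ a ≤ (β : ℝ) ^ b := fun h => pow_le_pow_right₀ hβ1 h
  have hbase : ∀ t ≤ β ^ M, ∀ N' ≤ N, ((d : ℝ) * (t + 1) + d * house c * (n * N')) ^ (n * B) ≤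
      (β : ℝ) ^ ((M + 2) * T₀) := fun t ht N' hN' =>
    base_pow_le (by omega) hnβ hdβ (house_nonneg _) hhc (hN'.trans hN6) (by omega) ht hnB
  have hfac : ∀ t T, t ≤ β ^ M → t ≤ T → (t.factorial : ℝ) * n ^ t ≤ (β : ℝ) ^ ((M + 2) * T) :=
    fun t T h1 h2 => le_trans (le_mul_of_one_le_right (by positivity) (one_le_pow₀ (by norm_num)))
      (factorial_mul_le (by omega) hnβ h1 h2)
  have hQ : ∀ x, house (p x) ≤ (β : ℝ) ^ ((3 * M + 5) * T₀) := by
    intro x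
    have hbn : 0 ≤ (d : ℝ) * (T₀ + 1) + d * house c * (n * N) := by
      have := house_nonneg c
      positivity
    calc house (p x) ≤ β * (B * B : ℕ) * ((T₀.factorial * n ^ T₀) *
          (d * (T₀ + 1) + d * house c * (n * N)) ^ (n * B)) := by
          refine (hph x).trans ?_
          gcongr
      _ ≤ β ^ T₀ * β ^ (M * T₀) * (β ^ ((M + 2) * T₀) * β ^ ((M + 2) * T₀)) := by
          push_cast
          gcongr
          · exact le_self_pow₀ hβ1 hT1.ne'
          · exact hfac _ _ hT₀M le_rfl
          · exact hbase _ hT₀M _ le_rfl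
      _ = _ := by rw [← pow_add, ← pow_add, ← pow_add]; congr 1; ring
  have hQ0 : (0 : ℝ) ≤ (β : ℝ) ^ ((3 * M + 5) * T₀) := by positivity
  have hmain : ∀ i ≤ I, ∀ k : Fin n → ℤ, (∀ j, |k j| ≤ ((I - i) * J : ℕ)) → ∀ e : K, e ^ n = 1 →
      ∀ t < β ^ i * T₀, PowerSeries.coeff t (auxSer n m d c p e (cyc ω k)) = 0 := by
    intro i
    induction i with
    | zero =>
      intro _ k hk e he t ht
      rw [Nat.sub_zero, ← hN] at hk
      exact hpz k hk e he t (by simpa using ht)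
    | succ i ih =>
      intro hi
      have ih := ih (by omega)
      have hNJ : (I - (i + 1)) * J + J = (I - i) * J := by
        rw [← Nat.succ_mul]; congr 1; omega
      have hN1 : (I - i) * J ≤ N := by rw [hN]; exact Nat.mul_le_mul_right _ (by omega)
      have hN2 : (I - (i + 1)) * J ≤ N := by omega
      have hTT : β ^ (i + 1) * T₀ = β * (β ^ i * T₀) := by ring
      have hT'M := hTi (i + 1) hi
      have hT0T' : T₀ ≤ β ^ (i + 1) * T₀ := Nat.le_mul_of_pos_left _ (hp1 _)
      set T' := β ^ (i + 1) * T₀ with hT'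
      have hbnd := stripBound_auxFun (N := (I - i) * J) hm hmn hd σ hω.pow_eq_one
        (b := (β : ℝ) ^ 2 + 1) (by positivity) hQ
      have hElt := growth_pow_le (B := B) (by omega) hnβ hdβ (norm_nonneg (uPer n m)) hu
        (hN1.trans hN6)
      rw [← hT₀] at hElt
      refine order_step (J := J) (T := β ^ i * T₀) hm hmn σ hω hc hdc hpi (κ := (β : ℝ) ^ 2)
        (E := (β : ℝ) ^ ((4 * M + 16) * T₀)) (S := (β : ℝ) ^ ((5 * M + 18) * T'))
        (H := (β : ℝ) ^ ((6 * M + 9) * T')) ?_ (by positivity) ?_ ?_ ?_ ?_ ?_ ?_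
      · have : (32 : ℝ) ≤ β := by exact_mod_cast h32
        nlinarith
      · rw [hJ]; push_cast; ring
      · rw [hNJ]
        intro l hl ε hε τ hτ z hz h8 hb
        have hb' := hbnd l hl ε hε τ hτ z hz h8 hb
        dsimp only at hb'
        refine hb'.trans ?_
        calc _ ≤ (β : ℝ) ^ (M * T₀) * (β : ℝ) ^ ((3 * M + 5) * T₀) * β ^ (11 * T₀) :=
              mul_le_mul (mul_le_mul_of_nonneg_right hBBr hQ0) hElt (by positivity) (by positivity)
          _ = _ := by rw [← pow_add, ← pow_add]; congr 1; ring
      · rw [hNJ]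
        exact ih
      · intro t ht
        calc _ ≤ (β : ℝ) ^ ((M + 2) * T') * β ^ ((4 * M + 16) * T₀) := by
              gcongr
              exact factorial_mul_le (by omega) hnβ (ht.le.trans hT'M) ht.le
          _ ≤ (β : ℝ) ^ ((M + 2) * T') * β ^ ((4 * M + 16) * T') := by
              gcongr
          _ = _ := by rw [← pow_add]; congr 1; ring
      · intro t ht k hk e he
        have h1 := house_coeff_auxSer_le (L := n * ((I - (i + 1)) * J : ℕ)) hm hmn hd he
          (house_cyc_le (by omega) hω.pow_eq_one hk) (c := c) hQ t
        have h2 := hbase t (ht.le.trans hT'M) _ hN2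
        calc _ ≤ (β : ℝ) ^ ((M + 2) * T') *
              (β ^ (M * T₀) * β ^ ((3 * M + 5) * T₀) * β ^ ((M + 2) * T₀)) := by
              refine mul_le_mul (hfac _ _ (ht.le.trans hT'M) ht.le) (h1.trans ?_) (house_nonneg _)
                (by positivity)
              refine mul_le_mul ?_ h2 ?_ (by positivity)
              · exact mul_le_mul_of_nonneg_right hBBr hQ0
              · have := house_nonneg c
                positivity
          _ = (β : ℝ) ^ ((M + 2) * T' + (5 * M + 7) * T₀) := by
              rw [← pow_add, ← pow_add, ← pow_add]; congr 1; ring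
          _ ≤ _ := by
              refine hmono ?_
              calc _ ≤ (M + 2) * T' + (5 * M + 7) * T' := by gcongr
                _ = _ := by ring
      · rw [← hh, hTT]
        exact decay_lt_one (by omega) (Nat.mul_pos (hp1 _) hT1) hlog
  have hfin := order_auxSer_le (T := β ^ I * T₀) hm hmn hd σ hp0 fun t ht => by
    have := hmain I le_rfl 0 (by simp) 1 (one_pow _) t ht
    rwa [cyc_zero] at this
  have hlt : n * B + (n * B + 1) * (B + 2 * (n * B) + 2 * (n * B)) < β ^ I * T₀ := by
    have hn1 : 1 ≤ n := by omega
    have hBβ : B ≤ β * B := Nat.le_mul_of_pos_left _ (by omega)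
    have hnBβ : n * B ≤ β * B := Nat.mul_le_mul_right _ hnβ
    calc n * B + (n * B + 1) * (B + 2 * (n * B) + 2 * (n * B))
        ≤ (β * B) * (β * B) + (β * B + β * B) * (β * B + 2 * (β * B) + 2 * (β * B)) := by
          have i0 : 1 ≤ β * B := Nat.mul_pos (by omega) hB1
          have i1 : n * B ≤ (β * B) * (β * B) := hnBβ.trans (Nat.le_mul_self _)
          exact add_le_add i1 (Nat.mul_le_mul (by omega) (by omega))
      _ = 11 * β ^ 2 * B * B := by ring
      _ < β * β ^ 2 * β ^ (7 * n + 6) * B := by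
          have h11 : 11 < β := by omega
          have : 0 < β ^ 2 := hp1 2
          have : 11 * β ^ 2 < β * β ^ 2 := Nat.mul_lt_mul_of_pos_right h11 this
          refine Nat.mul_lt_mul_of_pos_right ?_ hB1
          exact Nat.mul_lt_mul_of_lt_of_le this hBle (hp1 _)
      _ = β ^ (7 * n + 9) * B := by ring
      _ ≤ β ^ (I + 4) * B := Nat.mul_le_mul_right _ (Nat.pow_le_pow_right (by omega) (by omega))
      _ = _ := by rw [hT₀]; ring
  omega

theorem uPer_transcendental {n m : ℕ} (hm : 0 < m) (hmn : m < n) : ¬ IsAlgebraic ℚ (uPer n m) := by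
  intro halg
  have hn : n ≠ 0 := by omega
  have hζ := Complex.isPrimitiveRoot_exp n hn
  set ζ := Complex.exp (2 * Real.pi * Complex.I / n) with hζd
  have hζi : IsIntegral ℚ ζ :=
    IsIntegral.of_pow (by omega : 0 < n) (by rw [hζ.pow_eq_one]; exact isIntegral_one)
  let K := IntermediateField.adjoin ℚ ({ζ, uPer n m} : Set ℂ)
  have hfd : FiniteDimensional ℚ K := by
    refine IntermediateField.finiteDimensional_adjoin ?_
    rintro x (rfl | rfl)
    · exact hζi
    · exact halg.isIntegral
  have : NumberField K := { to_charZero := inferInstance, to_finiteDimensional := hfd }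
  let ω : K := ⟨ζ, IntermediateField.subset_adjoin _ _ (by simp)⟩
  let c : K := ⟨uPer n m, IntermediateField.subset_adjoin _ _ (by simp)⟩
  have hω : IsPrimitiveRoot ω n :=
    IsPrimitiveRoot.of_map_of_injective (f := algebraMap K ℂ) hζ (algebraMap K ℂ).injective
  have hcalg : IsAlgebraic ℤ c := (IsFractionRing.isAlgebraic_iff ℤ ℚ K).2 (Algebra.IsAlgebraic.isAlgebraic c)
  obtain ⟨y, hy0, hy⟩ := hcalg.exists_integral_multiple
  have hdc : IsIntegral ℤ ((y.natAbs : K) * c) := by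
    have h1 : ((y.natAbs : ℤ) : K) * c = y * c ∨ ((y.natAbs : ℤ) : K) * c = -(y * c) := by
      rcases Int.natAbs_eq y with h | h
      · left; rw [← h]
      · right
        rw [show ((y.natAbs : ℤ)) = -y by omega]; push_cast; ring
    rw [zsmul_eq_mul] at hy
    rw [← Int.cast_natCast]
    rcases h1 with h | h
    · rw [h]; exact hy
    · rw [h]; exact hy.neg
  exact uPer_not_in_numberField hm hmn (Int.natAbs_pos.2 hy0) (algebraMap K ℂ) hω rfl hdc

end

/-- The value `B(1/2, s)`. -/
noncomputable def halfBeta (s : ℝ) : ℝ := Real.Gamma (1 / 2) * Real.Gamma s / Real.Gamma (1 / 2 + s)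

theorem halfBeta_add_one {s : ℝ} (hs : 0 < s) : halfBeta (s + 1) = halfBeta s * (s / (s + 1 / 2)) := by
  have h1 : (1 / 2 + s : ℝ) ≠ 0 := by positivity
  have h2 : Real.Gamma (1 / 2 + s) ≠ 0 := (Real.Gamma_pos_of_pos (by positivity)).ne'
  have h3 : s + 1 / 2 ≠ 0 := by positivity
  unfold halfBeta
  rw [Real.Gamma_add_one hs.ne', ← add_assoc, Real.Gamma_add_one h1]
  field_simp
  ring

theorem halfBeta_natCast (k : ℕ) : halfBeta (k + 1 : ℕ) =
    (k.factorial : ℝ) / ∏ j ∈ Finset.range (k + 1), ((j : ℝ) + 1 / 2) := by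
  induction k with
  | zero =>
    have h : Real.Gamma (1 / 2) ≠ 0 := (Real.Gamma_pos_of_pos (by norm_num)).ne'
    have h2 := Real.Gamma_add_one (s := 1 / 2) (by norm_num)
    simp only [halfBeta, zero_add, Nat.cast_one, Real.Gamma_one, h2, Finset.prod_range_one,
      Nat.factorial_zero, Nat.cast_zero]
    field_simp
  | succ k ih =>
    have hp : ∏ j ∈ Finset.range (k + 1), ((j : ℝ) + 1 / 2) ≠ 0 :=
      Finset.prod_ne_zero_iff.2 fun j _ => by positivity
    have h3 : ((k + 1 : ℕ) : ℝ) + 1 / 2 ≠ 0 := by positivity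
    rw [Nat.cast_succ (k + 1), halfBeta_add_one (by positivity), ih, Finset.prod_range_succ _ (k + 1),
      Nat.factorial_succ, Nat.cast_mul, div_mul_div_comm, mul_comm (k.factorial : ℝ)]

theorem halfBeta_half_odd (k : ℕ) : halfBeta ((2 * (k : ℝ) + 1) / 2) =
    Real.pi * (∏ j ∈ Finset.range k, ((j : ℝ) + 1 / 2)) / (k.factorial : ℝ) := by
  induction k with
  | zero =>
    have h : Real.Gamma (1 / 2 + 1 / 2) = 1 := by norm_num
    simp only [halfBeta, Nat.cast_zero, mul_zero, zero_add, h, Finset.range_zero, Finset.prod_empty,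
      Nat.factorial_zero, Nat.cast_one, Real.Gamma_one_half_eq]
    rw [Real.mul_self_sqrt Real.pi_pos.le, mul_one]
  | succ k ih =>
    have e : (2 * ((k + 1 : ℕ) : ℝ) + 1) / 2 = (2 * (k : ℝ) + 1) / 2 + 1 := by push_cast; ring
    have h1 : (k.factorial : ℝ) ≠ 0 := Nat.cast_ne_zero.2 k.factorial_ne_zero
    have h2 : (k : ℝ) + 1 ≠ 0 := by positivity
    rw [e, halfBeta_add_one (by positivity), ih, Finset.prod_range_succ, Nat.factorial_succ]
    have h3 : (2 * (k : ℝ) + 1) / 2 + 1 / 2 = k + 1 := by ring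
    rw [h3]
    generalize ∏ j ∈ Finset.range k, ((j : ℝ) + 1 / 2) = P
    push_cast
    field_simp

theorem isAlgebraic_halfBeta_of_add {r : ℚ} (hr : 0 < r) (j : ℕ)
    (h : IsAlgebraic ℚ (halfBeta (r + j))) : IsAlgebraic ℚ (halfBeta r) := by
  induction j with
  | zero => simpa using h
  | succ j ih =>
    apply ih
    have hr' : (0 : ℝ) < r := by exact_mod_cast hr
    have hs : (0 : ℝ) < r + j := by positivity
    rw [Nat.cast_succ, ← add_assoc, halfBeta_add_one hs] at h
    have h1 : halfBeta (r + j) = halfBeta (r + j) * ((r + j) / (r + j + 1 / 2)) *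
        (((r + j + 1 / 2) / (r + j) : ℚ) : ℝ) := by
      push_cast
      have : (r + j + 1 / 2 : ℝ) ≠ 0 := by positivity
      field_simp
    rw [h1]
    exact h.mul (isAlgebraic_algebraMap (R := ℚ) (A := ℝ) ((r + j + 1 / 2) / (r + j)))

/-- `B(1/2, s)` is transcendental for positive rational `s` that is not an integer. -/
theorem exists_natCast_of_isAlgebraic_halfBeta {s : ℚ} (hs : 0 < s) (h : IsAlgebraic ℚ (halfBeta s)) :
    ∃ k : ℕ, 0 < k ∧ s = k := by
  have hfl : ((⌊s⌋₊ : ℕ) : ℚ) ≤ s := Nat.floor_le hs.le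
  have hlt := Nat.lt_floor_add_one s
  obtain ⟨r, hr⟩ : ∃ r : ℚ, r = s - ⌊s⌋₊ := ⟨_, rfl⟩
  rcases eq_or_lt_of_le (show 0 ≤ r by linarith) with h0 | h0
  · have hk : s = ⌊s⌋₊ := by linarith
    refine ⟨⌊s⌋₊, ?_, hk⟩
    rw [hk] at hs
    exact_mod_cast hs
  · exfalso
    have hr1 : r < 1 := by linarith
    have hsr : (s : ℝ) = r + (⌊s⌋₊ : ℕ) := by rw [hr]; push_cast; ring
    rw [hsr] at h
    have h1 := isAlgebraic_halfBeta_of_add h0 _ h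
    have hnum : 0 < r.num := Rat.num_pos.2 h0
    have hnd : r.num < r.den := by
      exact Rat.num_lt_denom_iff.2 hr1
    obtain ⟨m, hm⟩ : ∃ m : ℕ, (m : ℤ) = r.num := ⟨r.num.toNat, by omega⟩
    have hm0 : 0 < m := by omega
    have hmn : m < r.den := by omega
    have hrr : (r : ℝ) = m / r.den := by
      rw [Rat.cast_def, ← hm, Int.cast_natCast]
    have h2 := gamma_quotient_eq hm0 hmn
    rw [← hrr] at h2
    have h3 : IsAlgebraic ℚ ((halfBeta r : ℝ) : ℂ) := h1.algebraMap
    have h4 : ((halfBeta r : ℝ) : ℂ) = 2 * uPer r.den m := h2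
    rw [h4] at h3
    have h5 := h3.mul (isAlgebraic_algebraMap (R := ℚ) (A := ℂ) (1 / 2))
    rw [eq_ratCast, show 2 * uPer r.den m * ((1 / 2 : ℚ) : ℂ) = uPer r.den m by push_cast; ring] at h5
    exact uPer_transcendental hm0 hmn h5

theorem isAlgebraic_two_rpow {q : ℚ} (hq : 0 < q) : IsAlgebraic ℚ ((2 : ℝ) ^ ((1 : ℝ) / (q : ℝ))) := by
  have hnum : 0 < q.num := Rat.num_pos.2 hq
  obtain ⟨m, hm⟩ : ∃ m : ℕ, (m : ℤ) = q.num := ⟨q.num.toNat, by omega⟩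
  have hm0 : 0 < m := by omega
  refine IsIntegral.isAlgebraic (IsIntegral.of_pow hm0 ?_)
  have hq' : (q : ℝ) = m / q.den := by rw [Rat.cast_def, ← hm, Int.cast_natCast]
  have : ((2 : ℝ) ^ ((1 : ℝ) / (q : ℝ))) ^ m = ((2 ^ q.den : ℕ) : ℝ) := by
    rw [← Real.rpow_natCast, ← Real.rpow_mul (by norm_num), hq']
    have hm' : (m : ℝ) ≠ 0 := by positivity
    rw [show (1 : ℝ) / (m / q.den) * m = (q.den : ℕ) by field_simp, Real.rpow_natCast]
    push_cast; rfl
  rw [this]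
  exact isIntegral_natCast _

/-- For a positive rational `q`, set `L(q) = 2^{1/q}·B(1/2, 1/(2q))` with
`B(a,b) = Γ(a)Γ(b)/Γ(a+b)` (up to a positive integer factor, the length of the sinusoidal
spiral `r^q = 2cos(qθ)`).  Then `L(q)` is algebraic iff `q = 1/(2k)` for some positive
integer `k`.  Explicitly, `B(1/2, k) = (k-1)!/((1/2)(3/2)⋯(k-1/2))` and
`B(1/2, (2k+1)/2) = π·(1/2)(3/2)⋯(k-1/2)/k!`. -/
theorem stmt_19 (q : ℚ) (hq : 0 < q) :
    (IsAlgebraic ℚ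
        ((2 : ℝ) ^ ((1 : ℝ) / (q : ℝ)) *
          (Real.Gamma (1 / 2) * Real.Gamma (1 / (2 * (q : ℝ))) /
            Real.Gamma (1 / 2 + 1 / (2 * (q : ℝ))))) ↔
      ∃ k : ℕ, 0 < k ∧ q = 1 / (2 * (k : ℚ))) ∧
    (∀ k : ℕ, 0 < k →
      Real.Gamma (1 / 2) * Real.Gamma (k : ℝ) / Real.Gamma (1 / 2 + (k : ℝ)) =
        ((k - 1).factorial : ℝ) / ∏ j ∈ Finset.range k, ((j : ℝ) + 1 / 2)) ∧
    (∀ k : ℕ,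
      Real.Gamma (1 / 2) * Real.Gamma ((2 * (k : ℝ) + 1) / 2) /
          Real.Gamma (1 / 2 + (2 * (k : ℝ) + 1) / 2) =
        Real.pi * (∏ j ∈ Finset.range k, ((j : ℝ) + 1 / 2)) / (k.factorial : ℝ)) := by
  have hvalint : ∀ k : ℕ, 0 < k → halfBeta (k : ℝ) =
      ((k - 1).factorial : ℝ) / ∏ j ∈ Finset.range k, ((j : ℝ) + 1 / 2) := by
    intro k hk
    obtain ⟨k, rfl⟩ := Nat.exists_eq_succ_of_ne_zero hk.ne'
    exact halfBeta_natCast k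
  refine ⟨⟨fun h => ?_, ?_⟩, hvalint, halfBeta_half_odd⟩
  · have h2 := isAlgebraic_two_rpow hq
    have h20 : (2 : ℝ) ^ ((1 : ℝ) / (q : ℝ)) ≠ 0 := (Real.rpow_pos_of_pos (by norm_num) _).ne'
    have h3 := h2.inv.mul h
    rw [← mul_assoc, inv_mul_cancel₀ h20, one_mul] at h3
    have h4 : IsAlgebraic ℚ (halfBeta ((1 / (2 * q) : ℚ) : ℝ)) := by
      push_cast; exact h3
    obtain ⟨k, hk, hk'⟩ := exists_natCast_of_isAlgebraic_halfBeta (by positivity) h4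
    refine ⟨k, hk, ?_⟩
    rw [← hk']
    field_simp
  · rintro ⟨k, hk, rfl⟩
    refine (isAlgebraic_two_rpow hq).mul ?_
    have hk' : (k : ℝ) ≠ 0 := by positivity
    have e : (1 : ℝ) / (2 * ((1 / (2 * (k : ℚ)) : ℚ) : ℝ)) = k := by
      push_cast; field_simp
    rw [e]
    have h1 := hvalint k hk
    unfold halfBeta at h1
    rw [h1]
    have h2 : ((k - 1).factorial : ℝ) / ∏ j ∈ Finset.range k, ((j : ℝ) + 1 / 2) =
        algebraMap ℚ ℝ (((k - 1).factorial : ℚ) / ∏ j ∈ Finset.range k, ((j : ℚ) + 1 / 2)) := by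
      simp
    rw [h2]
    exact isAlgebraic_algebraMap _
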